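/- arXiv:2112.09962 — 5 statements merged into one kernel-verified Lean document; each statement's English description precedes it below -/
import Mathlib

section
/- Let α ≥ -1 and p > 2. Then for every f holomorphic on 𝔻, ‖f‖_{A^p_{(p/2)(α+2)−2}} ≤ (e^{1/e}/√2) · ‖f‖_{A²_α}. -/
open MeasureTheory Set Filter
open scoped ENNReal NNReal Topology

noncomputable section

/-- The open unit disk in `ℂ`. -/
def unitDisk : Set ℂ := Metric.ball 0 1

/-- `c_β(n) = Γ(n+β)/(Γ(β)·n!)`. -/
def ccoef (β : ℝ) (n : ℕ) : ℝ := Real.Gamma (n + β) / (Real.Gamma β * n.factorial)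

/-- The `n`-th Taylor coefficient of `f` at the origin. -/
def taylorCoeff (f : ℂ → ℂ) (n : ℕ) : ℂ := iteratedDeriv n f 0 / n.factorial

/-- The square of the `A²_α` norm, `∑ |a_n|²/c_{α+2}(n)`, valued in `[0,∞]`. -/
def A2normSq (α : ℝ) (f : ℂ → ℂ) : ℝ≥0∞ :=
  ∑' n : ℕ, ENNReal.ofReal (‖taylorCoeff f n‖ ^ 2 / ccoef (α + 2) n)

/-- The `A²_α` norm (Hardy `H²` norm when `α = -1`). -/
def A2norm (α : ℝ) (f : ℂ → ℂ) : ℝ≥0∞ := A2normSq α f ^ (1 / 2 : ℝ)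

/-- The `p`-th power of the weighted Bergman norm `‖f‖_{A^p_β}`, valued in `[0,∞]`:
`(β+1) ∫_𝔻 (1-|z|²)^β |f z|^p dA(z)` with `dA` the normalized area measure. -/
def ApIntPow (p β : ℝ) (f : ℂ → ℂ) : ℝ≥0∞ :=
  ENNReal.ofReal (β + 1) *
    (∫⁻ z in unitDisk, ENNReal.ofReal ((1 - ‖z‖ ^ 2) ^ β * ‖f z‖ ^ p)) / ENNReal.ofReal Real.pi

/-- The weighted Bergman norm `‖f‖_{A^p_β}`, valued in `[0,∞]`. -/
def ApNorm (p β : ℝ) (f : ℂ → ℂ) : ℝ≥0∞ := ApIntPow p β f ^ (1 / p)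

/-- The inner integral `∫₀¹ s^{α+1}/(1-(1-|z|²)s) ds`, valued in `[0,∞]`. -/
def Hinner (α : ℝ) (z : ℂ) : ℝ≥0∞ :=
  ∫⁻ s in Set.Ioo (0 : ℝ) 1, ENNReal.ofReal (s ^ (α + 1) / (1 - (1 - ‖z‖ ^ 2) * s))

/-- The quantity `F_p(f)`. -/
def Ffun (α p : ℝ) (f : ℂ → ℂ) : ℝ≥0∞ :=
  ENNReal.ofReal (‖f 0‖ ^ p) +
    ENNReal.ofReal (p / 2) *
      (∫⁻ z in unitDisk,
        ENNReal.ofReal (‖deriv f z‖ ^ 2 * ‖f z‖ ^ (p - 2) * (1 - ‖z‖ ^ 2) ^ (p * (α + 2) / 2)) *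
          Hinner α z) / ENNReal.ofReal Real.pi

/-- The quantity `G_p(f)`. -/
def Gfun (α p : ℝ) (f : ℂ → ℂ) : ℝ≥0∞ :=
  ENNReal.ofReal (p / (2 * (α + 2))) *
    (∫⁻ z in unitDisk,
      ENNReal.ofReal (‖deriv f z‖ ^ 2 * ‖f z‖ ^ (p - 2) * (1 - ‖z‖ ^ 2) ^ (p * (α + 2) / 2))) /
    ENNReal.ofReal Real.pi

theorem measurableSet_unitDisk : MeasurableSet unitDisk := Metric.isOpen_ball.measurableSet

theorem mem_unitDisk {z : ℂ} : z ∈ unitDisk ↔ ‖z‖ < 1 := by simp [unitDisk]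

theorem one_sub_norm_sq_pos {z : ℂ} (hz : z ∈ unitDisk) : 0 < 1 - ‖z‖ ^ 2 := by
  have := mem_unitDisk.1 hz
  nlinarith [norm_nonneg z]

theorem hasDerivAt_one_sub_sq_rpow {r s : ℝ} (hr : 0 < r) (hr1 : r < 1) :
    HasDerivAt (fun x : ℝ => (1 - x ^ 2) ^ s) (-(2 * s * r * (1 - r ^ 2) ^ (s - 1))) r := by
  have h1 : HasDerivAt (fun x : ℝ => 1 - x ^ 2) (-(2 * r)) r := by
    simpa using (hasDerivAt_pow 2 r).const_sub 1
  have := h1.rpow_const (p := s) (Or.inl (by nlinarith))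
  convert this using 1
  ring

theorem continuous_one_sub_sq_rpow {s : ℝ} (hs : 0 ≤ s) :
    Continuous (fun x : ℝ => (1 - x ^ 2) ^ s) :=
  (by fun_prop : Continuous fun x : ℝ => 1 - x ^ 2).rpow_const fun _ => Or.inr hs

theorem integrableOn_mul_one_sub_sq_rpow {s : ℝ} (hs : -1 < s) :
    IntegrableOn (fun r : ℝ => r * (1 - r ^ 2) ^ s) (Ioo 0 1) := by
  have h := intervalIntegral.integrableOn_deriv_of_nonneg (a := 0) (b := 1)
    (g := fun x : ℝ => -((1 - x ^ 2) ^ (s + 1))) (g' := fun r => 2 * (s + 1) * (r * (1 - r ^ 2) ^ s))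
    (continuous_one_sub_sq_rpow (by linarith)).neg.continuousOn
    (fun x hx => by
      refine (hasDerivAt_one_sub_sq_rpow (s := s + 1) hx.1 hx.2).neg.congr_deriv ?_
      rw [add_sub_cancel_right]
      ring)
    (fun x hx => by
      have := hx.1
      have : 0 ≤ 1 - x ^ 2 := by nlinarith [hx.2]
      have : 0 < s + 1 := by linarith
      positivity)
  rw [integrableOn_Ioc_iff_integrableOn_Ioo] at h
  have h2 := h.const_mul (2 * (s + 1))⁻¹
  refine h2.congr (ae_of_all _ fun x => ?_)
  have : s + 1 ≠ 0 := by linarith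
  simp only
  field_simp

theorem integrableOn_diskWeight {s : ℝ} (hs : -1 < s) :
    IntegrableOn (fun z : ℂ => (1 - ‖z‖ ^ 2) ^ s) unitDisk := by
  rw [← integrable_indicator_iff measurableSet_unitDisk]
  have key := integrable_fun_norm_addHaar (volume : Measure ℂ)
    (f := (Iio (1 : ℝ)).indicator fun r : ℝ => (1 - r ^ 2) ^ s)
  have e : (fun z : ℂ => (Iio (1 : ℝ)).indicator (fun r : ℝ => (1 - r ^ 2) ^ s) ‖z‖) =
      unitDisk.indicator (fun z : ℂ => (1 - ‖z‖ ^ 2) ^ s) := by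
    ext z
    by_cases hz : ‖z‖ < 1 <;> simp [indicator, mem_unitDisk, hz]
  rw [← e, key, Complex.finrank_real_complex]
  have h := (integrableOn_mul_one_sub_sq_rpow hs)
  rw [← integrable_indicator_iff measurableSet_Ioo] at h
  refine IntegrableOn.congr_fun h.integrableOn (fun x hx => ?_) measurableSet_Ioi
  have hx : 0 < x := hx
  by_cases h1 : x < 1 <;> simp [indicator, h1, hx]

theorem integrableOn_mul_diskWeight {g : ℂ → ℝ} (hg : Continuous g) {s : ℝ} (hs : -1 < s) :
    IntegrableOn (fun z : ℂ => g z * (1 - ‖z‖ ^ 2) ^ s) unitDisk := by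
  obtain ⟨C, hC⟩ := (isCompact_closedBall (0 : ℂ) 1).exists_bound_of_continuousOn hg.continuousOn
  refine Integrable.bdd_mul (c := C) (integrableOn_diskWeight hs) hg.aestronglyMeasurable ?_
  refine (ae_restrict_mem measurableSet_unitDisk).mono fun z hz => hC z ?_
  exact Metric.ball_subset_closedBall hz

theorem setIntegral_unitDisk_polar {E : Type*} [NormedAddCommGroup E] [NormedSpace ℝ E]
    (F : ℂ → E) :
    ∫ z in unitDisk, F z =
      ∫ q in Ioo (0 : ℝ) 1 ×ˢ Ioo (-Real.pi) Real.pi,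
        q.1 • F (q.1 * Complex.exp (q.2 * Complex.I)) := by
  rw [← integral_indicator measurableSet_unitDisk, ← Complex.integral_comp_polarCoord_symm,
    polarCoord_target]
  have hsub : Ioo (0 : ℝ) 1 ×ˢ Ioo (-Real.pi) Real.pi ⊆ Ioi (0 : ℝ) ×ˢ Ioo (-Real.pi) Real.pi :=
    prod_mono Ioo_subset_Ioi_self le_rfl
  symm
  rw [setIntegral_eq_of_subset_of_forall_sdiff_eq_zero
    (measurableSet_Ioi.prod measurableSet_Ioo) hsub]
  rotate_left
  · rintro ⟨r, θ⟩ ⟨⟨hr, hθ⟩, hn⟩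
    have hr : 0 < r := hr
    have : ¬ ‖Complex.polarCoord.symm (r, θ)‖ < 1 := by
      rw [Complex.norm_polarCoord_symm, abs_of_pos hr]
      intro h
      exact hn ⟨⟨hr, h⟩, hθ⟩
    rw [indicator_of_notMem (by rwa [mem_unitDisk]), smul_zero]
  · refine setIntegral_congr_fun (measurableSet_Ioo.prod measurableSet_Ioo) fun q hq => ?_
    have h : Complex.polarCoord.symm q = q.1 * Complex.exp (q.2 * Complex.I) := by
      rw [Complex.polarCoord_symm_apply, Complex.exp_mul_I, Complex.ofReal_cos, Complex.ofReal_sin]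
    rw [indicator_of_mem, h]
    rw [mem_unitDisk, Complex.norm_polarCoord_symm, abs_of_pos hq.1.1]
    exact hq.1.2

theorem radial_divergence {v : ℂ → ℝ} {v' : ℂ → ℂ →L[ℝ] ℝ} (hv : ∀ z, HasFDerivAt v (v' z) z)
    (hv' : Continuous fun z => v' z z) {s : ℝ} (hs : 0 < s) :
    ∫ z in unitDisk, ((2 * v z + v' z z) * (1 - ‖z‖ ^ 2) - 2 * s * ‖z‖ ^ 2 * v z) *
      (1 - ‖z‖ ^ 2) ^ (s - 1) = 0 := by
  have hvc : Continuous v := continuous_iff_continuousAt.2 fun z => (hv z).continuousAt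
  obtain ⟨Q, hQ⟩ : ∃ Q : ℂ → ℝ, ∀ z,
      (2 * v z + v' z z) * (1 - ‖z‖ ^ 2) - 2 * s * ‖z‖ ^ 2 * v z = Q z := ⟨_, fun _ => rfl⟩
  have hQc : Continuous Q := by
    rw [show Q = _ from funext fun z => (hQ z).symm]
    exact (((continuous_const.mul hvc).add hv').mul (by fun_prop)).sub (by fun_prop)
  simp_rw [hQ]
  have hnorm : ∀ r : ℝ, 0 < r → ∀ θ : ℝ, ‖(r : ℂ) * Complex.exp (θ * Complex.I)‖ = r := by
    intro r hr θ
    rw [norm_mul, Complex.norm_exp_ofReal_mul_I, Complex.norm_real, mul_one, Real.norm_of_nonneg hr.le]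
  rw [setIntegral_unitDisk_polar, Measure.volume_eq_prod, ← Measure.prod_restrict,
    integral_prod_symm]
  · refine integral_eq_zero_of_ae (ae_of_all _ fun θ => ?_)
    set e := Complex.exp (θ * Complex.I) with he
    have hd : ∀ r ∈ Ioo (0 : ℝ) 1, HasDerivAt (fun r : ℝ => r ^ 2 * v (r * e) * (1 - r ^ 2) ^ s)
        (r • (Q (r * e) * (1 - ‖(r : ℂ) * e‖ ^ 2) ^ (s - 1))) r := by
      intro r hr
      have h1 : HasDerivAt (fun r : ℝ => (r : ℂ) * e) e r := by
        simpa using (Complex.ofRealCLM.hasDerivAt (x := r)).mul_const e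
      have h2 := (hv (r * e)).comp_hasDerivAt r h1
      have h3 := ((hasDerivAt_pow 2 r).mul h2).mul (hasDerivAt_one_sub_sq_rpow (s := s) hr.1 hr.2)
      refine h3.congr_deriv ?_
      have h4 : v' (r * e) (r * e) = r * v' (r * e) e := by
        have : (r : ℂ) * e = r • e := by simp
        conv_lhs => rw [this, map_smul, ← this]
        rfl
      have h5 : (1 - r ^ 2) ^ s = (1 - r ^ 2) * (1 - r ^ 2) ^ (s - 1) := by
        have : 0 < 1 - r ^ 2 := by nlinarith [hr.1, hr.2]
        rw [← Real.rpow_one_add' this.le (by linarith)]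
        congr 1; ring
      rw [smul_eq_mul, ← hQ, he, hnorm r hr.1 θ, ← he, h4, h5, Pi.mul_apply, Function.comp_apply]
      push_cast
      ring
    have hint : IntegrableOn (fun r : ℝ => r • (Q (r * e) * (1 - ‖(r : ℂ) * e‖ ^ 2) ^ (s - 1)))
        (Ioo 0 1) := by
      obtain ⟨C, hC⟩ := (isCompact_Icc (a := (0 : ℝ)) (b := 1)).exists_bound_of_continuousOn
        (f := fun r : ℝ => Q (r * e)) (by fun_prop)
      have := Integrable.bdd_mul (c := C) (integrableOn_mul_one_sub_sq_rpow (s := s - 1) (by linarith))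
        (f := fun r : ℝ => Q (r * e)) (by fun_prop) ((ae_restrict_mem measurableSet_Ioo).mono
          fun z hz => hC z (Ioo_subset_Icc_self hz))
      refine IntegrableOn.congr_fun this (fun r hr => ?_) measurableSet_Ioo
      simp only [he, hnorm r hr.1 θ, smul_eq_mul]
      ring
    have hc : ContinuousOn (fun r : ℝ => r ^ 2 * v (r * e) * (1 - r ^ 2) ^ s) (Icc 0 1) := by
      have := continuous_one_sub_sq_rpow hs.le
      fun_prop
    have := intervalIntegral.integral_eq_sub_of_hasDerivAt_of_le zero_le_one hc hd
      ((intervalIntegrable_iff_integrableOn_Ioo_of_le zero_le_one).2 hint)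
    rw [intervalIntegral.integral_of_le zero_le_one, integral_Ioc_eq_integral_Ioo] at this
    simp only [Pi.zero_apply]
    rw [this]
    simp [Real.zero_rpow hs.ne']
  · obtain ⟨C, hC⟩ := (isCompact_closedBall (0 : ℂ) 1).exists_bound_of_continuousOn hQc.continuousOn
    have h1 := (integrableOn_mul_one_sub_sq_rpow (s := s - 1) (by linarith)).comp_fst
      (ν := (volume : Measure ℝ).restrict (Ioo (-Real.pi) Real.pi))
    have h2 := h1.bdd_mul (c := C) (f := fun q : ℝ × ℝ => Q (q.1 * Complex.exp (q.2 * Complex.I)))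
      (by fun_prop) (by
        rw [Measure.prod_restrict]
        refine (ae_restrict_mem (measurableSet_Ioo.prod measurableSet_Ioo)).mono fun q hq => hC _ ?_
        simp only [mem_closedBall_zero_iff, hnorm q.1 hq.1.1]
        exact hq.1.2.le)
    rw [Measure.prod_restrict] at h2 ⊢
    refine IntegrableOn.congr_fun h2 (fun q hq => ?_) (measurableSet_Ioo.prod measurableSet_Ioo)
    simp only [hnorm q.1 hq.1.1, smul_eq_mul]
    ring

theorem hasDerivAt_max_zero_rpow {b : ℝ} (hb : 1 < b) (x : ℝ) :
    HasDerivAt (fun y : ℝ => max 0 y ^ b) (b * max 0 x ^ (b - 1)) x := by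
  have hb0 : b ≠ 0 := by linarith
  have hb1 : b - 1 ≠ 0 := by linarith
  rcases lt_trichotomy x 0 with hx | rfl | hx
  · rw [max_eq_left hx.le, Real.zero_rpow hb1, mul_zero]
    refine (hasDerivAt_const x (0 : ℝ)).congr_of_eventuallyEq ?_
    filter_upwards [gt_mem_nhds hx] with y hy
    rw [max_eq_left hy.le, Real.zero_rpow hb0]
  · have h1 : HasDerivWithinAt (fun y : ℝ => max 0 y ^ b) (b * max 0 0 ^ (b - 1)) (Iic 0) 0 := by
      rw [max_self, Real.zero_rpow hb1, mul_zero]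
      refine (hasDerivWithinAt_const 0 _ (0 : ℝ)).congr (fun y hy => ?_) ?_
      · rw [max_eq_left hy, Real.zero_rpow hb0]
      · rw [max_self, Real.zero_rpow hb0]
    have h2 : HasDerivWithinAt (fun y : ℝ => max 0 y ^ b) (b * max 0 0 ^ (b - 1)) (Ici 0) 0 := by
      rw [max_self]
      refine (Real.hasDerivAt_rpow_const (Or.inr hb.le)).hasDerivWithinAt.congr (fun y hy => ?_) ?_
      · rw [max_eq_right hy]
      · rw [max_self]
    simpa using h1.union h2
  · rw [max_eq_right hx.le]
    refine (Real.hasDerivAt_rpow_const (Or.inl hx.ne')).congr_of_eventuallyEq ?_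
    filter_upwards [lt_mem_nhds hx] with y hy
    rw [max_eq_right hy.le]

theorem integrable_of_support_subset_unitDisk {E : Type*} [NormedAddCommGroup E] {k : ℂ → E}
    (hk : AEStronglyMeasurable k) (h0 : ∀ z, z ∉ unitDisk → k z = 0) {C : ℝ}
    (hC : ∀ z ∈ unitDisk, ‖k z‖ ≤ C) : Integrable k := by
  rw [← integrableOn_iff_integrable_of_support_subset (s := unitDisk)
    (fun z hz => by_contra fun h => hz (h0 z h))]
  exact Measure.integrableOn_of_bounded (M := C) (Metric.isBounded_ball.measure_lt_top).ne
    hk ((ae_restrict_mem measurableSet_unitDisk).mono hC)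

theorem setIntegral_dbar_mul_diskWeight {h : ℂ → ℂ} (hh : Differentiable ℝ h)
    {C : ℝ} (hC1 : ∀ z ∈ unitDisk, ‖fderiv ℝ h z 1‖ ≤ C)
    (hCI : ∀ z ∈ unitDisk, ‖fderiv ℝ h z Complex.I‖ ≤ C) {b : ℝ} (hb : 1 < b) :
    ∫ z in unitDisk, (1 - ‖z‖ ^ 2) ^ b • (fderiv ℝ h z 1 + Complex.I * fderiv ℝ h z Complex.I) =
      2 * b * ∫ z in unitDisk, (1 - ‖z‖ ^ 2) ^ (b - 1) • (h z * z) := by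
  set W : ℂ → ℝ := fun z => max 0 (1 - ‖z‖ ^ 2) ^ b with hW
  set W' : ℂ → ℂ →L[ℝ] ℝ := fun z =>
    (b * max 0 (1 - ‖z‖ ^ 2) ^ (b - 1)) • (-(2 • innerSL ℝ z)) with hW'
  have hWd : ∀ z, HasFDerivAt W (W' z) z := by
    intro z
    have h1 : HasFDerivAt (fun z : ℂ => 1 - ‖z‖ ^ 2) (-(2 • innerSL ℝ z)) z :=
      (hasStrictFDerivAt_norm_sq z).hasFDerivAt.const_sub 1
    exact (hasDerivAt_max_zero_rpow hb _).comp_hasFDerivAt z h1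
  have hin : ∀ z ∈ unitDisk, max 0 (1 - ‖z‖ ^ 2) = 1 - ‖z‖ ^ 2 := fun z hz =>
    max_eq_right (one_sub_norm_sq_pos hz).le
  have hout : ∀ z, z ∉ unitDisk → max 0 (1 - ‖z‖ ^ 2) = 0 := fun z hz => by
    rw [mem_unitDisk, not_lt] at hz
    exact max_eq_left (by nlinarith)
  have hmc : Continuous fun z : ℂ => max 0 (1 - ‖z‖ ^ 2) := by fun_prop
  have hWc : Continuous W := hmc.rpow_const fun _ => Or.inr (by linarith)
  have hV : Continuous fun z : ℂ => max 0 (1 - ‖z‖ ^ 2) ^ (b - 1) :=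
    hmc.rpow_const fun _ => Or.inr (by linarith)
  have hle : ∀ (z : ℂ) (c : ℝ), 0 ≤ c → |max 0 (1 - ‖z‖ ^ 2) ^ c| ≤ 1 := fun z c hc => by
    rw [abs_of_nonneg (by positivity)]
    exact Real.rpow_le_one (by positivity) (max_le zero_le_one (by nlinarith [norm_nonneg z])) hc
  have hW0 : ∀ z, z ∉ unitDisk → W z = 0 := fun z hz => by
    simp only [hW]; rw [hout z hz, Real.zero_rpow (by linarith)]
  have hW'0 : ∀ z, z ∉ unitDisk → ∀ v, W' z v = 0 := fun z hz v => by
    simp only [hW']; rw [hout z hz, Real.zero_rpow (by linarith)]; simp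
  obtain ⟨D, hD⟩ := (isCompact_closedBall (0 : ℂ) 1).exists_bound_of_continuousOn
    hh.continuous.continuousOn
  have hD' : ∀ z ∈ unitDisk, ‖h z‖ ≤ D := fun z hz => hD z (Metric.ball_subset_closedBall hz)
  have key : ∀ v : ℂ, (∀ z ∈ unitDisk, ‖fderiv ℝ h z v‖ ≤ C) →
      Integrable (fun z => W z • fderiv ℝ h z v) ∧ Integrable (fun z => W' z v • h z) ∧
      ∫ z, W' z v • h z = - ∫ z, W z • fderiv ℝ h z v := by
    intro v hv
    have i1 : Integrable (fun z => W z • fderiv ℝ h z v) := by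
      refine integrable_of_support_subset_unitDisk (C := C) ?_ (fun z hz => by simp [hW0 z hz]) ?_
      · exact AEStronglyMeasurable.smul (𝕜 := ℝ) hWc.aestronglyMeasurable
          (measurable_fderiv_apply_const ℝ h v).aestronglyMeasurable
      · intro z hz
        rw [norm_smul, Real.norm_eq_abs]
        have := hle z b (by linarith)
        have h2 := hv z hz
        nlinarith [norm_nonneg (fderiv ℝ h z v)]
    have i3 : Integrable (fun z => W z • h z) := by
      refine integrable_of_support_subset_unitDisk (C := D) ?_ (fun z hz => by simp [hW0 z hz]) ?_
      · exact (Continuous.smul (M := ℝ) hWc hh.continuous).aestronglyMeasurable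
      · intro z hz
        rw [norm_smul, Real.norm_eq_abs]
        have := hle z b (by linarith)
        have h2 := hD' z hz
        nlinarith [norm_nonneg (h z)]
    have hcont : Continuous fun z => W' z v • h z := by
      refine Continuous.smul (M := ℝ) ?_ hh.continuous
      simp only [hW', smul_apply, neg_apply,
        innerSL_apply_apply, smul_eq_mul]
      fun_prop
    have i2 : Integrable (fun z => W' z v • h z) := by
      obtain ⟨K, hK⟩ := (isCompact_closedBall (0 : ℂ) 1).exists_bound_of_continuousOn
        hcont.continuousOn
      exact integrable_of_support_subset_unitDisk (C := K) hcont.aestronglyMeasurable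
        (fun z hz => by simp [hW'0 z hz]) fun z hz => hK z (Metric.ball_subset_closedBall hz)
    refine ⟨i1, i2, ?_⟩
    exact integral_bilinear_hasFDerivAt_right_eq_neg_left_of_integrable
      (B := (ContinuousLinearMap.lsmul ℝ ℝ : ℝ →L[ℝ] ℂ →L[ℝ] ℂ).flip) (f := h) (g := W)
      (f' := fun z => fderiv ℝ h z) (g' := W') (v := v) (μ := volume) i1 i2 i3
      (fun z _ => (hh z).hasFDerivAt) (fun z _ => hWd z)
  obtain ⟨a1, a2, a3⟩ := key 1 hC1
  obtain ⟨b1, b2, b3⟩ := key Complex.I hCI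
  have hL : ∫ z in unitDisk, (1 - ‖z‖ ^ 2) ^ b •
      (fderiv ℝ h z 1 + Complex.I * fderiv ℝ h z Complex.I) =
      (∫ z, W z • fderiv ℝ h z 1) + Complex.I * ∫ z, W z • fderiv ℝ h z Complex.I := by
    rw [← integral_const_mul, ← integral_add a1 (b1.const_mul _)]
    refine Eq.trans ?_ (setIntegral_eq_integral_of_forall_compl_eq_zero (s := unitDisk) ?_)
    · refine setIntegral_congr_fun measurableSet_unitDisk fun z hz => ?_
      simp only [hW]
      rw [hin z hz, smul_add, mul_smul_comm]
    · intro z hz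
      simp [hW0 z hz]
  have hR : 2 * b * ∫ z in unitDisk, (1 - ‖z‖ ^ 2) ^ (b - 1) • (h z * z) =
      -((∫ z, W' z 1 • h z) + Complex.I * ∫ z, W' z Complex.I • h z) := by
    rw [← integral_const_mul, ← integral_const_mul, ← integral_add a2 (b2.const_mul _),
      ← integral_neg]
    refine Eq.trans ?_ (setIntegral_eq_integral_of_forall_compl_eq_zero (s := unitDisk) ?_)
    · refine setIntegral_congr_fun measurableSet_unitDisk fun z hz => ?_
      simp only [hW', smul_apply, neg_apply,
        innerSL_apply_apply, smul_eq_mul, Complex.inner]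
      rw [hin z hz]
      have e := Complex.re_add_im z
      simp only [Complex.real_smul, Complex.conj_re, Complex.mul_re, Complex.one_re, Complex.one_im,
        Complex.I_re, Complex.I_im, Complex.conj_im]
      push_cast
      linear_combination (-2 * b * (((1 - ‖z‖ ^ 2) ^ (b - 1) : ℝ) : ℂ) * h z) * e
    · intro z hz
      simp [hW'0 z hz]
  rw [hL, hR, a3, b3]
  ring

theorem hasFDerivAt_norm_rpow_mul_conj {p : ℝ} (hp : 2 < p) (w : ℂ) :
    HasFDerivAt (fun w : ℂ => ((‖w‖ ^ (p - 2) : ℝ) : ℂ) * (starRingEnd ℂ) w)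
      (((p - 2) * ‖w‖ ^ (p - 4)) • (innerSL ℝ w).smulRight ((starRingEnd ℂ) w) +
        ‖w‖ ^ (p - 2) • (Complex.conjCLE : ℂ →L[ℝ] ℂ)) w := by
  rcases eq_or_ne w 0 with rfl | hw
  · have h1 := hasFDerivAt_norm_rpow (0 : ℂ) (p := p - 1) (by linarith)
    rw [hasFDerivAt_iff_isLittleO_nhds_zero] at h1 ⊢
    refine Asymptotics.IsLittleO.congr' (f₁ := fun u : ℂ => ((‖u‖ ^ (p - 2) : ℝ) : ℂ) *
      (starRingEnd ℂ) u) (g₁ := fun u => u) ?_ (Eventually.of_forall fun u => ?_) EventuallyEq.rfl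
    · refine Asymptotics.IsLittleO.of_norm_left ?_
      have : ∀ u : ℂ, ‖((‖u‖ ^ (p - 2) : ℝ) : ℂ) * (starRingEnd ℂ) u‖ = ‖u‖ ^ (p - 1) := by
        intro u
        rw [norm_mul, Complex.norm_real, RCLike.norm_conj, Real.norm_of_nonneg (by positivity),
          ← Real.rpow_add_one' (norm_nonneg _) (by linarith)]
        congr 1; ring
      simp_rw [this]
      refine h1.congr_left fun u => ?_
      simp [Real.zero_rpow (show p - 1 ≠ 0 by linarith)]
    · simp [Real.zero_rpow (show p - 2 ≠ 0 by linarith)]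
  · have hpos : 0 < ‖w‖ := norm_pos_iff.2 hw
    have h1 : HasFDerivAt (fun w : ℂ => (‖w‖ ^ 2) ^ ((p - 2) / 2))
        (((p - 2) * ‖w‖ ^ (p - 4)) • innerSL ℝ w) w := by
      have := (hasStrictFDerivAt_norm_sq w).hasFDerivAt.rpow_const (p := (p - 2) / 2)
        (Or.inl (by positivity))
      refine this.congr_fderiv ?_
      rw [← Real.rpow_natCast, ← Real.rpow_mul hpos.le]
      ext u
      simp only [smul_apply, smul_eq_mul, nsmul_eq_mul]
      rw [show ((2 : ℕ) : ℝ) * ((p - 2) / 2 - 1) = p - 4 by push_cast; ring]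
      push_cast
      ring
    have h2 : HasFDerivAt (fun w : ℂ => ‖w‖ ^ (p - 2))
        (((p - 2) * ‖w‖ ^ (p - 4)) • innerSL ℝ w) w := by
      refine h1.congr_of_eventuallyEq (Eventually.of_forall fun u => ?_)
      simp only
      rw [← Real.rpow_natCast, ← Real.rpow_mul (norm_nonneg _)]
      congr 1; push_cast; ring
    have h3 := h2.smul (Complex.conjCLE.toContinuousLinearMap.hasFDerivAt (x := w))
    refine (h3.congr_fderiv ?_).congr_of_eventuallyEq (Eventually.of_forall fun u => ?_)
    · ext u
      simp
      ring
    · simp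

theorem continuous_norm_eval_rpow (P : Polynomial ℂ) {s : ℝ} (hs : 0 ≤ s) :
    Continuous fun z => ‖P.eval z‖ ^ s :=
  P.continuous.norm.rpow_const fun _ => Or.inr hs

theorem hasFDerivAt_eval (P : Polynomial ℂ) (z : ℂ) :
    HasFDerivAt (fun z => P.eval z)
      (P.derivative.eval z • (1 : ℂ →L[ℝ] ℂ)) z := by
  have := (P.hasDerivAt z).hasFDerivAt.restrictScalars ℝ
  refine this.congr_fderiv ?_
  ext u
  simp [mul_comm]

theorem setIntegral_laplacian_eval (P : Polynomial ℂ) {p b : ℝ} (hp : 2 < p) (hb : 1 < b) :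
    p * ∫ z in unitDisk, ‖P.derivative.eval z‖ ^ 2 * ‖P.eval z‖ ^ (p - 2) * (1 - ‖z‖ ^ 2) ^ b =
      2 * b * ∫ z in unitDisk, ‖P.eval z‖ ^ (p - 2) *
        inner ℝ (P.eval z) (P.derivative.eval z * z) * (1 - ‖z‖ ^ 2) ^ (b - 1) := by
  set P' := P.derivative with hP'
  set φ : ℂ → ℂ := fun w => ((‖w‖ ^ (p - 2) : ℝ) : ℂ) * (starRingEnd ℂ) w with hφ
  set φ' : ℂ → ℂ →L[ℝ] ℂ := fun w => ((p - 2) * ‖w‖ ^ (p - 4)) •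
    (innerSL ℝ w).smulRight ((starRingEnd ℂ) w) + ‖w‖ ^ (p - 2) • (Complex.conjCLE : ℂ →L[ℝ] ℂ)
    with hφ'
  set h : ℂ → ℂ := fun z => φ (P.eval z) * P'.eval z with hh
  have hmul : ∀ w : ℂ, ‖w‖ ^ (p - 4) * ‖w‖ ^ 2 = ‖w‖ ^ (p - 2) := fun w => by
    rw [← Real.rpow_add_natCast' (norm_nonneg _) (by push_cast; linarith)]
    congr 1; push_cast; ring
  have hφ1 : ∀ w u, ‖φ' w u‖ ≤ (p - 1) * ‖w‖ ^ (p - 2) * ‖u‖ := by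
    intro w u
    have h1 : |inner ℝ w u| ≤ ‖w‖ * ‖u‖ := abs_real_inner_le_norm w u
    simp only [hφ', add_apply, smul_apply, ContinuousLinearMap.smulRight_apply, innerSL_apply_apply]
    calc _ ≤ _ := norm_add_le _ _
      _ = (p - 2) * ‖w‖ ^ (p - 4) * (|inner ℝ w u| * ‖w‖) + ‖w‖ ^ (p - 2) * ‖u‖ := by
        have h2 : 0 ≤ ‖w‖ ^ (p - 4) := by positivity
        have h3 : 0 ≤ ‖w‖ ^ (p - 2) := by positivity
        have h4 : 0 < p - 2 := by linarith
        simp only [norm_smul, norm_mul, Real.norm_eq_abs, RCLike.norm_conj, abs_of_nonneg h2,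
          abs_of_nonneg h3, abs_of_pos h4, ContinuousLinearEquiv.coe_coe, Complex.conjCLE_apply]
      _ ≤ (p - 2) * ‖w‖ ^ (p - 4) * (‖w‖ * ‖u‖ * ‖w‖) + ‖w‖ ^ (p - 2) * ‖u‖ := by
        have h4 : 0 < p - 2 := by linarith
        gcongr
      _ = (p - 1) * ‖w‖ ^ (p - 2) * ‖u‖ := by rw [← hmul w]; ring
  have hφ2 : ∀ w u, φ' w u + Complex.I * φ' w (Complex.I * u) =
      (p * ‖w‖ ^ (p - 2) : ℝ) * (starRingEnd ℂ) u := by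
    intro w u
    have h5 : (starRingEnd ℂ) w * w = ((‖w‖ ^ 2 : ℝ) : ℂ) := by
      rw [mul_comm, Complex.mul_conj, Complex.normSq_eq_norm_sq]
    have h6 : ((inner ℝ w u : ℝ) : ℂ) + Complex.I * (inner ℝ w (Complex.I * u) : ℝ) =
        w * (starRingEnd ℂ) u := by
      simp only [Complex.inner]
      apply Complex.ext <;> simp <;> ring
    simp only [hφ', add_apply, smul_apply, ContinuousLinearMap.smulRight_apply, innerSL_apply_apply,
      ContinuousLinearEquiv.coe_coe, Complex.conjCLE_apply, map_mul, Complex.conj_I,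
      Complex.real_smul]
    have h7 := congrArg (fun x : ℝ => (x : ℂ)) (hmul w)
    push_cast at h5 h6 h7 ⊢
    linear_combination (((p : ℂ) - 2) * ((‖w‖ ^ (p - 4) : ℝ) : ℂ) * (starRingEnd ℂ) w) * h6 +
      ((p : ℂ) - 2) * (starRingEnd ℂ) u * h7 +
      (((p : ℂ) - 2) * ((‖w‖ ^ (p - 4) : ℝ) : ℂ) * (starRingEnd ℂ) u) * h5 -
      ((‖w‖ ^ (p - 2) : ℝ) : ℂ) * (starRingEnd ℂ) u * Complex.I_mul_I
  have hd : ∀ z, HasFDerivAt h (φ (P.eval z) • (P'.derivative.eval z • (1 : ℂ →L[ℝ] ℂ)) +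
      P'.eval z • ((φ' (P.eval z)).comp (P'.eval z • (1 : ℂ →L[ℝ] ℂ)))) z := fun z =>
    ((hasFDerivAt_norm_rpow_mul_conj hp (P.eval z)).comp z (hasFDerivAt_eval P z)).mul
      (hasFDerivAt_eval P' z)
  have hfd : ∀ z v, fderiv ℝ h z v = φ (P.eval z) * (P'.derivative.eval z * v) +
      P'.eval z * φ' (P.eval z) (P'.eval z * v) := fun z v => by
    rw [(hd z).fderiv]; rfl
  have hφn : ∀ w, ‖φ w‖ = ‖w‖ ^ (p - 2) * ‖w‖ := fun w => by
    simp only [hφ, norm_mul, Complex.norm_real, RCLike.norm_conj]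
    rw [Real.norm_of_nonneg (by positivity)]
  have hK : Continuous fun z => ‖P.eval z‖ ^ (p - 2) * ‖P.eval z‖ * ‖P'.derivative.eval z‖ +
      ‖P'.eval z‖ * ((p - 1) * ‖P.eval z‖ ^ (p - 2) * ‖P'.eval z‖) := by
    have := continuous_norm_eval_rpow P (s := p - 2) (by linarith)
    fun_prop
  obtain ⟨C, hC⟩ := (isCompact_closedBall (0 : ℂ) 1).exists_bound_of_continuousOn hK.continuousOn
  have hbound : ∀ v : ℂ, ‖v‖ = 1 → ∀ z ∈ unitDisk, ‖fderiv ℝ h z v‖ ≤ C := by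
    intro v hv z hz
    refine le_trans ?_ ((le_abs_self _).trans (hC z (Metric.ball_subset_closedBall hz)))
    rw [hfd]
    refine (norm_add_le _ _).trans ?_
    rw [norm_mul (φ _), norm_mul (P'.derivative.eval z), norm_mul (P'.eval z), hφn, hv, mul_one]
    have := hφ1 (P.eval z) (P'.eval z * v)
    rw [norm_mul, hv, mul_one] at this
    gcongr
  have main := setIntegral_dbar_mul_diskWeight (h := h) (fun z => (hd z).differentiableAt)
    (hbound 1 norm_one) (hbound Complex.I Complex.norm_I) hb
  have hL : ∀ z, (1 - ‖z‖ ^ 2) ^ b • (fderiv ℝ h z 1 + Complex.I * fderiv ℝ h z Complex.I) =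
      ((p * (‖P'.eval z‖ ^ 2 * ‖P.eval z‖ ^ (p - 2) * (1 - ‖z‖ ^ 2) ^ b) : ℝ) : ℂ) := by
    intro z
    rw [hfd, hfd, mul_one, mul_one, mul_comm _ Complex.I, mul_comm _ Complex.I]
    have h1 := hφ2 (P.eval z) (P'.eval z)
    have h2 : P'.eval z * (starRingEnd ℂ) (P'.eval z) = ((‖P'.eval z‖ ^ 2 : ℝ) : ℂ) := by
      rw [Complex.mul_conj, Complex.normSq_eq_norm_sq]
    rw [Complex.real_smul]
    push_cast at h1 h2 ⊢
    linear_combination (((1 - ‖z‖ ^ 2) ^ b : ℝ) : ℂ) * P'.eval z * h1 +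
      (((1 - ‖z‖ ^ 2) ^ b : ℝ) : ℂ) * p * ((‖P.eval z‖ ^ (p - 2) : ℝ) : ℂ) * h2 +
      (((1 - ‖z‖ ^ 2) ^ b : ℝ) : ℂ) * φ (P.eval z) * P'.derivative.eval z * Complex.I_mul_I
  simp_rw [hL] at main
  rw [integral_complex_ofReal, integral_const_mul] at main
  have hcont : Continuous fun z => h z * z := by
    have : Continuous h := continuous_iff_continuousAt.2 fun z => (hd z).continuousAt
    fun_prop
  have hint : IntegrableOn (fun z => (1 - ‖z‖ ^ 2) ^ (b - 1) • (h z * z)) unitDisk := by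
    obtain ⟨D, hD⟩ := (isCompact_closedBall (0 : ℂ) 1).exists_bound_of_continuousOn
      hcont.continuousOn
    refine Integrable.smul_bdd (𝕜 := ℝ) (integrableOn_diskWeight (by linarith)) D
      hcont.aestronglyMeasurable ?_
    refine (ae_restrict_mem measurableSet_unitDisk).mono fun z hz => hD z ?_
    exact Metric.ball_subset_closedBall hz
  have hre := congrArg Complex.re main
  rw [Complex.ofReal_re, show (2 * (b : ℂ)) = ((2 * b : ℝ) : ℂ) by push_cast; rfl,
    Complex.re_ofReal_mul] at hre
  rw [hre]
  have h8 := integral_re (𝕜 := ℂ) hint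
  simp only [RCLike.re_to_complex] at h8
  rw [← h8]
  congr 2
  ext z
  simp only [hh, hφ, Complex.inner, Complex.real_smul]
  rw [Complex.re_ofReal_mul, mul_assoc, mul_assoc, Complex.re_ofReal_mul, mul_comm (P'.eval z * z)]
  ring

theorem bergman_norm_identity (P : Polynomial ℂ) {p b : ℝ} (hp : 2 < p) (hb : 1 < b) :
    (b - 1) * ∫ z in unitDisk, ‖P.eval z‖ ^ p * (1 - ‖z‖ ^ 2) ^ (b - 2) =
      b * (∫ z in unitDisk, ‖P.eval z‖ ^ p * (1 - ‖z‖ ^ 2) ^ (b - 1)) +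
      p ^ 2 / (4 * b) * ∫ z in unitDisk,
        ‖P.derivative.eval z‖ ^ 2 * ‖P.eval z‖ ^ (p - 2) * (1 - ‖z‖ ^ 2) ^ b := by
  have hd : ∀ z, HasFDerivAt (fun z => ‖P.eval z‖ ^ p)
      (((p * ‖P.eval z‖ ^ (p - 2)) • innerSL ℝ (P.eval z)).comp
        (P.derivative.eval z • (1 : ℂ →L[ℝ] ℂ))) z := fun z =>
    HasFDerivAt.comp (g := fun w : ℂ => ‖w‖ ^ p) z
      (hasFDerivAt_norm_rpow (P.eval z) (by linarith)) (hasFDerivAt_eval P z)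
  set v' : ℂ → ℂ →L[ℝ] ℝ := fun z => ((p * ‖P.eval z‖ ^ (p - 2)) • innerSL ℝ (P.eval z)).comp
        (P.derivative.eval z • (1 : ℂ →L[ℝ] ℂ)) with hv'
  have hv : ∀ z, v' z z = p * ‖P.eval z‖ ^ (p - 2) * inner ℝ (P.eval z) (P.derivative.eval z * z) :=
    fun z => rfl
  have c1 := continuous_norm_eval_rpow P (s := p - 2) (by linarith)
  have c2 := continuous_norm_eval_rpow P (s := p) (by linarith)
  have c3 : Continuous fun z => inner ℝ (P.eval z) (P.derivative.eval z * z) := by fun_prop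
  have hc : Continuous fun z => v' z z := by
    simp_rw [hv]
    fun_prop
  have h1 := radial_divergence hd hc (s := b - 1) (by linarith)
  have h2 := setIntegral_laplacian_eval P hp hb
  have e : EqOn (fun z : ℂ => ((2 * ‖P.eval z‖ ^ p + v' z z) * (1 - ‖z‖ ^ 2) -
      2 * (b - 1) * ‖z‖ ^ 2 * ‖P.eval z‖ ^ p) * (1 - ‖z‖ ^ 2) ^ (b - 1 - 1))
      (fun z => 2 * b * (‖P.eval z‖ ^ p * (1 - ‖z‖ ^ 2) ^ (b - 1)) +
        p * (‖P.eval z‖ ^ (p - 2) * inner ℝ (P.eval z) (P.derivative.eval z * z) *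
          (1 - ‖z‖ ^ 2) ^ (b - 1)) -
        2 * (b - 1) * (‖P.eval z‖ ^ p * (1 - ‖z‖ ^ 2) ^ (b - 2))) unitDisk := by
    intro z hz
    have h3 : (1 - ‖z‖ ^ 2) ^ (b - 1) = (1 - ‖z‖ ^ 2) * (1 - ‖z‖ ^ 2) ^ (b - 2) := by
      rw [← Real.rpow_one_add' (one_sub_norm_sq_pos hz).le (by linarith)]
      congr 1; ring
    simp only [hv, h3, show b - 1 - 1 = b - 2 by ring]
    ring
  rw [setIntegral_congr_fun measurableSet_unitDisk e] at h1
  have i1 := (integrableOn_mul_diskWeight c2 (s := b - 1) (by linarith)).const_mul (2 * b)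
  have i2 := (integrableOn_mul_diskWeight (g := fun z => ‖P.eval z‖ ^ (p - 2) *
    inner ℝ (P.eval z) (P.derivative.eval z * z)) (c1.mul c3) (s := b - 1) (by linarith)).const_mul p
  have i3 := (integrableOn_mul_diskWeight c2 (s := b - 2) (by linarith)).const_mul (2 * (b - 1))
  rw [integral_sub ?_ i3, integral_add i1 i2, integral_const_mul, integral_const_mul,
    integral_const_mul] at h1
  · have hb0 : b ≠ 0 := by linarith
    field_simp
    linear_combination (-2 * b) * h1 - p * h2
  · exact i1.add i2

theorem integrableOn_odd_pow_mul_one_sub_sq_rpow (n : ℕ) {s : ℝ} (hs : -1 < s) :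
    IntegrableOn (fun r : ℝ => r ^ (2 * n + 1) * (1 - r ^ 2) ^ s) (Ioo 0 1) := by
  have h := Integrable.bdd_mul (c := 1) (f := fun r : ℝ => r ^ (2 * n))
    (integrableOn_mul_one_sub_sq_rpow hs)
    (by fun_prop : Continuous fun r : ℝ => r ^ (2 * n)).aestronglyMeasurable
    ((ae_restrict_mem measurableSet_Ioo).mono fun r hr => by
      rw [norm_pow, Real.norm_of_nonneg hr.1.le]
      exact pow_le_one₀ hr.1.le hr.2.le)
  refine h.congr (ae_of_all _ fun r => ?_)
  simp only
  ring

theorem two_mul_integral_odd_pow_mul_one_sub_sq_rpow (n : ℕ) {s : ℝ} (hs : -1 < s) :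
    2 * ∫ r in Ioo (0 : ℝ) 1, r ^ (2 * n + 1) * (1 - r ^ 2) ^ s =
      n.factorial * Real.Gamma (s + 1) / Real.Gamma (n + s + 2) := by
  have hs1 : s + 1 ≠ 0 := by linarith
  induction n with
  | zero =>
    have h := intervalIntegral.integral_eq_sub_of_hasDerivAt_of_le (a := 0) (b := 1)
      (f := fun x : ℝ => -((1 - x ^ 2) ^ (s + 1)))
      (f' := fun r => 2 * (s + 1) * (r * (1 - r ^ 2) ^ s)) zero_le_one
      (continuous_one_sub_sq_rpow (by linarith)).neg.continuousOn
      (fun x hx => by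
        refine (hasDerivAt_one_sub_sq_rpow (s := s + 1) hx.1 hx.2).neg.congr_deriv ?_
        rw [add_sub_cancel_right]
        ring)
      ((intervalIntegrable_iff_integrableOn_Ioo_of_le zero_le_one).2
        ((integrableOn_mul_one_sub_sq_rpow hs).const_mul _))
    rw [intervalIntegral.integral_of_le zero_le_one, integral_Ioc_eq_integral_Ioo,
      integral_const_mul] at h
    have hG : Real.Gamma (s + 1) ≠ 0 := (Real.Gamma_pos_of_pos (by linarith)).ne'
    simp only [Nat.cast_zero, zero_add, mul_zero, pow_one, Nat.factorial_zero, Nat.cast_one, one_mul]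
    rw [show s + 2 = s + 1 + 1 by ring, Real.Gamma_add_one hs1]
    simp [Real.zero_rpow hs1] at h
    field_simp
    linarith
  | succ n ih =>
    have i1 := integrableOn_odd_pow_mul_one_sub_sq_rpow n hs
    have i2 := integrableOn_odd_pow_mul_one_sub_sq_rpow (n + 1) hs
    have hn : (n : ℝ) + s + 2 ≠ 0 := by
      have : (0 : ℝ) ≤ n := n.cast_nonneg
      linarith
    have h := intervalIntegral.integral_eq_sub_of_hasDerivAt_of_le (a := 0) (b := 1)
      (f := fun x : ℝ => x ^ (2 * n + 2) * (1 - x ^ 2) ^ (s + 1))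
      (f' := fun r => (2 * n + 2) * (r ^ (2 * n + 1) * (1 - r ^ 2) ^ s) -
        (2 * n + 2 * s + 4) * (r ^ (2 * (n + 1) + 1) * (1 - r ^ 2) ^ s)) zero_le_one
      (((continuous_pow _).mul (continuous_one_sub_sq_rpow (by linarith))).continuousOn)
      (fun x hx => by
        refine ((hasDerivAt_pow _ x).mul
          (hasDerivAt_one_sub_sq_rpow (s := s + 1) hx.1 hx.2)).congr_deriv ?_
        have hx2 : 0 ≤ 1 - x ^ 2 := by nlinarith [hx.1, hx.2]
        rw [add_sub_cancel_right, Real.rpow_add_one' hx2 hs1, show 2 * n + 2 - 1 = 2 * n + 1 by omega]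
        push_cast
        ring)
      ((intervalIntegrable_iff_integrableOn_Ioo_of_le zero_le_one).2
        (by exact (i1.const_mul (2 * n + 2)).sub (i2.const_mul (2 * n + 2 * s + 4))))
    rw [intervalIntegral.integral_of_le zero_le_one, integral_Ioc_eq_integral_Ioo,
      integral_sub (i1.const_mul _) (i2.const_mul _), integral_const_mul, integral_const_mul] at h
    simp [Real.zero_rpow hs1] at h
    rw [show ((n + 1 : ℕ) : ℝ) + s + 2 = n + s + 2 + 1 by push_cast; ring, Real.Gamma_add_one hn,
      Nat.factorial_succ]
    push_cast
    have : Real.Gamma (n + s + 2) ≠ 0 := (Real.Gamma_pos_of_pos (by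
      have : (0 : ℝ) ≤ n := n.cast_nonneg
      linarith)).ne'
    field_simp at ih ⊢
    linear_combination ((n : ℝ) + 1) * ih - Real.Gamma (n + s + 2) * h

theorem integral_exp_int_mul_I (k : ℤ) :
    ∫ θ in Ioo (-Real.pi) Real.pi, Complex.exp (k * θ * Complex.I) =
      if k = 0 then (2 * Real.pi : ℂ) else 0 := by
  have hpi : -Real.pi ≤ Real.pi := by linarith [Real.pi_pos]
  rw [← integral_Ioc_eq_integral_Ioo, ← intervalIntegral.integral_of_le hpi]
  split_ifs with hk
  · simp [hk]
    ring
  · have hk' : (k : ℂ) * Complex.I ≠ 0 := by simp [hk]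
    have h := integral_exp_mul_complex (a := -Real.pi) (b := Real.pi) hk'
    simp_rw [mul_right_comm (k : ℂ) Complex.I] at h
    rw [h, div_eq_zero_iff, sub_eq_zero]
    left
    rw [Complex.exp_eq_exp_iff_exists_int]
    refine ⟨k, ?_⟩
    push_cast
    ring

theorem setIntegral_pow_mul_conj_pow (i j : ℕ) {s : ℝ} (hs : -1 < s) :
    ∫ z in unitDisk, ((1 - ‖z‖ ^ 2) ^ s) • (z ^ i * (starRingEnd ℂ) (z ^ j)) =
      if i = j then
        ((Real.pi * (i.factorial * Real.Gamma (s + 1) / Real.Gamma (i + s + 2)) : ℝ) : ℂ) else 0 := by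
  rw [setIntegral_unitDisk_polar]
  have e : EqOn (fun q : ℝ × ℝ => q.1 •
      ((1 - ‖q.1 * Complex.exp (q.2 * Complex.I)‖ ^ 2) ^ s •
        ((q.1 * Complex.exp (q.2 * Complex.I)) ^ i *
          (starRingEnd ℂ) ((q.1 * Complex.exp (q.2 * Complex.I)) ^ j))))
      (fun q => ((q.1 ^ (i + j + 1) * (1 - q.1 ^ 2) ^ s : ℝ) : ℂ) *
        Complex.exp (((i - j : ℤ) : ℂ) * q.2 * Complex.I))
      (Ioo (0 : ℝ) 1 ×ˢ Ioo (-Real.pi) Real.pi) := by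
    rintro ⟨r, θ⟩ ⟨⟨hr, -⟩, -⟩
    simp only
    rw [norm_mul, Complex.norm_exp_ofReal_mul_I, Complex.norm_real, mul_one,
      Real.norm_of_nonneg hr.le, Complex.real_smul, Complex.real_smul,
      show (((i - j : ℤ) : ℂ) * θ * Complex.I) = i * (θ * Complex.I) + j * -(θ * Complex.I) by
        push_cast; ring, Complex.exp_add, Complex.exp_nat_mul, Complex.exp_nat_mul]
    simp only [map_pow, map_mul, Complex.conj_ofReal, ← Complex.exp_conj, Complex.conj_I, mul_pow]
    push_cast
    rw [mul_neg]
    ring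
  rw [setIntegral_congr_fun (measurableSet_Ioo.prod measurableSet_Ioo) e, Measure.volume_eq_prod,
    setIntegral_prod_mul (fun r : ℝ => ((r ^ (i + j + 1) * (1 - r ^ 2) ^ s : ℝ) : ℂ))
      (fun θ : ℝ => Complex.exp (((i - j : ℤ) : ℂ) * θ * Complex.I)),
    integral_exp_int_mul_I, integral_complex_ofReal]
  by_cases hij : i = j
  · subst hij
    rw [if_pos (by simp), if_pos rfl, ← two_mul_integral_odd_pow_mul_one_sub_sq_rpow i hs,
      ← two_mul i]
    push_cast
    ring
  · rw [if_neg (by omega), if_neg hij, mul_zero]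

theorem setIntegral_norm_sq_eval (P : Polynomial ℂ) {s : ℝ} (hs : -1 < s) {N : ℕ}
    (hN : P.natDegree < N) :
    ∫ z in unitDisk, ‖P.eval z‖ ^ 2 * (1 - ‖z‖ ^ 2) ^ s =
      Real.pi * ∑ n ∈ Finset.range N,
        ‖P.coeff n‖ ^ 2 * (n.factorial * Real.Gamma (s + 1) / Real.Gamma (n + s + 2)) := by
  have e : ∀ z, ((‖P.eval z‖ ^ 2 * (1 - ‖z‖ ^ 2) ^ s : ℝ) : ℂ) =
      ∑ i ∈ Finset.range N, ∑ j ∈ Finset.range N, P.coeff i * (starRingEnd ℂ) (P.coeff j) *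
        ((1 - ‖z‖ ^ 2) ^ s • (z ^ i * (starRingEnd ℂ) (z ^ j))) := by
    intro z
    rw [Complex.ofReal_mul, ← Complex.normSq_eq_norm_sq, ← Complex.mul_conj,
      Polynomial.eval_eq_sum_range' hN, map_sum, Finset.sum_mul_sum, Finset.sum_mul]
    refine Finset.sum_congr rfl fun i _ => ?_
    rw [Finset.sum_mul]
    refine Finset.sum_congr rfl fun j _ => ?_
    rw [Complex.real_smul, map_mul]
    ring
  have hint : ∀ i j : ℕ, IntegrableOn (fun z : ℂ => P.coeff i * (starRingEnd ℂ) (P.coeff j) *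
        ((1 - ‖z‖ ^ 2) ^ s • (z ^ i * (starRingEnd ℂ) (z ^ j)))) unitDisk := by
    intro i j
    have hc : Continuous fun z : ℂ => z ^ i * (starRingEnd ℂ) (z ^ j) :=
      (continuous_pow i).mul (Complex.continuous_conj.comp (continuous_pow j))
    obtain ⟨D, hD⟩ := (isCompact_closedBall (0 : ℂ) 1).exists_bound_of_continuousOn
      hc.continuousOn
    refine Integrable.const_mul ?_ _
    refine Integrable.smul_bdd (𝕜 := ℝ) (integrableOn_diskWeight hs) D hc.aestronglyMeasurable ?_
    refine (ae_restrict_mem measurableSet_unitDisk).mono fun z hz => hD z ?_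
    exact Metric.ball_subset_closedBall hz
  have h := integral_complex_ofReal (μ := volume.restrict unitDisk)
    (f := fun z => ‖P.eval z‖ ^ 2 * (1 - ‖z‖ ^ 2) ^ s)
  apply Complex.ofReal_injective
  rw [← h]
  simp_rw [e]
  rw [integral_finsetSum _ fun i _ => integrable_finsetSum _ fun j _ => hint i j]
  simp_rw [integral_finsetSum _ fun j _ => hint _ j, integral_const_mul,
    setIntegral_pow_mul_conj_pow _ _ hs]
  rw [Finset.mul_sum]
  push_cast
  refine Finset.sum_congr rfl fun i hi => ?_
  simp_rw [mul_ite, mul_zero]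
  rw [Finset.sum_ite_eq, if_pos hi, Complex.mul_conj, Complex.normSq_eq_norm_sq]
  push_cast
  ring

theorem ccoef_pos {β : ℝ} (hβ : 0 < β) (n : ℕ) : 0 < ccoef β n := by
  have h1 := Real.Gamma_pos_of_pos hβ
  have h2 : 0 < Real.Gamma (n + β) := Real.Gamma_pos_of_pos (by positivity)
  unfold ccoef
  positivity

theorem ccoef_zero {β : ℝ} (hβ : 0 < β) : ccoef β 0 = 1 := by
  have h1 := (Real.Gamma_pos_of_pos hβ).ne'
  simp [ccoef, h1]

theorem succ_mul_ccoef_succ {β : ℝ} (hβ : 0 < β) (n : ℕ) :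
    (n + 1) * ccoef β (n + 1) = (n + β) * ccoef β n := by
  have h1 := (Real.Gamma_pos_of_pos hβ).ne'
  have h2 : (n : ℝ) + β ≠ 0 := by positivity
  unfold ccoef
  rw [show ((n + 1 : ℕ) : ℝ) + β = n + β + 1 by push_cast; ring, Real.Gamma_add_one h2,
    Nat.factorial_succ]
  push_cast
  field_simp

/-- The Chu–Vandermonde identity. -/
theorem sum_antidiagonal_ccoef_mul_ccoef {β γ : ℝ} (hβ : 0 < β) (hγ : 0 < γ) (n : ℕ) :
    ∑ x ∈ Finset.HasAntidiagonal.antidiagonal n, ccoef β x.1 * ccoef γ x.2 = ccoef (β + γ) n := by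
  induction n with
  | zero => simp [ccoef_zero hβ, ccoef_zero hγ, ccoef_zero (add_pos hβ hγ)]
  | succ n ih =>
    have hn : (n : ℝ) + 1 ≠ 0 := by positivity
    apply mul_left_cancel₀ hn
    rw [succ_mul_ccoef_succ (add_pos hβ hγ), ← ih, Finset.mul_sum, Finset.mul_sum]
    have h1 : ∑ x ∈ Finset.HasAntidiagonal.antidiagonal (n + 1), ((n : ℝ) + 1) * (ccoef β x.1 * ccoef γ x.2) =
        ∑ x ∈ Finset.HasAntidiagonal.antidiagonal (n + 1), (x.1 * ccoef β x.1 * ccoef γ x.2) +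
          ∑ x ∈ Finset.HasAntidiagonal.antidiagonal (n + 1), (ccoef β x.1 * (x.2 * ccoef γ x.2)) := by
      rw [← Finset.sum_add_distrib]
      refine Finset.sum_congr rfl fun x hx => ?_
      have : ((x.1 + x.2 : ℕ) : ℝ) = (n + 1 : ℕ) := by rw [Finset.HasAntidiagonal.mem_antidiagonal.1 hx]
      push_cast at this
      rw [← this]
      ring
    rw [h1, Finset.Nat.sum_antidiagonal_succ, Finset.Nat.sum_antidiagonal_succ',
      Nat.cast_zero, zero_mul, zero_mul, zero_mul, mul_zero, zero_add, zero_add,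
      ← Finset.sum_add_distrib]
    refine Finset.sum_congr rfl fun x hx => ?_
    have : ((x.1 + x.2 : ℕ) : ℝ) = n := by rw [Finset.HasAntidiagonal.mem_antidiagonal.1 hx]
    push_cast at this ⊢
    rw [succ_mul_ccoef_succ hβ, succ_mul_ccoef_succ hγ, ← this]
    ring

/-- The squared weighted `ℓ²` norm `∑ |a_n|²/c_β(n)` of the coefficients of a polynomial. -/
def coeffNormSq (β : ℝ) (P : Polynomial ℂ) : ℝ := ∑' n, ‖P.coeff n‖ ^ 2 / ccoef β n

theorem coeffNormSq_eq_sum (β : ℝ) {P : Polynomial ℂ} {N : ℕ} (hN : P.natDegree < N) :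
    coeffNormSq β P = ∑ n ∈ Finset.range N, ‖P.coeff n‖ ^ 2 / ccoef β n :=
  tsum_eq_sum fun n hn => by
    rw [Polynomial.coeff_eq_zero_of_natDegree_lt (hN.trans_le (by simpa using hn))]
    simp

theorem summable_coeffNormSq (β : ℝ) (P : Polynomial ℂ) :
    Summable fun n => ‖P.coeff n‖ ^ 2 / ccoef β n :=
  summable_of_ne_finset_zero (s := Finset.range (P.natDegree + 1)) fun n hn => by
    rw [Polynomial.coeff_eq_zero_of_natDegree_lt (by simpa using hn)]
    simp

theorem coeffNormSq_pos {β : ℝ} (hβ : 0 < β) {P : Polynomial ℂ} (hP : P ≠ 0) :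
    0 < coeffNormSq β P := by
  obtain ⟨n, hn⟩ : ∃ n, P.coeff n ≠ 0 := by
    by_contra! h
    exact hP (Polynomial.ext (by simpa using h))
  refine (summable_coeffNormSq β P).tsum_pos (fun n => ?_) n ?_
  · have := ccoef_pos hβ n
    positivity
  · have := ccoef_pos hβ n
    positivity

theorem coeffNormSq_mul_self_le {β : ℝ} (hβ : 0 < β) (P : Polynomial ℂ) :
    coeffNormSq (2 * β) (P * P) ≤ coeffNormSq β P ^ 2 := by
  have hs : Summable fun n => ‖‖P.coeff n‖ ^ 2 / ccoef β n‖ := (summable_coeffNormSq β P).norm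
  rw [sq, coeffNormSq, coeffNormSq, tsum_mul_tsum_eq_tsum_sum_antidiagonal_of_summable_norm hs hs]
  refine (summable_coeffNormSq _ _).tsum_le_tsum (fun n => ?_)
    (summable_norm_sum_mul_antidiagonal_of_summable_norm hs hs).of_norm
  rw [two_mul, ← sum_antidiagonal_ccoef_mul_ccoef hβ hβ, Polynomial.coeff_mul]
  have hpos : ∀ x ∈ Finset.HasAntidiagonal.antidiagonal n, 0 < ccoef β x.1 * ccoef β x.2 := fun x _ =>
    mul_pos (ccoef_pos hβ _) (ccoef_pos hβ _)
  calc _ ≤ (∑ x ∈ Finset.HasAntidiagonal.antidiagonal n, ‖P.coeff x.1‖ * ‖P.coeff x.2‖) ^ 2 /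
        ∑ x ∈ Finset.HasAntidiagonal.antidiagonal n, ccoef β x.1 * ccoef β x.2 := by
        refine div_le_div_of_nonneg_right ?_ (Finset.sum_nonneg fun x hx => (hpos x hx).le)
        refine pow_le_pow_left₀ (norm_nonneg _) ?_ 2
        simpa only [norm_mul] using norm_sum_le (Finset.HasAntidiagonal.antidiagonal n)
          fun x => P.coeff x.1 * P.coeff x.2
    _ ≤ _ := Finset.sq_sum_div_le_sum_sq_div _ _ hpos
    _ = _ := Finset.sum_congr rfl fun x _ => by rw [mul_pow, mul_div_mul_comm]

theorem dirichlet_norm_identity (P : Polynomial ℂ) {β : ℝ} (hβ : 0 < β) :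
    β * (∫ z in unitDisk, ‖P.eval z‖ ^ 2 * (1 - ‖z‖ ^ 2) ^ (β - 1)) +
      1 / β * (∫ z in unitDisk, ‖P.derivative.eval z‖ ^ 2 * (1 - ‖z‖ ^ 2) ^ β) =
      Real.pi * coeffNormSq β P := by
  have hG := (Real.Gamma_pos_of_pos hβ).ne'
  have hN : P.natDegree < P.natDegree + 1 + 1 := by omega
  have hN' : P.derivative.natDegree < P.natDegree + 1 :=
    (P.natDegree_derivative_le.trans (Nat.sub_le _ _)).trans_lt (Nat.lt_succ_self _)
  rw [setIntegral_norm_sq_eval P (by linarith) hN, coeffNormSq_eq_sum β hN,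
    setIntegral_norm_sq_eval _ (by linarith) hN', Finset.sum_range_succ' _ (P.natDegree + 1),
    Finset.sum_range_succ' _ (P.natDegree + 1),
    ccoef_zero hβ, sub_add_cancel, Nat.factorial_zero, Nat.cast_zero, Nat.cast_one,
    show 0 + (β - 1) + 2 = β + 1 by ring, Real.Gamma_add_one hβ.ne']
  have hterm : ∀ n : ℕ, ‖P.coeff (n + 1)‖ ^ 2 / ccoef β (n + 1) =
      β * (‖P.coeff (n + 1)‖ ^ 2 *
        ((n + 1).factorial * Real.Gamma β / Real.Gamma ((n + 1 : ℕ) + (β - 1) + 2))) +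
      1 / β * (‖P.derivative.coeff n‖ ^ 2 *
        (n.factorial * (β * Real.Gamma β) / Real.Gamma (n + β + 2))) := by
    intro n
    have h1 : (n : ℝ) + β + 1 ≠ 0 := by positivity
    have h2 : Real.Gamma (n + β + 1) ≠ 0 := (Real.Gamma_pos_of_pos (by positivity)).ne'
    have h3 : ‖P.derivative.coeff n‖ = ‖P.coeff (n + 1)‖ * (n + 1) := by
      rw [Polynomial.coeff_derivative, norm_mul]
      congr 1
      exact_mod_cast Complex.norm_natCast (n + 1)
    rw [h3, ccoef, show ((n + 1 : ℕ) : ℝ) + (β - 1) + 2 = n + β + 1 + 1 by push_cast; ring,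
      show ((n + 1 : ℕ) : ℝ) + β = n + β + 1 by push_cast; ring,
      show (n : ℝ) + β + 2 = n + β + 1 + 1 by ring, Real.Gamma_add_one h1, Nat.factorial_succ]
    push_cast
    field_simp
    ring
  rw [Finset.sum_congr rfl fun n _ => hterm n, Finset.sum_add_distrib, ← Finset.mul_sum,
    ← Finset.mul_sum]
  have h0 : β * (‖P.coeff 0‖ ^ 2 * (1 * Real.Gamma β / (β * Real.Gamma β))) =
      ‖P.coeff 0‖ ^ 2 / 1 := by field_simp
  linear_combination Real.pi * h0

theorem rpow_mul_rpow_le_weighted_sum {x y A C θ : ℝ} (hx : 0 ≤ x) (hy : 0 ≤ y) (hA : 0 < A)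
    (hC : 0 < C) (h0 : 0 ≤ θ) (h1 : θ ≤ 1) :
    x ^ (1 - θ) * y ^ θ ≤ A ^ (1 - θ) * C ^ θ * ((1 - θ) / A * x + θ / C * y) := by
  have h := Real.geom_mean_le_arith_mean2_weighted (sub_nonneg.2 h1) h0
    (div_nonneg hx hA.le) (div_nonneg hy hC.le) (sub_add_cancel 1 θ)
  rw [Real.div_rpow hx hA.le, Real.div_rpow hy hC.le, div_mul_div_comm,
    div_le_iff₀ (by positivity)] at h
  calc _ ≤ _ := h
    _ = _ := by ring

theorem weighted_norm_rpow_eq {a w β θ s : ℝ} (ha : 0 ≤ a) (hw : 0 < w) (h0 : 0 ≤ θ) :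
    a ^ (2 * (1 + θ)) * w ^ ((1 + θ) * β - s) =
      (a ^ 2 * w ^ (β - s)) ^ (1 - θ) * (a ^ 4 * w ^ (2 * β - s)) ^ θ := by
  rw [Real.mul_rpow (by positivity) (by positivity), Real.mul_rpow (by positivity) (by positivity),
    ← Real.rpow_natCast a 2, ← Real.rpow_natCast a 4, ← Real.rpow_mul ha, ← Real.rpow_mul ha,
    ← Real.rpow_mul hw.le, ← Real.rpow_mul hw.le, mul_mul_mul_comm, ← Real.rpow_add hw,
    ← Real.rpow_add' ha (by push_cast; linarith)]
  congr 2 <;> push_cast <;> ring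

theorem weighted_deriv_rpow_eq {a d w β θ : ℝ} (ha : 0 ≤ a) (hw : 0 < w) :
    d ^ 2 * a ^ (2 * θ) * w ^ ((1 + θ) * β) =
      (d ^ 2 * w ^ β) ^ (1 - θ) * (d ^ 2 * a ^ 2 * w ^ (2 * β)) ^ θ := by
  rw [Real.mul_rpow (by positivity) (by positivity), Real.mul_rpow (by positivity) (by positivity),
    Real.mul_rpow (by positivity) (by positivity)]
  have e1 : d ^ 2 = (d ^ 2) ^ (1 - θ) * (d ^ 2) ^ θ := by
    rw [← Real.rpow_add' (by positivity) (by simp)]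
    simp
  have e2 : w ^ ((1 + θ) * β) = (w ^ β) ^ (1 - θ) * (w ^ (2 * β)) ^ θ := by
    rw [← Real.rpow_mul hw.le, ← Real.rpow_mul hw.le, ← Real.rpow_add hw]
    congr 1
    ring
  have e3 : a ^ (2 * θ) = (a ^ 2) ^ θ := by
    rw [← Real.rpow_natCast a 2, ← Real.rpow_mul ha]
    norm_cast
  rw [e2, e3]
  nth_rewrite 1 [e1]
  ring

theorem bergman_bound_of_le_four (P : Polynomial ℂ) {β p : ℝ} (hβ : 1 ≤ β) (hp : 2 < p)
    (hp4 : p ≤ 4) :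
    (p / 2 * β - 1) * ∫ z in unitDisk, ‖P.eval z‖ ^ p * (1 - ‖z‖ ^ 2) ^ (p / 2 * β - 2) ≤
      Real.pi * (p / 2 ^ (p / 2)) * coeffNormSq β P ^ (p / 2) := by
  have hβ0 : 0 < β := by linarith
  rcases eq_or_ne P 0 with rfl | hP
  · have : p ≠ 0 := by linarith
    have : p / 2 ≠ 0 := by linarith
    simp [Real.zero_rpow, coeffNormSq, *]
  obtain ⟨θ, hθ⟩ : ∃ θ, θ = p / 2 - 1 := ⟨_, rfl⟩
  have hθ0 : 0 < θ := by linarith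
  have hθ1 : θ ≤ 1 := by linarith
  obtain rfl : p = 2 * (1 + θ) := by linarith
  rw [mul_div_cancel_left₀ _ two_ne_zero]
  set b := (1 + θ) * β with hb_def
  have hb : 1 < b := by nlinarith
  rw [bergman_norm_identity P hp hb]
  set N := coeffNormSq β P with hN_def
  have hN : 0 < N := coeffNormSq_pos hβ0 hP
  have c := P.continuous
  have c' := P.derivative.continuous
  have i1 := integrableOn_mul_diskWeight (g := fun z => ‖P.eval z‖ ^ 2) (by fun_prop)
    (s := β - 1) (by linarith)
  have i2 := integrableOn_mul_diskWeight (g := fun z => ‖P.eval z‖ ^ 4) (by fun_prop)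
    (s := 2 * β - 1) (by linarith)
  have j1 := integrableOn_mul_diskWeight (g := fun z => ‖P.derivative.eval z‖ ^ 2) (by fun_prop)
    (s := β) (by linarith)
  have j2 := integrableOn_mul_diskWeight
    (g := fun z => ‖P.derivative.eval z‖ ^ 2 * ‖P.eval z‖ ^ 2) (by fun_prop)
    (s := 2 * β) (by linarith)
  have i := integrableOn_mul_diskWeight
    (continuous_norm_eval_rpow P (s := 2 * (1 + θ)) (by linarith)) (s := b - 1) (by linarith)
  have j := integrableOn_mul_diskWeight
    (g := fun z => ‖P.derivative.eval z‖ ^ 2 * ‖P.eval z‖ ^ (2 * (1 + θ) - 2))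
    ((c'.norm.pow 2).mul (continuous_norm_eval_rpow P (by linarith))) (s := b) (by linarith)
  set K := N ^ (1 - θ) * (N ^ 2 / 2) ^ θ with hK_def
  have hK : 0 < K := by positivity
  have hS : ∫ z in unitDisk, ‖P.eval z‖ ^ (2 * (1 + θ)) * (1 - ‖z‖ ^ 2) ^ (b - 1) ≤
      K * ((1 - θ) / N * (∫ z in unitDisk, ‖P.eval z‖ ^ 2 * (1 - ‖z‖ ^ 2) ^ (β - 1)) +
        θ / (N ^ 2 / 2) * ∫ z in unitDisk, ‖P.eval z‖ ^ 4 * (1 - ‖z‖ ^ 2) ^ (2 * β - 1)) := by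
    rw [← integral_const_mul, ← integral_const_mul,
      ← integral_add (i1.const_mul _) (i2.const_mul _), ← integral_const_mul]
    refine setIntegral_mono_on i (((i1.const_mul _).add (i2.const_mul _)).const_mul _)
      measurableSet_unitDisk fun z hz => ?_
    have hw := one_sub_norm_sq_pos hz
    rw [weighted_norm_rpow_eq (norm_nonneg _) hw hθ0.le]
    exact rpow_mul_rpow_le_weighted_sum (by positivity) (by positivity) hN (by positivity)
      hθ0.le hθ1
  have hT : ∫ z in unitDisk, ‖P.derivative.eval z‖ ^ 2 * ‖P.eval z‖ ^ (2 * (1 + θ) - 2) *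
        (1 - ‖z‖ ^ 2) ^ b ≤
      K * ((1 - θ) / N * (∫ z in unitDisk, ‖P.derivative.eval z‖ ^ 2 * (1 - ‖z‖ ^ 2) ^ β) +
        θ / (N ^ 2 / 2) * ∫ z in unitDisk,
          ‖P.derivative.eval z‖ ^ 2 * ‖P.eval z‖ ^ 2 * (1 - ‖z‖ ^ 2) ^ (2 * β)) := by
    rw [← integral_const_mul, ← integral_const_mul,
      ← integral_add (j1.const_mul _) (j2.const_mul _), ← integral_const_mul]
    refine setIntegral_mono_on j (((j1.const_mul _).add (j2.const_mul _)).const_mul _)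
      measurableSet_unitDisk fun z hz => ?_
    have hw := one_sub_norm_sq_pos hz
    rw [show 2 * (1 + θ) - 2 = 2 * θ by ring,
      weighted_deriv_rpow_eq (norm_nonneg _) hw]
    exact rpow_mul_rpow_le_weighted_sum (by positivity) (by positivity) hN (by positivity)
      hθ0.le hθ1
  have h1 := dirichlet_norm_identity P hβ0
  have h2 := dirichlet_norm_identity (P * P) (β := 2 * β) (by linarith)
  have h3 := coeffNormSq_mul_self_le hβ0 P
  have e1 : ∀ z, ‖(P * P).eval z‖ ^ 2 = ‖P.eval z‖ ^ 4 := fun z => by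
    rw [Polynomial.eval_mul, norm_mul]
    ring
  have e2 : ∀ z, ‖(P * P).derivative.eval z‖ ^ 2 =
      4 * (‖P.derivative.eval z‖ ^ 2 * ‖P.eval z‖ ^ 2) := fun z => by
    rw [Polynomial.derivative_mul, mul_comm P, ← two_mul, Polynomial.eval_mul, Polynomial.eval_mul,
      norm_mul, norm_mul]
    simp
    ring
  simp_rw [e1, e2, mul_assoc (4 : ℝ)] at h2
  rw [integral_const_mul] at h2
  rw [← hN_def] at h1 h3
  generalize (∫ z in unitDisk, ‖P.eval z‖ ^ 2 * (1 - ‖z‖ ^ 2) ^ (β - 1)) = S1 at *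
  generalize (∫ z in unitDisk, ‖P.eval z‖ ^ 4 * (1 - ‖z‖ ^ 2) ^ (2 * β - 1)) = S2 at *
  generalize (∫ z in unitDisk, ‖P.derivative.eval z‖ ^ 2 * (1 - ‖z‖ ^ 2) ^ β) = T1 at *
  generalize (∫ z in unitDisk,
    ‖P.derivative.eval z‖ ^ 2 * ‖P.eval z‖ ^ 2 * (1 - ‖z‖ ^ 2) ^ (2 * β)) = T2 at *
  generalize (∫ z in unitDisk,
    ‖P.eval z‖ ^ (2 * (1 + θ)) * (1 - ‖z‖ ^ 2) ^ (b - 1)) = S at *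
  generalize (∫ z in unitDisk, ‖P.derivative.eval z‖ ^ 2 * ‖P.eval z‖ ^ (2 * (1 + θ) - 2) *
        (1 - ‖z‖ ^ 2) ^ b) = T at *
  have h4 : β * S2 + 1 / β * T2 ≤ Real.pi * (N ^ 2 / 2) := by
    have : β * S2 + 1 / β * T2 = (2 * β * S2 + 1 / (2 * β) * (4 * T2)) / 2 := by
      field_simp
      ring
    rw [this, h2]
    nlinarith [Real.pi_pos]
  calc b * S + (2 * (1 + θ)) ^ 2 / (4 * b) * T = (1 + θ) * (β * S + 1 / β * T) := by
        rw [hb_def]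
        field_simp
        ring
    _ ≤ (1 + θ) * (β * (K * ((1 - θ) / N * S1 + θ / (N ^ 2 / 2) * S2)) +
          1 / β * (K * ((1 - θ) / N * T1 + θ / (N ^ 2 / 2) * T2))) := by gcongr
    _ = (1 + θ) * K * ((1 - θ) / N * (β * S1 + 1 / β * T1) +
          θ / (N ^ 2 / 2) * (β * S2 + 1 / β * T2)) := by ring
    _ ≤ (1 + θ) * K * ((1 - θ) / N * (Real.pi * N) + θ / (N ^ 2 / 2) * (Real.pi * (N ^ 2 / 2))) := by
        rw [h1]
        gcongr
    _ = Real.pi * (2 * (1 + θ) / 2 ^ (1 + θ)) * N ^ (1 + θ) := by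
        have hK' : K = N ^ (1 + θ) / 2 ^ θ := by
          rw [hK_def, Real.div_rpow (by positivity) zero_le_two, ← Real.rpow_natCast N 2,
            ← Real.rpow_mul hN.le, ← mul_div_assoc, ← Real.rpow_add hN]
          congr 2
          push_cast
          ring
        rw [hK', Real.rpow_add two_pos, Real.rpow_one]
        field_simp
        ring

theorem le_exp_div_exp_one (p : ℝ) : p ≤ Real.exp (p / Real.exp 1) := by
  have h := Real.add_one_le_exp (p / Real.exp 1 - 1)
  rwa [sub_add_cancel, Real.exp_sub, div_le_div_iff_of_pos_right (Real.exp_pos 1)] at h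

theorem one_le_exp_div_sqrt_two : 1 ≤ Real.exp (1 / Real.exp 1) / √2 := by
  rw [one_le_div (by positivity)]
  refine Real.sqrt_le_iff.2 ⟨(Real.exp_pos _).le, ?_⟩
  rw [← Real.exp_nat_mul, ← mul_div_assoc]
  exact_mod_cast le_exp_div_exp_one 2

theorem div_two_rpow_le (p : ℝ) :
    p / 2 ^ (p / 2) ≤ (Real.exp (1 / Real.exp 1) / √2) ^ p := by
  rw [Real.div_rpow (Real.exp_pos _).le (Real.sqrt_nonneg _), Real.sqrt_eq_rpow,
    ← Real.rpow_mul zero_le_two, one_div_mul_eq_div, ← Real.exp_mul, one_div_mul_eq_div]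
  gcongr
  exact le_exp_div_exp_one p

theorem bergman_bound (k : ℕ) : ∀ (P : Polynomial ℂ) {β p : ℝ}, 1 ≤ β → 2 < p → p ≤ 2 ^ (k + 2) →
    (p / 2 * β - 1) * ∫ z in unitDisk, ‖P.eval z‖ ^ p * (1 - ‖z‖ ^ 2) ^ (p / 2 * β - 2) ≤
      Real.pi * (Real.exp (1 / Real.exp 1) / √2) ^ p * coeffNormSq β P ^ (p / 2) := by
  have hnn : ∀ {β : ℝ} (P : Polynomial ℂ), 1 ≤ β → 0 ≤ coeffNormSq β P := fun P hβ =>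
    tsum_nonneg fun n => div_nonneg (sq_nonneg _) (ccoef_pos (by linarith) n).le
  have small : ∀ (P : Polynomial ℂ) {β p : ℝ}, 1 ≤ β → 2 < p → p ≤ 4 →
      (p / 2 * β - 1) * ∫ z in unitDisk, ‖P.eval z‖ ^ p * (1 - ‖z‖ ^ 2) ^ (p / 2 * β - 2) ≤
        Real.pi * (Real.exp (1 / Real.exp 1) / √2) ^ p * coeffNormSq β P ^ (p / 2) := by
    intro P β p hβ hp hp4
    refine (bergman_bound_of_le_four P hβ hp hp4).trans ?_
    have := hnn P hβ
    have := div_two_rpow_le p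
    gcongr
  induction k with
  | zero => exact fun P β p hβ hp hp4 => small P hβ hp (by norm_num at hp4; exact hp4)
  | succ k ih =>
    intro P β p hβ hp hpk
    rcases le_or_gt p 4 with hp4 | hp4
    · exact small P hβ hp hp4
    have h := ih (P * P) (β := 2 * β) (p := p / 2) (by linarith) (by linarith)
      (by rw [pow_succ] at hpk; linarith)
    have e : ∀ z, ‖(P * P).eval z‖ ^ (p / 2) = ‖P.eval z‖ ^ p := fun z => by
      rw [Polynomial.eval_mul, norm_mul, ← sq, ← Real.rpow_natCast, ← Real.rpow_mul (norm_nonneg _)]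
      congr 1
      push_cast
      ring
    simp_rw [e, show p / 2 / 2 * (2 * β) = p / 2 * β by ring] at h
    refine h.trans ?_
    have h1 := hnn P hβ
    have h2 : coeffNormSq (2 * β) (P * P) ^ (p / 2 / 2) ≤ coeffNormSq β P ^ (p / 2) := by
      calc _ ≤ (coeffNormSq β P ^ 2) ^ (p / 2 / 2) :=
            Real.rpow_le_rpow (hnn _ (by linarith)) (coeffNormSq_mul_self_le (by linarith) P)
              (by linarith)
        _ = _ := by
            rw [← Real.rpow_natCast, ← Real.rpow_mul h1]
            congr 1
            push_cast
            ring
    have h3 : (Real.exp (1 / Real.exp 1) / √2) ^ (p / 2) ≤ (Real.exp (1 / Real.exp 1) / √2) ^ p :=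
      Real.rpow_le_rpow_of_exponent_le one_le_exp_div_sqrt_two (by linarith)
    have h4 := hnn (P * P) (β := 2 * β) (by linarith)
    gcongr

/-- The Taylor polynomial of `f` at the origin with `n` terms. -/
def taylorPoly (f : ℂ → ℂ) (n : ℕ) : Polynomial ℂ :=
  ∑ k ∈ Finset.range n, Polynomial.monomial k (taylorCoeff f k)

theorem coeff_taylorPoly (f : ℂ → ℂ) (n k : ℕ) :
    (taylorPoly f n).coeff k = if k < n then taylorCoeff f k else 0 := by
  simp [taylorPoly, Polynomial.finsetSum_coeff, Polynomial.coeff_monomial]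

theorem tendsto_eval_taylorPoly {f : ℂ → ℂ} (hf : DifferentiableOn ℂ f unitDisk) {z : ℂ}
    (hz : z ∈ unitDisk) :
    Tendsto (fun n => (taylorPoly f n).eval z) atTop (𝓝 (f z)) := by
  refine (Complex.hasSum_taylorSeries_on_ball hf hz).tendsto_sum_nat.congr fun n => ?_
  rw [taylorPoly, Polynomial.eval_finsetSum]
  refine Finset.sum_congr rfl fun k _ => ?_
  rw [Polynomial.eval_monomial, taylorCoeff, sub_zero, smul_eq_mul, smul_eq_mul]
  ring

theorem ofReal_coeffNormSq_taylorPoly_le {α : ℝ} (hα : -1 ≤ α) (f : ℂ → ℂ) (n : ℕ) :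
    ENNReal.ofReal (coeffNormSq (α + 2) (taylorPoly f n)) ≤ A2normSq α f := by
  have hc : ∀ k, 0 < ccoef (α + 2) k := ccoef_pos (by linarith)
  rw [coeffNormSq, ENNReal.ofReal_tsum_of_nonneg (fun k => div_nonneg (sq_nonneg _) (hc k).le)
    (summable_coeffNormSq _ _)]
  refine ENNReal.tsum_le_tsum fun k => ENNReal.ofReal_le_ofReal ?_
  rw [coeff_taylorPoly]
  split_ifs
  · rfl
  · have := hc k
    rw [norm_zero, zero_pow two_ne_zero, zero_div]
    positivity

theorem lintegral_norm_eval_rpow_le (P : Polynomial ℂ) {β p : ℝ} (hβ : 1 ≤ β) (hp : 2 < p) :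
    ∫⁻ z in unitDisk, ENNReal.ofReal ((1 - ‖z‖ ^ 2) ^ (p / 2 * β - 2) * ‖P.eval z‖ ^ p) ≤
      ENNReal.ofReal (Real.pi * (Real.exp (1 / Real.exp 1) / √2) ^ p *
        coeffNormSq β P ^ (p / 2) / (p / 2 * β - 1)) := by
  have hb : 1 < p / 2 * β := by nlinarith
  obtain ⟨k, hk⟩ := pow_unbounded_of_one_lt p one_lt_two
  have h := bergman_bound k P hβ hp
    (hk.le.trans (pow_le_pow_right₀ one_le_two (Nat.le_add_right k 2)))
  simp_rw [mul_comm ((1 - ‖_‖ ^ 2) ^ (p / 2 * β - 2) : ℝ)]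
  rw [← ofReal_integral_eq_lintegral_ofReal (integrableOn_mul_diskWeight
    (continuous_norm_eval_rpow P (by linarith)) (by linarith))]
  · refine ENNReal.ofReal_le_ofReal ?_
    rwa [le_div_iff₀' (by linarith)]
  · refine (ae_restrict_mem measurableSet_unitDisk).mono fun z hz => ?_
    have := one_sub_norm_sq_pos hz
    simp only [Pi.zero_apply]
    positivity

theorem lintegral_norm_rpow_le {α p : ℝ} (hα : -1 ≤ α) (hp : 2 < p) {f : ℂ → ℂ}
    (hf : DifferentiableOn ℂ f unitDisk) (hA : A2normSq α f ≠ ⊤) :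
    ∫⁻ z in unitDisk, ENNReal.ofReal ((1 - ‖z‖ ^ 2) ^ (p / 2 * (α + 2) - 2) * ‖f z‖ ^ p) ≤
      ENNReal.ofReal (Real.pi * (Real.exp (1 / Real.exp 1) / √2) ^ p *
        (A2normSq α f).toReal ^ (p / 2) / (p / 2 * (α + 2) - 1)) := by
  have hb : 1 < p / 2 * (α + 2) := by nlinarith
  set F : ℕ → ℂ → ℝ≥0∞ := fun n z =>
    ENNReal.ofReal ((1 - ‖z‖ ^ 2) ^ (p / 2 * (α + 2) - 2) * ‖(taylorPoly f n).eval z‖ ^ p) with hF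
  have hmeas : ∀ n, Measurable (F n) := fun n => by
    have := (taylorPoly f n).continuous.measurable
    fun_prop
  have hlim : ∀ z ∈ unitDisk, ENNReal.ofReal
      ((1 - ‖z‖ ^ 2) ^ (p / 2 * (α + 2) - 2) * ‖f z‖ ^ p) = liminf (fun n => F n z) atTop := by
    intro z hz
    refine (ENNReal.tendsto_ofReal (Tendsto.const_mul _ ?_)).liminf_eq.symm
    exact (tendsto_eval_taylorPoly hf hz).norm.rpow_const (Or.inr (by linarith))
  rw [setLIntegral_congr_fun measurableSet_unitDisk hlim]
  refine (lintegral_liminf_le hmeas).trans ?_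
  refine liminf_le_of_frequently_le' (Frequently.of_forall fun n => ?_)
  refine (lintegral_norm_eval_rpow_le _ (by linarith) hp).trans (ENNReal.ofReal_le_ofReal ?_)
  have h0 : 0 ≤ coeffNormSq (α + 2) (taylorPoly f n) :=
    tsum_nonneg fun k => div_nonneg (sq_nonneg _) (ccoef_pos (by linarith) k).le
  have h1 : coeffNormSq (α + 2) (taylorPoly f n) ≤ (A2normSq α f).toReal :=
    (ENNReal.ofReal_le_iff_le_toReal hA).1 (ofReal_coeffNormSq_taylorPoly_le hα f n)
  have h2 : 0 ≤ p / 2 * (α + 2) - 1 := by linarith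
  gcongr

/-- for α ≥ -1 and p > 2,
‖f‖_{A^p_{(p/2)(α+2)-2}} ≤ (e^{1/e}/√2) ‖f‖_{A²_α}. -/
theorem statement7 (α p : ℝ) (hα : -1 ≤ α) (hp : 2 < p) (f : ℂ → ℂ)
    (hf : DifferentiableOn ℂ f unitDisk) :
    ApNorm p (p / 2 * (α + 2) - 2) f ≤
      ENNReal.ofReal (Real.exp (1 / Real.exp 1) / Real.sqrt 2) * A2norm α f := by
  have hK : 0 < Real.exp (1 / Real.exp 1) / √2 := by positivity
  have hb : 1 < p / 2 * (α + 2) := by nlinarith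
  by_cases hA : A2normSq α f = ⊤
  · rw [A2norm, hA, ENNReal.top_rpow_of_pos (by norm_num), ENNReal.mul_top]
    · exact le_top
    · simpa using hK
  obtain ⟨K, hK_def⟩ : ∃ K, K = Real.exp (1 / Real.exp 1) / √2 := ⟨_, rfl⟩
  have h := lintegral_norm_rpow_le hα hp hf hA
  rw [← hK_def] at h hK ⊢
  set N := (A2normSq α f).toReal with hN
  have hN0 : 0 ≤ N := ENNReal.toReal_nonneg
  have h1 : ApIntPow p (p / 2 * (α + 2) - 2) f ≤ ENNReal.ofReal ((K * N ^ (1 / 2 : ℝ)) ^ p) := by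
    calc _ ≤ ENNReal.ofReal (p / 2 * (α + 2) - 2 + 1) * ENNReal.ofReal (Real.pi * K ^ p *
          N ^ (p / 2) / (p / 2 * (α + 2) - 1)) / ENNReal.ofReal Real.pi := by
          unfold ApIntPow
          gcongr
      _ = _ := by
          rw [← ENNReal.ofReal_mul (by linarith), ← ENNReal.ofReal_div_of_pos Real.pi_pos,
            Real.mul_rpow hK.le (by positivity), ← Real.rpow_mul hN0, one_div_mul_eq_div]
          have : p / 2 * (α + 2) - 1 ≠ 0 := by linarith
          have := Real.pi_ne_zero
          congr 1
          rw [show p / 2 * (α + 2) - 2 + 1 = p / 2 * (α + 2) - 1 by ring, mul_div_cancel₀ _ ‹_›]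
          field_simp
  calc _ ≤ ENNReal.ofReal ((K * N ^ (1 / 2 : ℝ)) ^ p) ^ (1 / p) :=
        ENNReal.rpow_le_rpow h1 (by positivity)
    _ = ENNReal.ofReal K * ENNReal.ofReal (N ^ (1 / 2 : ℝ)) := by
        rw [ENNReal.ofReal_rpow_of_nonneg (by positivity) (by positivity),
          ← Real.rpow_mul (by positivity), mul_one_div_cancel (by linarith), Real.rpow_one,
          ENNReal.ofReal_mul hK.le]
    _ = _ := by
        rw [← ENNReal.ofReal_rpow_of_nonneg hN0 (by norm_num), hN, ENNReal.ofReal_toReal hA, A2norm]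

end
end

section
/- The function x ↦ √((x−1)/x) · exp( x^{x−1} / (2e(x−1)^x) ) is decreasing on the interval (1, ∞). -/
open Set

/-- The difference between `1/x + 1/(x-1)` and `log (x/(x-1))`. -/
noncomputable def logGap (x : ℝ) : ℝ := x⁻¹ + (x - 1)⁻¹ - (Real.log x - Real.log (x - 1))

lemma inv_le_log_sub_log {x : ℝ} (hx : 1 < x) : x⁻¹ ≤ Real.log x - Real.log (x - 1) := by
  have h0 : 0 < x - 1 := by linarith
  have h := Real.one_sub_inv_le_log_of_pos (div_pos (by linarith : 0 < x) h0)
  rw [Real.log_div (by linarith) h0.ne'] at h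
  convert h using 1
  field_simp
  ring

lemma log_sub_log_le_inv {x : ℝ} (hx : 1 < x) : Real.log x - Real.log (x - 1) ≤ (x - 1)⁻¹ := by
  have h0 : 0 < x - 1 := by linarith
  have h := Real.log_le_sub_one_of_pos (div_pos (by linarith : 0 < x) h0)
  rw [Real.log_div (by linarith) h0.ne'] at h
  convert h using 1
  field_simp
  ring

lemma inv_le_logGap {x : ℝ} (hx : 1 < x) : x⁻¹ ≤ logGap x := by
  have := log_sub_log_le_inv hx
  unfold logGap
  linarith

lemma logGap_pos {x : ℝ} (hx : 1 < x) : 0 < logGap x :=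
  (inv_pos.2 (by linarith)).trans_le (inv_le_logGap hx)

lemma hasDerivAt_log_sub_one {x : ℝ} (hx : 1 < x) :
    HasDerivAt (fun y : ℝ => Real.log (y - 1)) (x - 1)⁻¹ x := by
  simpa using ((hasDerivAt_id x).sub_const 1).log (by simpa using (sub_pos.2 hx).ne')

lemma hasDerivAt_logGap {x : ℝ} (hx : 1 < x) :
    HasDerivAt logGap (-(x⁻¹ ^ 2 + (x - 1)⁻¹ ^ 2 - x⁻¹ * (x - 1)⁻¹)) x := by
  have h0 : x - 1 ≠ 0 := (sub_pos.2 hx).ne'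
  have h1 : x ≠ 0 := by linarith
  have h := ((hasDerivAt_inv h1).add (((hasDerivAt_id x).sub_const 1).inv h0)).sub
    ((Real.hasDerivAt_log h1).sub (hasDerivAt_log_sub_one hx))
  refine h.congr_deriv ?_
  simp only [id]
  field_simp
  ring

lemma logGap_mul_lt {x : ℝ} (hx : 1 < x) :
    (Real.log x - Real.log (x - 1)) * logGap x
      < x⁻¹ ^ 2 + (x - 1)⁻¹ ^ 2 - x⁻¹ * (x - 1)⁻¹ := by
  have h : x⁻¹ < (x - 1)⁻¹ := inv_strictAnti₀ (by linarith) (by linarith)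
  unfold logGap
  nlinarith [sq_nonneg (x⁻¹ + (x - 1)⁻¹ - 2 * (Real.log x - Real.log (x - 1))),
    pow_pos (sub_pos.2 h) 2]

lemma strictAntiOn_mul_log_add_log_logGap :
    StrictAntiOn (fun x : ℝ => x * Real.log x - (x - 1) * Real.log (x - 1) + Real.log (logGap x))
      (Ioi 1) := by
  have hd : ∀ x : ℝ, 1 < x → HasDerivAt
      (fun x : ℝ => x * Real.log x - (x - 1) * Real.log (x - 1) + Real.log (logGap x))
      (Real.log x - Real.log (x - 1)
        + -(x⁻¹ ^ 2 + (x - 1)⁻¹ ^ 2 - x⁻¹ * (x - 1)⁻¹) / logGap x) x := by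
    intro x hx
    have h0 : x - 1 ≠ 0 := (sub_pos.2 hx).ne'
    have h1 : x ≠ 0 := by linarith
    have h := (((hasDerivAt_id x).mul (Real.hasDerivAt_log h1)).sub
      (((hasDerivAt_id x).sub_const 1).mul (hasDerivAt_log_sub_one hx))).add
      ((hasDerivAt_logGap hx).log (logGap_pos hx).ne')
    refine h.congr_deriv ?_
    simp only [id]
    rw [mul_inv_cancel₀ h1, mul_inv_cancel₀ h0]
    ring
  refine strictAntiOn_of_deriv_neg (convex_Ioi 1)
    (fun x hx => (hd x hx).continuousAt.continuousWithinAt) fun x hx => ?_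
  rw [interior_Ioi] at hx
  rw [(hd x hx).deriv, neg_div, ← sub_eq_add_neg, sub_neg, lt_div_iff₀ (logGap_pos hx)]
  exact logGap_mul_lt hx

lemma one_sub_inv_le_mul_log_add_log_logGap {x : ℝ} (hx : 1 < x) :
    1 - x⁻¹ ≤ x * Real.log x - (x - 1) * Real.log (x - 1) + Real.log (logGap x) := by
  have h1 : x ≠ 0 := by linarith
  have h2 := Real.log_le_log (inv_pos.2 (by linarith)) (inv_le_logGap hx)
  rw [Real.log_inv] at h2
  have h3 := mul_le_mul_of_nonneg_left (inv_le_log_sub_log hx) (sub_pos.2 hx).le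
  rw [sub_mul, mul_inv_cancel₀ h1] at h3
  linarith

lemma one_lt_mul_log_add_log_logGap {x : ℝ} (hx : 1 < x) :
    1 < x * Real.log x - (x - 1) * Real.log (x - 1) + Real.log (logGap x) := by
  have hx' : 1 < x + 1 := by linarith
  refine lt_of_le_of_lt ?_ (strictAntiOn_mul_log_add_log_logGap (a := x) hx hx' (by linarith))
  have hlim : Filter.Tendsto (fun y : ℝ => 1 - y⁻¹) Filter.atTop (nhds 1) := by
    simpa using tendsto_inv_atTop_zero.const_sub (1 : ℝ)
  refine le_of_tendsto hlim ?_
  filter_upwards [Filter.eventually_ge_atTop (x + 1)] with y hy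
  have hy' : 1 < y := hx'.trans_le hy
  exact (one_sub_inv_le_mul_log_add_log_logGap hy').trans
    (strictAntiOn_mul_log_add_log_logGap.antitoneOn hx' hy' hy)

lemma inv_sub_inv_lt_exp_mul_logGap {x : ℝ} (hx : 1 < x) :
    (x - 1)⁻¹ - x⁻¹
      < Real.exp ((x - 1) * Real.log x - x * Real.log (x - 1) - 1) * logGap x := by
  have h0 : 0 < x - 1 := sub_pos.2 hx
  have h1 : 0 < x := by linarith
  have h2 : (x - 1)⁻¹ - x⁻¹ = Real.exp (-Real.log x - Real.log (x - 1)) := by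
    rw [Real.exp_sub, Real.exp_neg, Real.exp_log h1, Real.exp_log h0]
    field_simp
    ring
  rw [h2, ← Real.exp_log (logGap_pos hx), ← Real.exp_add, Real.exp_lt_exp]
  linarith [one_lt_mul_log_add_log_logGap hx]

lemma strictAntiOn_log_add_exp :
    StrictAntiOn (fun x : ℝ => (Real.log (x - 1) - Real.log x) / 2 +
      Real.exp ((x - 1) * Real.log x - x * Real.log (x - 1) - 1) / 2) (Ioi 1) := by
  have hd : ∀ x : ℝ, 1 < x → HasDerivAt
      (fun x : ℝ => (Real.log (x - 1) - Real.log x) / 2 +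
        Real.exp ((x - 1) * Real.log x - x * Real.log (x - 1) - 1) / 2)
      (((x - 1)⁻¹ - x⁻¹
        - Real.exp ((x - 1) * Real.log x - x * Real.log (x - 1) - 1) * logGap x) / 2) x := by
    intro x hx
    have h0 : x - 1 ≠ 0 := (sub_pos.2 hx).ne'
    have h1 : x ≠ 0 := by linarith
    have hl := Real.hasDerivAt_log h1
    have hm := hasDerivAt_log_sub_one hx
    have h := ((hm.sub hl).div_const 2).add
      ((((((hasDerivAt_id x).sub_const 1).mul hl).sub ((hasDerivAt_id x).mul hm)).sub_const
        1).exp.div_const 2)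
    refine h.congr_deriv ?_
    have h3 : 1 * Real.log x + (x - 1) * x⁻¹ - (1 * Real.log (x - 1) + x * (x - 1)⁻¹)
        = -logGap x := by
      unfold logGap
      field_simp
      ring
    simp only [id, Pi.sub_apply, Pi.mul_apply]
    rw [h3]
    ring
  refine strictAntiOn_of_deriv_neg (convex_Ioi 1)
    (fun x hx => (hd x hx).continuousAt.continuousWithinAt) fun x hx => ?_
  rw [interior_Ioi] at hx
  rw [(hd x hx).deriv]
  linarith [inv_sub_inv_lt_exp_mul_logGap hx]

lemma sqrt_mul_exp_eq_exp {x : ℝ} (hx : 1 < x) :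
    Real.sqrt ((x - 1) / x) * Real.exp (x ^ (x - 1) / (2 * Real.exp 1 * (x - 1) ^ x)) =
      Real.exp ((Real.log (x - 1) - Real.log x) / 2 +
        Real.exp ((x - 1) * Real.log x - x * Real.log (x - 1) - 1) / 2) := by
  have h0 : 0 < x - 1 := sub_pos.2 hx
  have h1 : 0 < x := by linarith
  rw [Real.exp_add, ← Real.log_div h0.ne' h1.ne', Real.exp_half, Real.exp_log (div_pos h0 h1),
    Real.rpow_def_of_pos h1, Real.rpow_def_of_pos h0, Real.exp_sub, Real.exp_sub,
    mul_comm (x - 1), mul_comm x (Real.log (x - 1))]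
  congr 2
  field_simp

/-- the function x ↦ √((x-1)/x) · exp(x^{x-1}/(2e(x-1)^x)) is decreasing
on (1, ∞). -/
theorem statement8 :
    StrictAntiOn
      (fun x : ℝ => Real.sqrt ((x - 1) / x) *
        Real.exp (x ^ (x - 1) / (2 * Real.exp 1 * (x - 1) ^ x)))
      (Set.Ioi (1 : ℝ)) :=
  (Real.exp_strictMono.comp_strictAntiOn strictAntiOn_log_add_exp).congr
    fun _ hx => (sqrt_mul_exp_eq_exp hx).symm
end

section
/- Let k ≥ 2 be an integer and define C(p) := (p/2)^{1/p} · (k−1)^{1/2 − k/p} · k^{(k−1)/p − 1/2} for p ∈ (2(k−1), 2k]. Then C(p) ≤ √((k−1)/k) · exp( k^{k−1} / (2e(k−1)^k) ) for all p ∈ (2(k−1), 2k], with the maximum of C on this interval attained at p = 2e(k−1)^k / k^{k−1}. -/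
open Set

section

variable {k : ℝ}

theorem rpow_mul_rpow_mul_rpow_eq_sqrt_mul_exp (hk : 1 < k) {p : ℝ} (hp : 0 < p) :
    (p / 2) ^ (1 / p) * (k - 1) ^ (1 / 2 - k / p) * k ^ ((k - 1) / p - 1 / 2) =
      Real.sqrt ((k - 1) / k) *
        Real.exp ((Real.log (p / 2) - (k * Real.log (k - 1) - (k - 1) * Real.log k)) / p) := by
  have hm : 0 < k - 1 := by linarith
  have hk₀ : 0 < k := by linarith
  rw [Real.sqrt_eq_rpow, Real.rpow_def_of_pos (half_pos hp), Real.rpow_def_of_pos hm,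
    Real.rpow_def_of_pos hk₀, Real.rpow_def_of_pos (div_pos hm hk₀),
    Real.log_div hm.ne' hk₀.ne', ← Real.exp_add, ← Real.exp_add, ← Real.exp_add]
  congr 1
  field_simp
  ring

theorem two_mul_exp_one_mul_rpow_div_rpow (hk : 1 < k) :
    2 * Real.exp 1 * (k - 1) ^ k / k ^ (k - 1) =
      2 * Real.exp (1 + (k * Real.log (k - 1) - (k - 1) * Real.log k)) := by
  have hm : 0 < k - 1 := by linarith
  have hk₀ : 0 < k := by linarith
  rw [Real.rpow_def_of_pos hm, Real.rpow_def_of_pos hk₀, mul_assoc, ← Real.exp_add,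
    mul_div_assoc, ← Real.exp_sub]
  ring_nf

theorem log_half_sub_div_le (c : ℝ) {p : ℝ} (hp : 0 < p) :
    (Real.log (p / 2) - c) / p ≤ 1 / (2 * Real.exp (1 + c)) := by
  have h := Real.log_le_sub_one_of_pos (div_pos (half_pos hp) (Real.exp_pos (1 + c)))
  rw [Real.log_div (half_pos hp).ne' (Real.exp_pos _).ne', Real.log_exp] at h
  rw [div_le_iff₀ hp]
  calc Real.log (p / 2) - c ≤ p / 2 / Real.exp (1 + c) := by linarith
    _ = 1 / (2 * Real.exp (1 + c)) * p := by field_simp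

theorem two_mul_exp_mem_Ioc (hk : 1 < k) :
    2 * Real.exp (1 + (k * Real.log (k - 1) - (k - 1) * Real.log k)) ∈
      Ioc (2 * (k - 1)) (2 * k) := by
  have hm : 0 < k - 1 := by linarith
  have hk₀ : 0 < k := by linarith
  constructor
  · have h := Real.log_lt_sub_one_of_pos (div_pos hk₀ hm)
      (by rw [Ne, div_eq_one_iff_eq hm.ne']; linarith)
    rw [Real.log_div hk₀.ne' hm.ne', div_sub_one hm.ne', lt_div_iff₀ hm] at h
    have := (Real.log_lt_iff_lt_exp hm).1
      (show Real.log (k - 1) < 1 + (k * Real.log (k - 1) - (k - 1) * Real.log k) by linarith)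
    linarith
  · have h := Real.log_le_sub_one_of_pos (div_pos hm hk₀)
    rw [Real.log_div hm.ne' hk₀.ne', div_sub_one hk₀.ne', le_div_iff₀ hk₀] at h
    have := (Real.le_log_iff_exp_le hk₀).1
      (show 1 + (k * Real.log (k - 1) - (k - 1) * Real.log k) ≤ Real.log k by linarith)
    linarith

end

/-- for an integer k ≥ 2 and C(p) = (p/2)^{1/p} (k-1)^{1/2-k/p} k^{(k-1)/p-1/2}
on (2(k-1), 2k], one has C(p) ≤ √((k-1)/k) · exp(k^{k-1}/(2e(k-1)^k)), and the maximum of C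
on this interval is attained at p = 2e(k-1)^k/k^{k-1}. -/
theorem statement9 (k : ℕ) (hk : 2 ≤ k) :
    (∀ p ∈ Set.Ioc (2 * ((k : ℝ) - 1)) (2 * (k : ℝ)),
      (p / 2) ^ (1 / p) * ((k : ℝ) - 1) ^ (1 / 2 - (k : ℝ) / p) *
          (k : ℝ) ^ (((k : ℝ) - 1) / p - 1 / 2) ≤
        Real.sqrt (((k : ℝ) - 1) / k) *
          Real.exp ((k : ℝ) ^ ((k : ℝ) - 1) / (2 * Real.exp 1 * ((k : ℝ) - 1) ^ (k : ℝ)))) ∧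
    2 * Real.exp 1 * ((k : ℝ) - 1) ^ (k : ℝ) / (k : ℝ) ^ ((k : ℝ) - 1) ∈
      Set.Ioc (2 * ((k : ℝ) - 1)) (2 * (k : ℝ)) ∧
    IsMaxOn
      (fun p : ℝ => (p / 2) ^ (1 / p) * ((k : ℝ) - 1) ^ (1 / 2 - (k : ℝ) / p) *
        (k : ℝ) ^ (((k : ℝ) - 1) / p - 1 / 2))
      (Set.Ioc (2 * ((k : ℝ) - 1)) (2 * (k : ℝ)))
      (2 * Real.exp 1 * ((k : ℝ) - 1) ^ (k : ℝ) / (k : ℝ) ^ ((k : ℝ) - 1)) := by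
  have hk₁ : (1 : ℝ) < k := by exact_mod_cast hk
  have hexponent : (k : ℝ) ^ ((k : ℝ) - 1) / (2 * Real.exp 1 * ((k : ℝ) - 1) ^ (k : ℝ)) =
      1 / (2 * Real.exp (1 + (k * Real.log (k - 1) - (k - 1) * Real.log k))) := by
    rw [← two_mul_exp_one_mul_rpow_div_rpow hk₁, one_div_div]
  rw [hexponent, two_mul_exp_one_mul_rpow_div_rpow hk₁]
  have hbound : ∀ p ∈ Ioc (2 * ((k : ℝ) - 1)) (2 * (k : ℝ)),
      (p / 2) ^ (1 / p) * ((k : ℝ) - 1) ^ (1 / 2 - (k : ℝ) / p) *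
          (k : ℝ) ^ (((k : ℝ) - 1) / p - 1 / 2) ≤
        Real.sqrt (((k : ℝ) - 1) / k) *
          Real.exp (1 / (2 * Real.exp (1 + (k * Real.log (k - 1) - (k - 1) * Real.log k)))) := by
    intro p hp
    have hp₀ : 0 < p := by linarith [hp.1]
    rw [rpow_mul_rpow_mul_rpow_eq_sqrt_mul_exp hk₁ hp₀]
    exact mul_le_mul_of_nonneg_left (Real.exp_le_exp.2 (log_half_sub_div_le _ hp₀))
      (Real.sqrt_nonneg _)
  refine ⟨hbound, two_mul_exp_mem_Ioc hk₁, fun p hp => (hbound p hp).trans_eq ?_⟩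
  dsimp only
  rw [rpow_mul_rpow_mul_rpow_eq_sqrt_mul_exp hk₁ (by positivity),
    mul_div_cancel_left₀ _ two_ne_zero, Real.log_exp, add_sub_cancel_right]
end

section
/- Let f be holomorphic on 𝔻 with ∑_{n≥0} |a_n|² < ∞, where a_n are the Taylor coefficients of f at the origin. Then lim_{p → 2⁺} ‖f‖_{A^p_{p/2 − 2}} = (∑_{n≥0} |a_n|²)^{1/2}, i.e., the A^p_{p/2−2} norms converge to the Hardy H² norm of f as p decreases to 2. -/
open MeasureTheory Set Filter
open scoped ENNReal NNReal Topology

noncomputable section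

theorem lintegral_unitBall_polar (g : ℂ → ℝ≥0∞) (hg : Measurable g) :
    ∫⁻ z in Metric.ball (0 : ℂ) 1, g z = ∫⁻ r in Ioo (0 : ℝ) 1,
      ∫⁻ θ in Ioo (-Real.pi) Real.pi, ENNReal.ofReal r * g (circleMap 0 r θ) := by
  rw [← lintegral_indicator measurableSet_ball, ← Complex.lintegral_comp_polarCoord_symm]
  have hc : Measurable fun q : ℝ × ℝ => circleMap 0 q.1 q.2 :=
    Real.circleMap.continuous.measurable
  have hm : Measurable fun q : ℝ × ℝ =>
      ENNReal.ofReal q.1 * g (circleMap 0 q.1 q.2) :=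
    (ENNReal.measurable_ofReal.comp measurable_fst).mul (hg.comp hc)
  rw [← lintegral_prod (f := fun q : ℝ × ℝ => ENNReal.ofReal q.1 * g (circleMap 0 q.1 q.2))
    hm.aemeasurable, Measure.prod_restrict, ← Measure.volume_eq_prod,
    ← lintegral_indicator (measurableSet_Ioo.prod measurableSet_Ioo),
    ← lintegral_indicator (by exact measurableSet_Ioi.prod measurableSet_Ioo)]
  refine lintegral_congr fun q => ?_
  have hq : Complex.polarCoord.symm q = circleMap 0 q.1 q.2 := by
    simp [circleMap, Complex.exp_mul_I]
  have hn : ‖circleMap 0 q.1 q.2‖ = |q.1| := by simp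
  by_cases h1 : q ∈ polarCoord.target
  · rw [indicator_of_mem h1, hq, smul_eq_mul]
    by_cases h2 : q.1 < 1
    · rw [indicator_of_mem, indicator_of_mem
        (show q ∈ Ioo (0 : ℝ) 1 ×ˢ Ioo (-Real.pi) Real.pi from ⟨⟨h1.1, h2⟩, h1.2⟩)]
      rw [mem_ball_zero_iff, hn, abs_of_pos h1.1]; exact h2
    · rw [indicator_of_notMem, indicator_of_notMem (fun h => h2 h.1.2), mul_zero]
      rw [mem_ball_zero_iff, hn, abs_of_pos h1.1]; exact h2
  · rw [indicator_of_notMem h1, indicator_of_notMem (fun h => h1 ⟨h.1.1, h.2⟩)]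

theorem lintegral_circle_eq_circleAverage (g : ℂ → ℝ) (r : ℝ)
    (hg : Continuous fun θ => g (circleMap 0 r θ)) (h0 : ∀ θ, 0 ≤ g (circleMap 0 r θ)) :
    ∫⁻ θ in Ioo (-Real.pi) Real.pi, ENNReal.ofReal (g (circleMap 0 r θ)) =
      ENNReal.ofReal (2 * Real.pi * Real.circleAverage g 0 r) := by
  have hpi := Real.pi_pos
  rw [Real.circleAverage_eq_integral_add (-Real.pi),
    intervalIntegral.integral_comp_add_right (fun θ => g (circleMap 0 r θ)), smul_eq_mul,
    mul_inv_cancel_left₀ (by positivity), intervalIntegral.integral_of_le (by linarith),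
    show (0 : ℝ) + -Real.pi = -Real.pi by ring, show 2 * Real.pi + -Real.pi = Real.pi by ring,
    ofReal_integral_eq_lintegral_ofReal, restrict_Ioo_eq_restrict_Ioc]
  · exact (hg.integrableOn_Icc).mono_set Ioc_subset_Icc_self
  · exact ae_of_all _ fun θ => h0 _

theorem lintegral_radial_weight {a γ : ℝ} (ha : 0 ≤ a) (ha1 : a ≤ 1) (hγ : 0 < γ) :
    ∫⁻ r in Ioo a 1, ENNReal.ofReal (r * (1 - r ^ 2) ^ (γ - 1)) =
      ENNReal.ofReal ((1 - a ^ 2) ^ γ / (2 * γ)) := by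
  have hcont : ContinuousOn (fun r : ℝ => -((1 - r ^ 2) ^ γ / (2 * γ))) (Icc a 1) := by
    refine (ContinuousOn.div_const (ContinuousOn.rpow_const (by fun_prop) ?_) _).neg
    intro x _; exact Or.inr hγ.le
  have hder : ∀ r ∈ Ioo a 1, HasDerivAt (fun r : ℝ => -((1 - r ^ 2) ^ γ / (2 * γ)))
      (r * (1 - r ^ 2) ^ (γ - 1)) r := by
    intro r hr
    have hpos : 0 < 1 - r ^ 2 := by nlinarith [hr.1, hr.2]
    have h1 : HasDerivAt (fun r : ℝ => 1 - r ^ 2) (-(2 * r)) r := by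
      simpa using ((hasDerivAt_id r).pow 2).const_sub 1
    convert! ((h1.rpow_const (p := γ) (Or.inl hpos.ne')).div_const (2 * γ)).neg using 1
    field_simp
  have hnn : ∀ r ∈ Ioo a 1, 0 ≤ r * (1 - r ^ 2) ^ (γ - 1) := by
    intro r hr
    have hpos : 0 < 1 - r ^ 2 := by nlinarith [hr.1, hr.2]
    exact mul_nonneg (ha.trans hr.1.le) (Real.rpow_nonneg hpos.le _)
  have hint := intervalIntegral.integrableOn_deriv_of_nonneg hcont hder hnn
  have hftc := intervalIntegral.integral_eq_sub_of_hasDerivAt_of_le ha1 hcont hder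
    ((intervalIntegrable_iff_integrableOn_Ioc_of_le ha1).2 hint)
  rw [← ofReal_integral_eq_lintegral_ofReal (hint.mono_set Ioo_subset_Ioc_self),
    ← integral_Ioc_eq_integral_Ioo, ← intervalIntegral.integral_of_le ha1, hftc]
  · simp [Real.zero_rpow hγ.ne']
  · exact (ae_restrict_iff' measurableSet_Ioo).2 (ae_of_all _ hnn)

theorem lintegral_rpow_mul_sub {x p : ℝ} (hx : 0 ≤ x) (hp : 2 ≤ p) :
    ∫⁻ l in Ioi (0 : ℝ), ENNReal.ofReal (l ^ (p - 2)) * ENNReal.ofReal (x - l) =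
      ENNReal.ofReal (x ^ p / (p * (p - 1))) := by
  have h1 : ∫⁻ l in Ioi (0 : ℝ), ENNReal.ofReal (l ^ (p - 2)) * ENNReal.ofReal (x - l) =
      ∫⁻ l in Ioc (0 : ℝ) x, ENNReal.ofReal (l ^ (p - 2) * (x - l)) := by
    rw [← lintegral_indicator measurableSet_Ioi, ← lintegral_indicator measurableSet_Ioc]
    refine lintegral_congr fun l => ?_
    by_cases h : l ∈ Ioc 0 x
    · rw [indicator_of_mem h, indicator_of_mem (show l ∈ Ioi 0 from h.1),
        ENNReal.ofReal_mul (Real.rpow_nonneg (le_of_lt h.1) _)]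
    · rw [indicator_of_notMem h]
      by_cases h' : l ∈ Ioi 0
      · rw [indicator_of_mem h', ENNReal.ofReal_of_nonpos (p := x - l), mul_zero]
        have : ¬ l ≤ x := fun h2 => h ⟨h', h2⟩
        linarith
      · rw [indicator_of_notMem h']
  have hF : ContinuousOn (fun l : ℝ => l ^ (p - 2) * (x - l)) (Icc 0 x) :=
    (ContinuousOn.rpow_const continuousOn_id fun _ _ => Or.inr (by linarith)).mul (by fun_prop)
  have hI := hF.integrableOn_Icc.mono_set (μ := volume) Ioc_subset_Icc_self
  rw [h1, ← ofReal_integral_eq_lintegral_ofReal hI, ← intervalIntegral.integral_of_le hx]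
  · congr 1
    have e : ∀ l ∈ uIcc 0 x, l ^ (p - 2) * (x - l) = x * l ^ (p - 2) - l ^ (p - 1) := by
      intro l hl
      rw [uIcc_of_le hx] at hl
      have : l ^ (p - 1) = l ^ (p - 2) * l := by
        rw [← Real.rpow_add_one' hl.1 (by linarith)]; ring_nf
      rw [this]; ring
    rw [intervalIntegral.integral_congr e, intervalIntegral.integral_sub,
      intervalIntegral.integral_const_mul, integral_rpow (Or.inl (by linarith)),
      integral_rpow (Or.inl (by linarith)), Real.zero_rpow (by linarith),
      Real.zero_rpow (by linarith), show p - 2 + 1 = p - 1 by ring, show p - 1 + 1 = p by ring]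
    · have : x ^ p = x ^ (p - 1) * x := by
        rw [← Real.rpow_add_one' hx (by linarith)]; ring_nf
      have h2 : p - 1 ≠ 0 := by linarith
      have h3 : p ≠ 0 := by linarith
      rw [this]; field_simp; ring
    · exact (intervalIntegral.intervalIntegrable_rpow (Or.inl (by linarith))).const_mul _
    · exact intervalIntegral.intervalIntegrable_rpow (Or.inl (by linarith))
  · refine (ae_restrict_iff' measurableSet_Ioc).2 (ae_of_all _ fun l hl => ?_)
    exact mul_nonneg (Real.rpow_nonneg hl.1.le _) (by linarith [hl.2])

theorem continuous_comp_circleMap {F : ℂ → ℂ} (hF : DifferentiableOn ℂ F (Metric.ball 0 1))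
    {r : ℝ} (hr : |r| < 1) : Continuous fun θ => F (circleMap 0 r θ) :=
  hF.continuousOn.comp_continuous (continuous_circleMap 0 r) fun θ => by simpa using hr

theorem lintegral_circle_sub_mono {F : ℂ → ℂ} (hF : DifferentiableOn ℂ F (Metric.ball 0 1))
    {r R l : ℝ} (hr : 0 < r) (hrR : r < R) (hR : R < 1) (hl : 0 ≤ l) :
    ∫⁻ θ in Ioo (-Real.pi) Real.pi, ENNReal.ofReal (‖F (circleMap 0 r θ)‖ - l) ≤
      ∫⁻ θ in Ioo (-Real.pi) Real.pi, ENNReal.ofReal (‖F (circleMap 0 R θ)‖ - l) := by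
  have hpi := Real.pi_pos
  have hR0 : 0 < R := hr.trans hrR
  set k : ℝ → ℝ → ℝ := fun θ φ => poissonKernel 0 (circleMap 0 r θ) (circleMap 0 R φ) with hk
  have hk1 : ∀ θ φ, k θ φ = (R ^ 2 - r ^ 2) / ‖circleMap 0 R φ - circleMap 0 r θ‖ ^ 2 := by
    intro θ φ
    simp [hk, poissonKernel_def]
  have hne : ∀ θ φ, ‖circleMap 0 R φ - circleMap 0 r θ‖ ^ 2 ≠ 0 := by
    intro θ φ h
    have h1 : circleMap 0 R φ = circleMap 0 r θ := by
      rw [← sub_eq_zero, ← norm_eq_zero]; exact pow_eq_zero_iff (two_ne_zero) |>.1 h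
    have h2 := congrArg norm h1
    simp only [norm_circleMap_zero, abs_of_pos hr, abs_of_pos hR0] at h2
    linarith
  have hk0 : ∀ θ φ, 0 ≤ k θ φ := by
    intro θ φ
    rw [hk1]
    exact div_nonneg (by nlinarith) (by positivity)
  have hkc : Continuous fun q : ℝ × ℝ => k q.1 q.2 := by
    simp only [hk1]
    refine Continuous.div (by fun_prop) ?_ fun q => hne _ _
    exact (((continuous_circleMap 0 R).comp continuous_snd).sub
      ((continuous_circleMap 0 r).comp continuous_fst)).norm.pow 2
  have hsymm : ∀ θ φ, k θ φ = k φ θ := by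
    intro θ φ
    rw [hk1, hk1]
    congr 1
    rw [Complex.sq_norm, Complex.sq_norm]
    simp only [circleMap, zero_add, Complex.exp_mul_I, Complex.normSq_apply]
    simp only [← Complex.ofReal_cos, ← Complex.ofReal_sin, Complex.sub_re, Complex.sub_im,
      Complex.mul_re, Complex.mul_im, Complex.add_re, Complex.add_im, Complex.ofReal_re,
      Complex.ofReal_im, Complex.I_re, Complex.I_im]
    linear_combination (R ^ 2 - r ^ 2) * Real.sin_sq_add_cos_sq φ -
      (R ^ 2 - r ^ 2) * Real.sin_sq_add_cos_sq θ
  have hw : ∀ θ, circleMap 0 r θ ∈ Metric.ball (0 : ℂ) R := by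
    intro θ; simpa [abs_of_pos hr] using hrR
  have hkθ : ∀ θ, Continuous fun φ => k θ φ := fun θ => by
    have := hkc.comp (Continuous.prodMk_right θ)
    exact this
  have hone : ∀ θ, ∫⁻ φ in Ioo (-Real.pi) Real.pi, ENNReal.ofReal (k θ φ) =
      ENNReal.ofReal (2 * Real.pi) := by
    intro θ
    refine (lintegral_circle_eq_circleAverage (poissonKernel 0 (circleMap 0 r θ)) R
      (hkθ θ) (hk0 θ)).trans ?_
    have := (diffContOnCl_const (c := (1 : ℂ)) (s := Metric.ball (0 : ℂ) R)
      |>.circleAverage_poissonKernel_smul (hw θ))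
    have h2 : Real.circleAverage (poissonKernel 0 (circleMap 0 r θ)) 0 R = 1 := by
      have h3 : (poissonKernel 0 (circleMap 0 r θ) • fun _ : ℂ => (1 : ℂ)) =
          fun z => ((poissonKernel 0 (circleMap 0 r θ) z : ℝ) : ℂ) := by
        ext z; simp
      rw [h3, Real.circleAverage_def, intervalIntegral.integral_ofReal] at this
      rw [Real.circleAverage_def]
      rw [Complex.real_smul] at this
      exact_mod_cast this
    rw [h2, mul_one]
  have hFR : Continuous fun φ => F (circleMap 0 R φ) :=
    continuous_comp_circleMap hF (by rwa [abs_of_pos hR0])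
  have hpt : ∀ θ, ENNReal.ofReal (2 * Real.pi) * ENNReal.ofReal (‖F (circleMap 0 r θ)‖ - l) ≤
      ∫⁻ φ in Ioo (-Real.pi) Real.pi,
        ENNReal.ofReal (k θ φ) * ENNReal.ofReal (‖F (circleMap 0 R φ)‖ - l) := by
    intro θ
    have hd : DiffContOnCl ℂ F (Metric.ball 0 R) := by
      refine (hF.mono ?_).diffContOnCl
      exact (Metric.closure_ball_subset_closedBall).trans (Metric.closedBall_subset_ball hR)
    have hP := hd.circleAverage_poissonKernel_smul (hw θ)
    rw [Real.circleAverage_eq_integral_add (-Real.pi),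
      intervalIntegral.integral_comp_add_right
        (fun φ => (poissonKernel 0 (circleMap 0 r θ) • F) (circleMap 0 R φ)),
      intervalIntegral.integral_of_le (by linarith),
      show (0 : ℝ) + -Real.pi = -Real.pi by ring,
      show 2 * Real.pi + -Real.pi = Real.pi by ring, inv_smul_eq_iff₀ (by positivity),
      integral_Ioc_eq_integral_Ioo] at hP
    have h1 : ENNReal.ofReal (2 * Real.pi) * ENNReal.ofReal ‖F (circleMap 0 r θ)‖ ≤
        ∫⁻ φ in Ioo (-Real.pi) Real.pi,
          ENNReal.ofReal (k θ φ) * ENNReal.ofReal ‖F (circleMap 0 R φ)‖ := by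
      have h2 := enorm_integral_le_lintegral_enorm (μ := volume.restrict (Ioo (-Real.pi) Real.pi))
        (fun φ => (poissonKernel 0 (circleMap 0 r θ) • F) (circleMap 0 R φ))
      rw [hP, enorm_smul, Real.enorm_of_nonneg (by positivity), ← ofReal_norm] at h2
      refine h2.trans (lintegral_mono fun φ => ?_)
      rw [Pi.smul_apply', enorm_smul, ← ofReal_norm (F _),
        Real.enorm_of_nonneg (hk0 θ φ)]
    rw [ENNReal.ofReal_sub _ hl, ENNReal.mul_sub (fun _ _ => ENNReal.ofReal_ne_top),
      tsub_le_iff_right]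
    refine h1.trans ?_
    rw [← hone θ, ← lintegral_mul_const _ (by fun_prop), ← lintegral_add_right _ (by fun_prop)]
    refine lintegral_mono fun φ => ?_
    rw [← mul_add]
    gcongr
    rw [← tsub_le_iff_right, ENNReal.ofReal_sub _ hl]
  have h2pi : ENNReal.ofReal (2 * Real.pi) ≠ 0 := by
    rw [Ne, ENNReal.ofReal_eq_zero, not_le]; positivity
  rw [← ENNReal.mul_le_mul_iff_right h2pi ENNReal.ofReal_ne_top,
    ← lintegral_const_mul' _ _ ENNReal.ofReal_ne_top]
  refine (lintegral_mono hpt).trans ?_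
  have hm : Measurable fun φ => ENNReal.ofReal (‖F (circleMap 0 R φ)‖ - l) :=
    (hFR.norm.sub continuous_const).measurable.ennreal_ofReal
  rw [lintegral_lintegral_swap (Measurable.aemeasurable (by
    exact (ENNReal.measurable_ofReal.comp hkc.measurable).mul (hm.comp measurable_snd))),
    ← lintegral_const_mul' _ _ ENNReal.ofReal_ne_top]
  refine lintegral_mono fun φ => ?_
  simp_rw [hsymm _ φ]
  rw [lintegral_mul_const' _ _ ENNReal.ofReal_ne_top, hone]

theorem summable_norm_mul_pow {a : ℕ → ℂ} (ha : Summable fun n => ‖a n‖ ^ 2) {r : ℝ}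
    (h0 : 0 ≤ r) (h1 : r < 1) : Summable fun n => ‖a n‖ * r ^ n := by
  have hg : Summable fun n => (r ^ 2) ^ n :=
    summable_geometric_of_lt_one (by positivity) (by nlinarith)
  refine Summable.of_nonneg_of_le (fun n => by positivity) (fun n => ?_) (ha.add hg)
  rw [← pow_mul, mul_comm 2 n, pow_mul]
  nlinarith [sq_nonneg (‖a n‖ - r ^ n), norm_nonneg (a n), pow_nonneg h0 n]

theorem circleAverage_norm_sq_partialSum (a : ℕ → ℂ) {r : ℝ} (hr : 0 ≤ r) (N : ℕ) :
    Real.circleAverage (fun z => ‖∑ n ∈ Finset.range N, a n * z ^ n‖ ^ 2) 0 r =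
      ∑ n ∈ Finset.range N, ‖a n‖ ^ 2 * (r ^ 2) ^ n := by
  set p : Polynomial ℂ := ∑ n ∈ Finset.range N, Polynomial.monomial n (a n * (r : ℂ) ^ n) with hp
  have hco : ∀ n, p.coeff n = if n < N then a n * (r : ℂ) ^ n else 0 := by
    intro n
    simp [hp, Polynomial.finsetSum_coeff, Polynomial.coeff_monomial]
  have hev : ∀ z, p.eval z = ∑ n ∈ Finset.range N, a n * (r * z + 0) ^ n := by
    intro z
    simp [hp, Polynomial.eval_finsetSum, mul_pow, mul_assoc]
  rw [Real.circleAverage_eq_circleAverage_zero_one]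
  simp_rw [← hev]
  rw [← p.sum_sq_norm_coeff_eq_circleAverage,
    Finset.sum_subset (s₂ := Finset.range N)]
  · refine Finset.sum_congr rfl fun n hn => ?_
    rw [hco, if_pos (Finset.mem_range.1 hn), norm_mul, norm_pow, Complex.norm_real,
      Real.norm_of_nonneg hr]
    ring
  · intro n hn
    rw [Polynomial.mem_support_iff, hco] at hn
    by_contra h
    simp_all
  · intro n _ hn
    rw [Polynomial.notMem_support_iff] at hn
    simp [hn]

theorem circleAverage_norm_sq_eq_tsum {F : ℂ → ℂ} {a : ℕ → ℂ}
    (ha : Summable fun n => ‖a n‖ ^ 2)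
    (hF : ∀ z ∈ Metric.ball (0 : ℂ) 1, HasSum (fun n => a n * z ^ n) (F z)) {r : ℝ}
    (h0 : 0 ≤ r) (h1 : r < 1) :
    Real.circleAverage (fun z => ‖F z‖ ^ 2) 0 r = ∑' n, ‖a n‖ ^ 2 * (r ^ 2) ^ n := by
  have hs : Summable fun n => ‖a n‖ ^ 2 * (r ^ 2) ^ n := by
    refine ha.of_nonneg_of_le (fun n => by positivity) fun n => ?_
    exact mul_le_of_le_one_right (by positivity) (pow_le_one₀ (by positivity) (by nlinarith))
  have hlim : Tendsto (fun N => Real.circleAverage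
      (fun z => ‖∑ n ∈ Finset.range N, a n * z ^ n‖ ^ 2) 0 r) atTop
      (𝓝 (Real.circleAverage (fun z => ‖F z‖ ^ 2) 0 r)) := by
    simp only [Real.circleAverage_def]
    refine Tendsto.const_smul (intervalIntegral.tendsto_integral_filter_of_dominated_convergence
      (fun _ => (∑' n, ‖a n‖ * r ^ n) ^ 2) ?_ ?_ intervalIntegrable_const ?_) _
    · refine Eventually.of_forall fun N => Continuous.aestronglyMeasurable ?_
      have := continuous_circleMap 0 r
      fun_prop
    · refine Eventually.of_forall fun N => ae_of_all _ fun θ _ => ?_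
      rw [Real.norm_of_nonneg (by positivity)]
      gcongr
      refine (norm_sum_le _ _).trans (le_trans (le_of_eq ?_)
        ((summable_norm_mul_pow ha h0 h1).sum_le_tsum (Finset.range N) fun n _ => by positivity))
      simp [abs_of_nonneg h0]
    · refine ae_of_all _ fun θ _ => ?_
      exact ((hF _ (by simpa [abs_of_nonneg h0] using h1)).tendsto_sum_nat.norm).pow 2
  refine tendsto_nhds_unique hlim ?_
  simp_rw [circleAverage_norm_sq_partialSum a h0]
  exact hs.hasSum.tendsto_sum_nat

theorem norm_sq_mul_le_tsum {F : ℂ → ℂ} {a : ℕ → ℂ}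
    (ha : Summable fun n => ‖a n‖ ^ 2)
    (hF : ∀ z ∈ Metric.ball (0 : ℂ) 1, HasSum (fun n => a n * z ^ n) (F z)) {z : ℂ}
    (hz : z ∈ Metric.ball (0 : ℂ) 1) :
    ‖F z‖ ^ 2 * (1 - ‖z‖ ^ 2) ≤ ∑' n, ‖a n‖ ^ 2 := by
  have hz' : ‖z‖ < 1 := by simpa using hz
  have hpos : 0 < 1 - ‖z‖ ^ 2 := by nlinarith [norm_nonneg z]
  rw [← le_div_iff₀ hpos, div_eq_mul_inv]
  refine le_of_tendsto ((hF z hz).tendsto_sum_nat.norm.pow 2) (Eventually.of_forall fun N => ?_)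
  calc ‖∑ n ∈ Finset.range N, a n * z ^ n‖ ^ 2
      ≤ (∑ n ∈ Finset.range N, ‖a n‖ * ‖z‖ ^ n) ^ 2 := by
        gcongr
        refine (norm_sum_le _ _).trans (le_of_eq (by simp))
    _ ≤ (∑ n ∈ Finset.range N, ‖a n‖ ^ 2) * ∑ n ∈ Finset.range N, (‖z‖ ^ n) ^ 2 :=
        Finset.sum_mul_sq_le_sq_mul_sq _ _ _
    _ ≤ (∑' n, ‖a n‖ ^ 2) * (1 - ‖z‖ ^ 2)⁻¹ := by
        have hlt : ‖z‖ ^ 2 < 1 := by linarith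
        gcongr
        · exact ha.sum_le_tsum _ fun n _ => by positivity
        · rw [← tsum_geometric_of_lt_one (by positivity) hlt]
          refine le_trans (le_of_eq (Finset.sum_congr rfl fun n _ => ?_))
            ((summable_geometric_of_lt_one (by positivity) hlt).sum_le_tsum (Finset.range N)
              fun n _ => by positivity)
          rw [← pow_mul, ← pow_mul, mul_comm]

theorem rpow_le_lintegral_superlevel {x s S p : ℝ} (hx : 0 ≤ x) (hp : 2 ≤ p)
    (hs : 0 < s) (hS : x ^ 2 * s ≤ S) :
    ENNReal.ofReal (x ^ p) ≤ ∫⁻ l in Ioi (0 : ℝ), ENNReal.ofReal (p * (p - 1) * l ^ (p - 2)) *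
      ({l : ℝ | l ^ 2 * s < S}.indicator 1 l * ENNReal.ofReal (x - l)) := by
  have hc : 0 < p * (p - 1) := by nlinarith
  have h := lintegral_rpow_mul_sub hx hp
  have h2 : ENNReal.ofReal (x ^ p) = ENNReal.ofReal (p * (p - 1)) *
      ENNReal.ofReal (x ^ p / (p * (p - 1))) := by
    rw [← ENNReal.ofReal_mul hc.le, mul_div_cancel₀ _ hc.ne']
  rw [h2, ← h, ← lintegral_const_mul' _ _ ENNReal.ofReal_ne_top]
  refine setLIntegral_mono' measurableSet_Ioi fun l hl => ?_
  rw [ENNReal.ofReal_mul hc.le, mul_assoc]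
  gcongr
  by_cases hlx : l < x
  · rw [indicator_of_mem, Pi.one_apply, one_mul]
    have hl0 : 0 < l := hl
    have : l ^ 2 < x ^ 2 := by nlinarith
    exact (mul_lt_mul_of_pos_right this hs).trans_le hS
  · rw [ENNReal.ofReal_of_nonpos (by linarith)]
    simp

theorem rpow_mul_lintegral_radial_le {l S p : ℝ} (hl : 0 < l) (hS : 0 ≤ S) (hp : 2 < p) :
    ENNReal.ofReal (p * (p - 1) * l ^ (p - 2)) * ∫⁻ r in Ioo (0 : ℝ) 1,
      ENNReal.ofReal (r * (1 - r ^ 2) ^ (p / 2 - 2)) *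
        {l : ℝ | l ^ 2 * (1 - r ^ 2) < S}.indicator 1 l ≤
    ENNReal.ofReal (p * (p - 1) / (p - 2) * S ^ (p / 2 - 1)) := by
  set a : ℝ := √(1 - S / l ^ 2) with ha
  have ha0 : 0 ≤ a := Real.sqrt_nonneg _
  have hSl : 0 ≤ S / l ^ 2 := by positivity
  have ha1 : a ≤ 1 := by
    exact Real.sqrt_le_iff.2 ⟨zero_le_one, by linarith⟩
  have ha2 : 1 - a ^ 2 ≤ S / l ^ 2 := by
    rcases le_total 0 (1 - S / l ^ 2) with h | h
    · rw [ha, Real.sq_sqrt h]; linarith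
    · nlinarith [sq_nonneg a]
  have hpq : p / 2 - 2 = (p / 2 - 1) - 1 := by ring
  have hγ : 0 < p / 2 - 1 := by linarith
  have h1 : ∫⁻ r in Ioo (0 : ℝ) 1, ENNReal.ofReal (r * (1 - r ^ 2) ^ (p / 2 - 2)) *
        {l : ℝ | l ^ 2 * (1 - r ^ 2) < S}.indicator 1 l ≤
      ENNReal.ofReal ((1 - a ^ 2) ^ (p / 2 - 1) / (2 * (p / 2 - 1))) := by
    rw [← lintegral_radial_weight ha0 ha1 hγ, ← hpq, ← lintegral_indicator measurableSet_Ioo,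
      ← lintegral_indicator measurableSet_Ioo]
    refine lintegral_mono fun r => ?_
    by_cases hr : r ∈ Ioo (0 : ℝ) 1
    · rw [indicator_of_mem hr]
      by_cases hlr : l ^ 2 * (1 - r ^ 2) < S
      · rw [indicator_of_mem (s := {l : ℝ | l ^ 2 * (1 - r ^ 2) < S}) hlr,
          indicator_of_mem, Pi.one_apply, mul_one]
        refine ⟨?_, hr.2⟩
        rw [ha, Real.sqrt_lt' hr.1]
        have : 1 - r ^ 2 < S / l ^ 2 := by
          rw [lt_div_iff₀ (by positivity)]; linarith
        linarith
      · rw [indicator_of_notMem (s := {l : ℝ | l ^ 2 * (1 - r ^ 2) < S}) hlr, mul_zero]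
        exact zero_le
    · rw [indicator_of_notMem hr]
      exact zero_le
  have hc : 0 < p * (p - 1) := by nlinarith
  refine (mul_le_mul_right h1 _).trans ?_
  rw [← ENNReal.ofReal_mul (by positivity)]
  refine ENNReal.ofReal_le_ofReal ?_
  have ha3 : 0 ≤ 1 - a ^ 2 := by nlinarith
  calc p * (p - 1) * l ^ (p - 2) * ((1 - a ^ 2) ^ (p / 2 - 1) / (2 * (p / 2 - 1)))
      ≤ p * (p - 1) * l ^ (p - 2) * ((S / l ^ 2) ^ (p / 2 - 1) / (2 * (p / 2 - 1))) := by
        gcongr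
    _ = p * (p - 1) / (p - 2) * S ^ (p / 2 - 1) := by
        have : (l ^ 2) ^ (p / 2 - 1) = l ^ (p - 2) := by
          rw [← Real.rpow_natCast, ← Real.rpow_mul hl.le]; congr 1; push_cast; ring
        rw [Real.div_rpow hS (by positivity), this]
        have h3 : l ^ (p - 2) ≠ 0 := (Real.rpow_pos_of_pos hl _).ne'
        have h4 : p - 2 ≠ 0 := by linarith
        rw [show 2 * (p / 2 - 1) = p - 2 by ring]
        field_simp

theorem lintegral_iSup_circle_le {F : ℂ → ℂ} {a : ℕ → ℂ} (hFm : Measurable F)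
    (hFd : DifferentiableOn ℂ F (Metric.ball 0 1)) (ha : Summable fun n => ‖a n‖ ^ 2)
    (hF : ∀ z ∈ Metric.ball (0 : ℂ) 1, HasSum (fun n => a n * z ^ n) (F z))
    {R : ℕ → ℝ} (hR : StrictMono R) (hR0 : ∀ n, 0 < R n) (hR1 : ∀ n, R n < 1) :
    ∫⁻ l in Ioi (0 : ℝ), ⨆ n, ∫⁻ θ in Ioo (-Real.pi) Real.pi,
      ENNReal.ofReal (‖F (circleMap 0 (R n) θ)‖ - l) ≤
    ENNReal.ofReal (Real.pi * ∑' n, ‖a n‖ ^ 2) := by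
  have hmeas : ∀ n, Measurable fun q : ℝ × ℝ =>
      ENNReal.ofReal (‖F (circleMap 0 (R n) q.2)‖ - q.1) := fun n =>
    (((hFm.comp (continuous_circleMap 0 (R n)).measurable).comp measurable_snd).norm.sub
      measurable_fst).ennreal_ofReal
  rw [← lintegral_indicator measurableSet_Ioi]
  have hind : ∀ l, (Ioi (0 : ℝ)).indicator (fun l => ⨆ n, ∫⁻ θ in Ioo (-Real.pi) Real.pi,
      ENNReal.ofReal (‖F (circleMap 0 (R n) θ)‖ - l)) l =
      ⨆ n, (Ioi (0 : ℝ)).indicator (fun l => ∫⁻ θ in Ioo (-Real.pi) Real.pi,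
      ENNReal.ofReal (‖F (circleMap 0 (R n) θ)‖ - l)) l := by
    intro l
    by_cases hl : l ∈ Ioi (0 : ℝ)
    · simp only [indicator_of_mem hl]
    · simp only [indicator_of_notMem hl, ENNReal.iSup_zero]
  simp_rw [hind]
  rw [lintegral_iSup]
  · refine iSup_le fun n => ?_
    rw [lintegral_indicator measurableSet_Ioi,
      lintegral_lintegral_swap (hmeas n).aemeasurable]
    have h2 : ∀ x : ℝ, 0 ≤ x → ∫⁻ l in Ioi (0 : ℝ), ENNReal.ofReal (x - l) =
        ENNReal.ofReal (x ^ 2 / 2) := by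
      intro x hx
      have h3 := lintegral_rpow_mul_sub (p := 2) hx le_rfl
      norm_num at h3
      exact h3
    simp_rw [h2 _ (norm_nonneg _)]
    rw [lintegral_circle_eq_circleAverage (fun z => ‖F z‖ ^ 2 / 2) (R n)
      ((continuous_comp_circleMap hFd (by rw [abs_of_pos (hR0 n)]; exact hR1 n)).norm.pow 2
        |>.div_const 2) (fun θ => by positivity)]
    refine ENNReal.ofReal_le_ofReal ?_
    have h4 := circleAverage_norm_sq_eq_tsum ha hF (hR0 n).le (hR1 n)
    have h5 : Real.circleAverage (fun z => ‖F z‖ ^ 2 / 2) 0 (R n) =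
        Real.circleAverage (fun z => ‖F z‖ ^ 2) 0 (R n) / 2 := by
      simp only [Real.circleAverage_def, intervalIntegral.integral_div, smul_eq_mul]
      ring
    rw [h5, h4]
    have h6 : ∀ m, ‖a m‖ ^ 2 * (R n ^ 2) ^ m ≤ ‖a m‖ ^ 2 := fun m =>
      mul_le_of_le_one_right (by positivity)
        (pow_le_one₀ (by positivity) (by nlinarith [hR0 n, hR1 n]))
    have h7 : ∑' m, ‖a m‖ ^ 2 * (R n ^ 2) ^ m ≤ ∑' m, ‖a m‖ ^ 2 :=
      (ha.of_nonneg_of_le (fun m => by positivity) h6).tsum_le_tsum h6 ha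
    nlinarith [Real.pi_pos]
  · intro n
    exact (hmeas n).lintegral_prod_right'.indicator measurableSet_Ioi
  · intro m n hmn l
    by_cases hl : l ∈ Ioi (0 : ℝ)
    · simp only [indicator_of_mem hl]
      rcases hmn.eq_or_lt with rfl | hmn
      · exact le_rfl
      · exact lintegral_circle_sub_mono hFd (hR0 m) (hR hmn) (hR1 n) (le_of_lt hl)
    · simp only [indicator_of_notMem hl, le_refl]

theorem lintegral_bergman_le {F : ℂ → ℂ} {a : ℕ → ℂ} (hFm : Measurable F)
    (hFd : DifferentiableOn ℂ F (Metric.ball 0 1)) (ha : Summable fun n => ‖a n‖ ^ 2)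
    (hF : ∀ z ∈ Metric.ball (0 : ℂ) 1, HasSum (fun n => a n * z ^ n) (F z))
    {p : ℝ} (hp : 2 < p) :
    ∫⁻ z in Metric.ball (0 : ℂ) 1, ENNReal.ofReal ((1 - ‖z‖ ^ 2) ^ (p / 2 - 2) * ‖F z‖ ^ p) ≤
      ENNReal.ofReal (p * (p - 1) / (p - 2) * (∑' n, ‖a n‖ ^ 2) ^ (p / 2 - 1)) *
        ENNReal.ofReal (Real.pi * ∑' n, ‖a n‖ ^ 2) := by
  set S := ∑' n, ‖a n‖ ^ 2 with hSdef
  have hS : 0 ≤ S := tsum_nonneg fun n => by positivity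
  obtain ⟨R, hR, hR01, hRlim⟩ := exists_seq_strictMono_tendsto' (zero_lt_one (α := ℝ))
  set J : ℝ → ℝ → ℝ≥0∞ := fun r l =>
    ∫⁻ θ in Ioo (-Real.pi) Real.pi, ENNReal.ofReal (‖F (circleMap 0 r θ)‖ - l) with hJ
  have hJM : ∀ r ∈ Ioo (0 : ℝ) 1, ∀ l ∈ Ioi (0 : ℝ), J r l ≤ ⨆ n, J (R n) l := by
    intro r hr l hl
    obtain ⟨n, hn⟩ := (hRlim.eventually (lt_mem_nhds hr.2)).exists
    exact (lintegral_circle_sub_mono hFd hr.1 hn (hR01 n).2 (le_of_lt hl)).trans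
      (le_iSup (fun n => J (R n) l) n)
  have hc : Measurable fun q : ℝ × ℝ => circleMap 0 q.1 q.2 :=
    Real.circleMap.continuous.measurable
  have hJm : Measurable (Function.uncurry J) := by
    refine Measurable.lintegral_prod_right' (f := fun q : (ℝ × ℝ) × ℝ =>
      ENNReal.ofReal (‖F (circleMap 0 q.1.1 q.2)‖ - q.1.2)) ?_
    exact ((hFm.comp (hc.comp (by fun_prop :
      Measurable fun q : (ℝ × ℝ) × ℝ => (q.1.1, q.2)))).norm.sub (by fun_prop)).ennreal_ofReal
  set w : ℝ → ℝ≥0∞ := fun l => ENNReal.ofReal (p * (p - 1) * l ^ (p - 2)) with hw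
  have hwm : Measurable w := by fun_prop
  set v : ℝ → ℝ≥0∞ := fun r => ENNReal.ofReal (r * (1 - r ^ 2) ^ (p / 2 - 2)) with hv
  have hvm : Measurable v := by fun_prop
  set χ : ℝ → ℝ → ℝ≥0∞ := fun r l => {l : ℝ | l ^ 2 * (1 - r ^ 2) < S}.indicator 1 l with hχdef
  have hχ : Measurable (Function.uncurry χ) := by
    have : MeasurableSet {q : ℝ × ℝ | q.2 ^ 2 * (1 - q.1 ^ 2) < S} :=
      measurableSet_lt (by fun_prop) measurable_const
    exact (measurable_const (a := (1 : ℝ≥0∞))).indicator this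
  have hMm : Measurable fun l => ⨆ n, J (R n) l :=
    Measurable.iSup fun n => hJm.of_uncurry_left
  rw [lintegral_unitBall_polar _ (by fun_prop)]
  calc _ ≤ ∫⁻ r in Ioo (0 : ℝ) 1, ∫⁻ l in Ioi (0 : ℝ), w l * (v r * χ r l) * J r l := by
        refine setLIntegral_mono' measurableSet_Ioo fun r hr => ?_
        have hs : 0 < 1 - r ^ 2 := by nlinarith [hr.1, hr.2]
        have hn : ∀ θ, ‖circleMap 0 r θ‖ = r := fun θ => by simp [abs_of_pos hr.1]
        have hball : ∀ θ, circleMap 0 r θ ∈ Metric.ball (0 : ℂ) 1 := fun θ => by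
          rw [mem_ball_zero_iff, hn]; exact hr.2
        calc _ ≤ ∫⁻ θ in Ioo (-Real.pi) Real.pi, ∫⁻ l in Ioi (0 : ℝ), w l * (v r * χ r l) *
              ENNReal.ofReal (‖F (circleMap 0 r θ)‖ - l) := by
              refine lintegral_mono fun θ => ?_
              have h1 := norm_sq_mul_le_tsum ha hF (hball θ)
              rw [hn] at h1
              have h2 := rpow_le_lintegral_superlevel (norm_nonneg _) hp.le hs h1
              rw [hn, ENNReal.ofReal_mul (Real.rpow_nonneg hs.le _), ← mul_assoc,
                ← ENNReal.ofReal_mul hr.1.le]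
              refine (mul_le_mul_right h2 _).trans (le_of_eq ?_)
              rw [← lintegral_const_mul' _ _ ENNReal.ofReal_ne_top]
              refine lintegral_congr fun l => ?_
              simp only [hw, hv, hχdef]
              ring
          _ = ∫⁻ l in Ioi (0 : ℝ), w l * (v r * χ r l) * J r l := by
              rw [lintegral_lintegral_swap]
              · refine lintegral_congr fun l => ?_
                rw [lintegral_const_mul]
                exact ((hFm.comp (continuous_circleMap 0 r).measurable).norm.sub
                  measurable_const).ennreal_ofReal
              · refine Measurable.aemeasurable ?_
                refine ((hwm.comp measurable_snd).mul (measurable_const.mul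
                  ((hχ.of_uncurry_left (x := r)).comp measurable_snd))).mul ?_
                exact ((hFm.comp ((continuous_circleMap 0 r).measurable.comp
                  measurable_fst)).norm.sub measurable_snd).ennreal_ofReal
    _ ≤ ∫⁻ r in Ioo (0 : ℝ) 1, ∫⁻ l in Ioi (0 : ℝ),
          w l * (v r * χ r l) * ⨆ n, J (R n) l := by
        refine setLIntegral_mono' measurableSet_Ioo fun r hr => ?_
        refine setLIntegral_mono' measurableSet_Ioi fun l hl => ?_
        exact mul_le_mul_right (hJM r hr l hl) _
    _ = ∫⁻ l in Ioi (0 : ℝ), (w l * ∫⁻ r in Ioo (0 : ℝ) 1, v r * χ r l) * ⨆ n, J (R n) l := by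
        rw [lintegral_lintegral_swap]
        · refine lintegral_congr fun l => ?_
          have hm : Measurable fun r => v r * χ r l :=
            hvm.mul hχ.of_uncurry_right
          rw [lintegral_mul_const _ (hm.const_mul _), lintegral_const_mul _ hm]
        · refine Measurable.aemeasurable ?_
          exact ((hwm.comp measurable_snd).mul ((hvm.comp measurable_fst).mul hχ)).mul
            (hMm.comp measurable_snd)
    _ ≤ ∫⁻ l in Ioi (0 : ℝ), ENNReal.ofReal (p * (p - 1) / (p - 2) * S ^ (p / 2 - 1)) *
          ⨆ n, J (R n) l := by
        refine setLIntegral_mono' measurableSet_Ioi fun l hl => ?_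
        exact mul_le_mul_left (rpow_mul_lintegral_radial_le hl hS hp) _
    _ ≤ _ := by
        rw [lintegral_const_mul' _ _ ENNReal.ofReal_ne_top]
        exact mul_le_mul_right (lintegral_iSup_circle_le hFm hFd ha hF hR
          (fun n => (hR01 n).1) fun n => (hR01 n).2) _

theorem rpow_circleAverage_norm_sq_le {F : ℂ → ℂ} {r p : ℝ}
    (hc : Continuous fun θ => F (circleMap 0 r θ)) (hp : 2 ≤ p) :
    (Real.circleAverage (fun z => ‖F z‖ ^ 2) 0 r) ^ (p / 2) ≤
      Real.circleAverage (fun z => ‖F z‖ ^ p) 0 r := by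
  have hpi := Real.pi_pos
  rw [Real.circleAverage_eq_intervalAverage, Real.circleAverage_eq_intervalAverage]
  have hrw : ∀ x : ℝ, 0 ≤ x → (x ^ 2) ^ (p / 2) = x ^ p := by
    intro x hx
    rw [← Real.rpow_natCast, ← Real.rpow_mul hx]; congr 1; push_cast; ring
  have hu : uIoc 0 (2 * Real.pi) = Ioc 0 (2 * Real.pi) := uIoc_of_le (by positivity)
  have key := (convexOn_rpow (p := p / 2) (by linarith)).map_set_average_le
    (μ := volume) (t := uIoc 0 (2 * Real.pi)) (f := fun θ => ‖F (circleMap 0 r θ)‖ ^ 2)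
    (continuousOn_id.rpow_const fun _ _ => Or.inr (by linarith)) isClosed_Ici
    (by rw [hu]; simp [hpi]) (by rw [hu]; exact measure_Ioc_lt_top.ne) (ae_of_all _ fun θ => by
      simp only [mem_Ici]; positivity)
    (by rw [hu]; exact (hc.norm.pow 2).integrableOn_Icc.mono_set Ioc_subset_Icc_self)
    (by
      rw [hu]
      exact ((hc.norm.pow 2).rpow_const fun _ => Or.inr (by linarith)).integrableOn_Icc.mono_set
        Ioc_subset_Icc_self)
  simp only [hrw _ (norm_nonneg _)] at key
  exact key

theorem le_lintegral_bergman {F : ℂ → ℂ} {a : ℕ → ℂ} (hFm : Measurable F)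
    (hFd : DifferentiableOn ℂ F (Metric.ball 0 1)) (ha : Summable fun n => ‖a n‖ ^ 2)
    (hF : ∀ z ∈ Metric.ball (0 : ℂ) 1, HasSum (fun n => a n * z ^ n) (F z))
    {p r : ℝ} (hp : 2 < p) (hr0 : 0 ≤ r) (hr1 : r < 1) :
    ENNReal.ofReal (2 * Real.pi * (∑' n, ‖a n‖ ^ 2 * (r ^ 2) ^ n) ^ (p / 2)) *
        ENNReal.ofReal ((1 - r ^ 2) ^ (p / 2 - 1) / (2 * (p / 2 - 1))) ≤
      ∫⁻ z in Metric.ball (0 : ℂ) 1,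
        ENNReal.ofReal ((1 - ‖z‖ ^ 2) ^ (p / 2 - 2) * ‖F z‖ ^ p) := by
  have hpi := Real.pi_pos
  rw [lintegral_unitBall_polar _ (by fun_prop), ← lintegral_radial_weight hr0 hr1.le (by linarith),
    ← lintegral_const_mul' _ _ ENNReal.ofReal_ne_top]
  refine le_trans ?_ (lintegral_mono_set (Ioo_subset_Ioo_left hr0))
  refine setLIntegral_mono' measurableSet_Ioo fun s hs => ?_
  have hs0 : 0 < s := hr0.trans_lt hs.1
  have hw : 0 < 1 - s ^ 2 := by nlinarith [hs.2]
  have hn : ∀ θ, ‖circleMap 0 s θ‖ = s := fun θ => by simp [abs_of_pos hs0]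
  have hc : Continuous fun θ => F (circleMap 0 s θ) :=
    continuous_comp_circleMap hFd (by rw [abs_of_pos hs0]; exact hs.2)
  have e : ∀ θ, ENNReal.ofReal s * ENNReal.ofReal ((1 - ‖circleMap 0 s θ‖ ^ 2) ^ (p / 2 - 2) *
      ‖F (circleMap 0 s θ)‖ ^ p) = ENNReal.ofReal (s * (1 - s ^ 2) ^ (p / 2 - 1 - 1)) *
      ENNReal.ofReal (‖F (circleMap 0 s θ)‖ ^ p) := by
    intro θ
    rw [hn, ← ENNReal.ofReal_mul hs0.le, ← ENNReal.ofReal_mul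
      (mul_nonneg hs0.le (Real.rpow_nonneg hw.le _)), show p / 2 - 1 - 1 = p / 2 - 2 by ring,
      mul_assoc]
  simp_rw [e]
  rw [lintegral_const_mul' _ _ ENNReal.ofReal_ne_top, mul_comm]
  refine mul_le_mul_right ?_ _
  rw [lintegral_circle_eq_circleAverage (fun z => ‖F z‖ ^ p) s
    (hc.norm.rpow_const fun _ => Or.inr (by linarith)) (fun θ => by positivity)]
  refine ENNReal.ofReal_le_ofReal (mul_le_mul_of_nonneg_left ?_ (by positivity))
  refine le_trans ?_ (rpow_circleAverage_norm_sq_le hc hp.le)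
  rw [circleAverage_norm_sq_eq_tsum ha hF hs0.le hs.2]
  have hsum : ∀ t : ℝ, 0 ≤ t → t < 1 → Summable fun n => ‖a n‖ ^ 2 * (t ^ 2) ^ n :=
    fun t h0 h1 => ha.of_nonneg_of_le (fun n => by positivity) fun n =>
      mul_le_of_le_one_right (by positivity) (pow_le_one₀ (by positivity) (by nlinarith))
  refine Real.rpow_le_rpow (tsum_nonneg fun n => by positivity) ?_ (by linarith)
  refine (hsum r hr0 hr1).tsum_le_tsum (fun n => ?_) (hsum s hs0.le hs.2)
  have := hs.1
  gcongr

theorem tendsto_tsum_norm_sq_mul_pow {a : ℕ → ℂ} (ha : Summable fun n => ‖a n‖ ^ 2) :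
    Tendsto (fun r : ℝ => ∑' n, ‖a n‖ ^ 2 * (r ^ 2) ^ n) (𝓝[<] 1) (𝓝 (∑' n, ‖a n‖ ^ 2)) := by
  refine tendsto_tsum_of_dominated_convergence ha (fun n => ?_) ?_
  · have : Continuous fun r : ℝ => ‖a n‖ ^ 2 * (r ^ 2) ^ n := by fun_prop
    simpa using (this.tendsto 1).mono_left nhdsWithin_le_nhds
  · filter_upwards [Ioo_mem_nhdsLT (zero_lt_one (α := ℝ))] with r hr n
    rw [Real.norm_of_nonneg (by have := hr.1; positivity)]
    exact mul_le_of_le_one_right (by positivity)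
      (pow_le_one₀ (by positivity) (by nlinarith [hr.1, hr.2]))

theorem ApNorm_congr {f g : ℂ → ℂ} (h : EqOn f g unitDisk) (p β : ℝ) :
    ApNorm p β f = ApNorm p β g := by
  unfold ApNorm ApIntPow
  congr 3
  refine setLIntegral_congr_fun Metric.isOpen_ball.measurableSet fun z hz => ?_
  rw [h hz]

theorem ApNorm_le {F : ℂ → ℂ} {a : ℕ → ℂ} (hFm : Measurable F)
    (hFd : DifferentiableOn ℂ F (Metric.ball 0 1)) (ha : Summable fun n => ‖a n‖ ^ 2)
    (hF : ∀ z ∈ Metric.ball (0 : ℂ) 1, HasSum (fun n => a n * z ^ n) (F z))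
    {p : ℝ} (hp : 2 < p) :
    ApNorm p (p / 2 - 2) F ≤
      ENNReal.ofReal ((p * (p - 1) / 2 * (∑' n, ‖a n‖ ^ 2) ^ (p / 2)) ^ (1 / p)) := by
  have hpi := Real.pi_pos
  have hS : 0 ≤ ∑' n, ‖a n‖ ^ 2 := tsum_nonneg fun n => by positivity
  have h2 : 0 < p - 2 := by linarith
  have h1 : 0 < p - 1 := by linarith
  have h0 : 0 < p := by linarith
  rw [ApNorm, ApIntPow, ← ENNReal.ofReal_rpow_of_nonneg (by positivity) (by positivity)]
  refine ENNReal.rpow_le_rpow ?_ (by positivity)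
  refine (ENNReal.div_le_div_right (mul_le_mul_right
    (lintegral_bergman_le hFm hFd ha hF hp) _) _).trans (le_of_eq ?_)
  rw [← ENNReal.ofReal_mul (by positivity), ← ENNReal.ofReal_mul (by linarith),
    ← ENNReal.ofReal_div_of_pos hpi]
  congr 1
  have : (∑' n, ‖a n‖ ^ 2) ^ (p / 2) = (∑' n, ‖a n‖ ^ 2) ^ (p / 2 - 1) * ∑' n, ‖a n‖ ^ 2 := by
    rw [← Real.rpow_add_one' hS (by linarith)]; ring_nf
  rw [this]
  field_simp
  ring

theorem le_ApNorm {F : ℂ → ℂ} {a : ℕ → ℂ} (hFm : Measurable F)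
    (hFd : DifferentiableOn ℂ F (Metric.ball 0 1)) (ha : Summable fun n => ‖a n‖ ^ 2)
    (hF : ∀ z ∈ Metric.ball (0 : ℂ) 1, HasSum (fun n => a n * z ^ n) (F z))
    {p r : ℝ} (hp : 2 < p) (hr0 : 0 ≤ r) (hr1 : r < 1) :
    ENNReal.ofReal (((∑' n, ‖a n‖ ^ 2 * (r ^ 2) ^ n) ^ (p / 2) *
      (1 - r ^ 2) ^ (p / 2 - 1)) ^ (1 / p)) ≤ ApNorm p (p / 2 - 2) F := by
  have hpi := Real.pi_pos
  have hT : 0 ≤ ∑' n, ‖a n‖ ^ 2 * (r ^ 2) ^ n := tsum_nonneg fun n => by positivity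
  have h2 : 0 < p - 2 := by linarith
  have h0 : 0 < p := by linarith
  have hw : 0 ≤ 1 - r ^ 2 := by nlinarith
  rw [ApNorm, ApIntPow, ← ENNReal.ofReal_rpow_of_nonneg (by positivity) (by positivity)]
  refine ENNReal.rpow_le_rpow ?_ (by positivity)
  refine (le_of_eq ?_).trans (ENNReal.div_le_div_right (mul_le_mul_right
    (le_lintegral_bergman hFm hFd ha hF hp hr0 hr1) _) _)
  rw [← ENNReal.ofReal_mul (by positivity), ← ENNReal.ofReal_mul (by linarith),
    ← ENNReal.ofReal_div_of_pos hpi]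
  congr 1
  rw [show p / 2 - 2 + 1 = p / 2 - 1 by ring]
  have h3 : p / 2 - 1 ≠ 0 := by linarith
  field_simp

theorem tendsto_ApNorm {F : ℂ → ℂ} {a : ℕ → ℂ} (hFm : Measurable F)
    (hFd : DifferentiableOn ℂ F (Metric.ball 0 1)) (ha : Summable fun n => ‖a n‖ ^ 2)
    (hF : ∀ z ∈ Metric.ball (0 : ℂ) 1, HasSum (fun n => a n * z ^ n) (F z)) :
    Tendsto (fun p : ℝ => ApNorm p (p / 2 - 2) F) (𝓝[>] 2)
      (𝓝 (ENNReal.ofReal ((∑' n, ‖a n‖ ^ 2) ^ (1 / 2 : ℝ)))) := by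
  have hexp : ContinuousAt (fun p : ℝ => 1 / p) 2 :=
    continuousAt_const.div continuousAt_id two_ne_zero
  have hpow : ∀ x : ℝ, ContinuousAt (fun p : ℝ => x ^ (p / 2)) 2 := fun x =>
    continuousAt_const.rpow (by fun_prop) (Or.inr (by norm_num))
  refine tendsto_order.2 ⟨fun c hc => ?_, fun c hc => ?_⟩
  · have hlim : Tendsto (fun r : ℝ => ENNReal.ofReal
        ((∑' n, ‖a n‖ ^ 2 * (r ^ 2) ^ n) ^ (1 / 2 : ℝ))) (𝓝[<] 1)
        (𝓝 (ENNReal.ofReal ((∑' n, ‖a n‖ ^ 2) ^ (1 / 2 : ℝ)))) :=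
      ENNReal.tendsto_ofReal ((tendsto_tsum_norm_sq_mul_pow ha).rpow_const (Or.inr (by norm_num)))
    obtain ⟨r, hrc, hr⟩ := ((hlim.eventually (lt_mem_nhds hc)).and
      (Ioo_mem_nhdsLT (zero_lt_one (α := ℝ)))).exists
    have hw : 1 - r ^ 2 ≠ 0 := by nlinarith [hr.1, hr.2]
    have hcont : ContinuousAt (fun p : ℝ => ENNReal.ofReal
        (((∑' n, ‖a n‖ ^ 2 * (r ^ 2) ^ n) ^ (p / 2) * (1 - r ^ 2) ^ (p / 2 - 1)) ^ (1 / p))) 2 :=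
      ENNReal.continuous_ofReal.continuousAt.comp
        (((hpow _).mul (continuousAt_const.rpow (by fun_prop) (Or.inl hw))).rpow hexp
          (Or.inr (by norm_num)))
    have hev := hcont.eventually (lt_mem_nhds (a := c) (by simpa using hrc))
    filter_upwards [hev.filter_mono nhdsWithin_le_nhds, self_mem_nhdsWithin] with p hp1 hp2
    exact hp1.trans_le (le_ApNorm hFm hFd ha hF hp2 hr.1.le hr.2)
  · have hcont : ContinuousAt (fun p : ℝ => ENNReal.ofReal
        ((p * (p - 1) / 2 * (∑' n, ‖a n‖ ^ 2) ^ (p / 2)) ^ (1 / p))) 2 :=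
      ENNReal.continuous_ofReal.continuousAt.comp
        ((ContinuousAt.mul (by fun_prop) (hpow _)).rpow hexp (Or.inr (by norm_num)))
    have hev := Tendsto.eventually_lt_const (u := c) (by norm_num at hc ⊢; exact hc) hcont
    filter_upwards [hev.filter_mono nhdsWithin_le_nhds, self_mem_nhdsWithin] with p hp1 hp2
    exact (ApNorm_le hFm hFd ha hF hp2).trans_lt hp1

/-- if f is holomorphic on 𝔻 with square-summable Taylor coefficients,
then ‖f‖_{A^p_{p/2-2}} → ‖f‖_{H²} as p → 2⁺. -/
theorem statement10 (f : ℂ → ℂ) (hf : DifferentiableOn ℂ f unitDisk)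
    (hsum : Summable fun n : ℕ => ‖taylorCoeff f n‖ ^ 2) :
    Filter.Tendsto (fun p : ℝ => ApNorm p (p / 2 - 2) f) (nhdsWithin 2 (Set.Ioi 2))
      (nhds (ENNReal.ofReal ((∑' n : ℕ, ‖taylorCoeff f n‖ ^ 2) ^ (1 / 2 : ℝ)))) := by
  classical
  have hEq : EqOn f (unitDisk.indicator f) unitDisk := fun z hz => (indicator_of_mem hz f).symm
  simp_rw [fun p : ℝ => ApNorm_congr hEq p (p / 2 - 2)]
  refine tendsto_ApNorm ?_ (hf.congr hEq.symm) hsum fun z hz => ?_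
  · have h := ContinuousOn.measurable_piecewise (g := (0 : ℂ → ℂ)) hf.continuousOn
      continuous_zero.continuousOn (Metric.isOpen_ball (x := (0 : ℂ)) (ε := 1)).measurableSet
    rwa [piecewise_eq_indicator] at h
  · rw [← hEq hz]
    convert! Complex.hasSum_taylorSeries_on_ball (c := 0) (r := 1) hf hz using 2 with n
    simp only [taylorCoeff, smul_eq_mul, sub_zero]
    ring

end
end

section
/- (Hardy–Stein identity) Let p > 0 and let f be holomorphic on 𝔻. Then for every r ∈ (0,1), the derivative with respect to r of M_p^p(r, f) equals (p²/(2r)) ∫_{r𝔻} |f'(z)|² |f(z)|^{p−2} dA(z), where r𝔻 is the disk of radius r centered at the origin. -/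
open MeasureTheory Set Filter
open scoped ENNReal NNReal Topology

noncomputable section

section HardyStein

open scoped ComplexConjugate

theorem hasDerivAt_normSq_add_rpow {c : ℝ → ℂ} {c' : ℂ} {x ε : ℝ} (s : ℝ) (hε : 0 < ε)
    (hc : HasDerivAt c c' x) :
    HasDerivAt (fun y => (Complex.normSq (c y) + ε) ^ s)
      (2 * s * ((Complex.normSq (c x) + ε) ^ (s - 1) * (conj (c x) * c').re)) x := by
  have h1 : HasDerivAt (fun y => (c y).re) c'.re x :=
    (Complex.reCLM.hasFDerivAt.comp_hasDerivAt x hc)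
  have h2 : HasDerivAt (fun y => (c y).im) c'.im x :=
    (Complex.imCLM.hasFDerivAt.comp_hasDerivAt x hc)
  have h3 : HasDerivAt (fun y => Complex.normSq (c y) + ε)
      (2 * (conj (c x) * c').re) x := by
    simp only [Complex.normSq_apply]
    refine (((h1.mul h1).add (h2.mul h2)).add_const ε).congr_deriv ?_
    simp only [Complex.mul_re, Complex.conj_re, Complex.conj_im]
    ring
  have h0 : Complex.normSq (c x) + ε ≠ 0 :=
    (add_pos_of_nonneg_of_pos (Complex.normSq_nonneg _) hε).ne'
  convert h3.rpow_const (p := s) (Or.inl h0) using 1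
  ring

theorem hasDerivAt_normSq_add_rpow_mul_re {c k : ℝ → ℂ} {c' k' : ℂ} {x ε : ℝ} (s : ℝ) (hε : 0 < ε)
    (hc : HasDerivAt c c' x) (hk : HasDerivAt k k' x) :
    HasDerivAt (fun y => (Complex.normSq (c y) + ε) ^ s * (conj (c y) * k y).re)
      (2 * s * ((Complex.normSq (c x) + ε) ^ (s - 1) * (conj (c x) * c').re) *
          (conj (c x) * k x).re +
        (Complex.normSq (c x) + ε) ^ s * (conj c' * k x + conj (c x) * k').re) x := by
  have hcc : HasDerivAt (fun y => conj (c y)) (conj c') x :=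
    (Complex.conjCLE.hasFDerivAt.comp_hasDerivAt x hc)
  exact (hasDerivAt_normSq_add_rpow s hε hc).mul
    (Complex.reCLM.hasFDerivAt.comp_hasDerivAt x (hcc.mul hk))

theorem hasDerivAt_intervalIntegral_of_continuousOn {g g' : ℝ → ℝ → ℝ} {a b l u : ℝ}
    (hg : ContinuousOn (Function.uncurry g) (Ioo l u ×ˢ univ))
    (hg' : ContinuousOn (Function.uncurry g') (Ioo l u ×ˢ univ))
    (hd : ∀ x ∈ Ioo l u, ∀ t, HasDerivAt (fun y => g y t) (g' x t) x) {x : ℝ}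
    (hx : x ∈ Ioo l u) :
    HasDerivAt (fun y => ∫ t in a..b, g y t) (∫ t in a..b, g' x t) x := by
  obtain ⟨δ, hδ, hδ'⟩ := Metric.isOpen_iff.1 isOpen_Ioo x hx
  have hsub : Icc (x - δ / 2) (x + δ / 2) ⊆ Ioo l u := by
    intro y hy
    apply hδ'
    rw [Metric.mem_ball, Real.dist_eq, abs_lt]
    constructor <;> linarith [hy.1, hy.2]
  have hslice : ∀ {φ : ℝ → ℝ → ℝ}, ContinuousOn (Function.uncurry φ) (Ioo l u ×ˢ univ) →
      ∀ y ∈ Ioo l u, Continuous (φ y) := by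
    intro φ hφ y hy
    rw [← continuousOn_univ]
    exact hφ.comp (f := fun t => (y, t)) (by fun_prop) (fun t _ => ⟨hy, mem_univ _⟩)
  obtain ⟨C, hC⟩ := (isCompact_Icc (a := x - δ / 2) (b := x + δ / 2)).prod
    (isCompact_uIcc (a := a) (b := b)) |>.exists_bound_of_continuousOn
      (hg'.mono (prod_mono hsub (subset_univ _)))
  have hnhds : Icc (x - δ / 2) (x + δ / 2) ∈ 𝓝 x := Icc_mem_nhds (by linarith) (by linarith)
  refine (intervalIntegral.hasDerivAt_integral_of_dominated_loc_of_deriv_le (bound := fun _ => C)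
    hnhds ?_ ((hslice hg x hx).intervalIntegrable _ _)
    (hslice hg' x hx).aestronglyMeasurable ?_ intervalIntegrable_const ?_).2
  · filter_upwards [hnhds] with y hy
    exact (hslice hg y (hsub hy)).aestronglyMeasurable
  · refine Eventually.of_forall fun t ht y hy => ?_
    exact hC (y, t) ⟨hy, uIoc_subset_uIcc ht⟩
  · exact Eventually.of_forall fun t _ y hy => hd y (hsub hy) t


theorem norm_ofReal_mul_exp_I_mul (ρ t : ℝ) : ‖(ρ : ℂ) * Complex.exp (Complex.I * t)‖ = |ρ| := by
  rw [norm_mul, mul_comm Complex.I, Complex.norm_exp_ofReal_mul_I, mul_one, Complex.norm_real,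
    Real.norm_eq_abs]

theorem ContinuousOn.comp_ofReal_mul_exp {E : Type*} [TopologicalSpace E] {φ : ℂ → E} {R : ℝ}
    (hφ : ContinuousOn φ (Metric.ball 0 R)) :
    ContinuousOn (fun x : ℝ × ℝ => φ (x.1 * Complex.exp (Complex.I * x.2)))
      (Ioo (-R) R ×ˢ univ) := by
  refine hφ.comp (by fun_prop) fun x hx => ?_
  rw [mem_ball_zero_iff, norm_ofReal_mul_exp_I_mul]
  exact abs_lt.2 hx.1

theorem setIntegral_ball_eq_polar {φ : ℂ → ℝ} {R r : ℝ}
    (hφ : ContinuousOn φ (Metric.ball 0 R)) (hr : 0 < r) (hrR : r < R) :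
    ∫ z in Metric.ball (0 : ℂ) r, φ z =
      ∫ ρ in (0 : ℝ)..r, ∫ t in (0 : ℝ)..(2 * Real.pi),
        ρ * φ (ρ * Complex.exp (Complex.I * t)) := by
  have hcont : ContinuousOn (fun x : ℝ × ℝ => x.1 * φ (x.1 * Complex.exp (Complex.I * x.2)))
      (Icc 0 r ×ˢ Icc (-Real.pi) Real.pi) :=
    (continuous_fst.continuousOn.mul hφ.comp_ofReal_mul_exp).mono
      (prod_mono (fun x hx => ⟨by linarith [hx.1], by linarith [hx.2]⟩) (subset_univ _))
  have hint := hcont.integrableOn_compact (μ := volume) (isCompact_Icc.prod isCompact_Icc)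
  have hint' := hint.mono_set (s := Ioo 0 r ×ˢ Ioo (-Real.pi) Real.pi)
    (prod_mono Ioo_subset_Icc_self Ioo_subset_Icc_self)
  rw [← integral_indicator Metric.isOpen_ball.measurableSet,
    ← Complex.integral_comp_polarCoord_symm, polarCoord_target]
  have h1 : ∀ x ∈ Ioi (0 : ℝ) ×ˢ Ioo (-Real.pi) Real.pi,
      x.1 • (Metric.ball (0 : ℂ) r).indicator φ (Complex.polarCoord.symm x) =
      (Ioo 0 r ×ˢ Ioo (-Real.pi) Real.pi).indicator
        (fun x : ℝ × ℝ => x.1 * φ (x.1 * Complex.exp (Complex.I * x.2))) x := by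
    rintro ⟨ρ, t⟩ ⟨hρ, ht⟩
    have hρ0 : 0 < ρ := hρ
    have he : Complex.polarCoord.symm (ρ, t) = ρ * Complex.exp (Complex.I * t) := by
      rw [Complex.polarCoord_symm_apply, mul_comm Complex.I, Complex.exp_mul_I]
      simp
    rw [he, smul_eq_mul]
    by_cases h : ρ < r
    · rw [indicator_of_mem, indicator_of_mem]
      · exact ⟨⟨hρ, h⟩, ht⟩
      · rwa [mem_ball_zero_iff, norm_ofReal_mul_exp_I_mul, abs_of_pos hρ0]
    · rw [indicator_of_notMem, indicator_of_notMem, mul_zero]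
      · exact fun h' => h h'.1.2
      · rwa [mem_ball_zero_iff, norm_ofReal_mul_exp_I_mul, abs_of_pos hρ0]
  rw [setIntegral_congr_fun (measurableSet_Ioi.prod measurableSet_Ioo) h1,
    setIntegral_indicator (measurableSet_Ioo.prod measurableSet_Ioo),
    inter_eq_self_of_subset_right (prod_mono Ioo_subset_Ioi_self subset_rfl),
    Measure.volume_eq_prod, setIntegral_prod _ (by simpa [Measure.volume_eq_prod] using hint'),
    intervalIntegral.integral_of_le hr.le, ← integral_Ioc_eq_integral_Ioo]
  congr 1
  ext ρ
  rw [← integral_Ioc_eq_integral_Ioo,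
    ← intervalIntegral.integral_of_le (by linarith [Real.pi_pos])]
  have hper : Function.Periodic (fun t : ℝ => ρ * φ (ρ * Complex.exp (Complex.I * t)))
      (2 * Real.pi) := by
    intro t
    have : Complex.I * ((t + 2 * Real.pi : ℝ) : ℂ) = Complex.I * t + 2 * Real.pi * Complex.I := by
      push_cast
      ring
    simp only [this, Complex.exp_periodic (Complex.I * t)]
  have := hper.intervalIntegral_add_eq (-Real.pi) 0
  rw [zero_add, show -Real.pi + 2 * Real.pi = Real.pi by ring] at this
  exact this

/-- The derivative identity behind Green's formula in polar coordinates: the radial derivative of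
the radial flux density plus the angular derivative of the angular flux density is a Laplacian. -/
theorem radial_add_angular_eq (a d d' e : ℂ) (ρ ε q P : ℝ) (he : ‖e‖ = 1) :
    (2 * (q - 1) * (P * (conj a * (d * e)).re) * (conj a * (ρ * e * d)).re +
        P * (Complex.normSq a + ε) *
          (conj (d * e) * (ρ * e * d) + conj a * (e * d + ρ * e * (d' * e))).re) +
      (2 * (q - 1) * (P * (conj a * (d * (ρ * (e * Complex.I)))).re) *
          (conj a * (Complex.I * e * d)).re +
        P * (Complex.normSq a + ε) *
          (conj (d * (ρ * (e * Complex.I))) * (Complex.I * e * d) +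
            conj a * (Complex.I * (e * Complex.I) * d +
              Complex.I * e * (d' * (ρ * (e * Complex.I))))).re) =
      ρ * (2 * ‖d‖ ^ 2 * P * (q * Complex.normSq a + ε)) := by
  have h1 : e.re * e.re + e.im * e.im = 1 := by
    rw [← Complex.normSq_apply, Complex.normSq_eq_norm_sq, he, one_pow]
  rw [← Complex.normSq_eq_norm_sq]
  simp only [Complex.normSq_apply, Complex.mul_re, Complex.mul_im, Complex.conj_re,
    Complex.conj_im, Complex.add_re, Complex.add_im, Complex.I_re, Complex.I_im,
    Complex.ofReal_re, Complex.ofReal_im]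
  have h2 : e.im ^ 2 = 1 - e.re ^ 2 := by linarith
  ring_nf
  simp only [h2]
  ring

/-- The Laplacian of `(|f|² + ε)^q / (2 * q)`, for `f` holomorphic. -/
def regDensity (f : ℂ → ℂ) (ε q : ℝ) (z : ℂ) : ℝ :=
  2 * ‖deriv f z‖ ^ 2 * (Complex.normSq (f z) + ε) ^ (q - 1 - 1) * (q * Complex.normSq (f z) + ε)

theorem normSq_add_pos {ε : ℝ} (hε : 0 < ε) (w : ℂ) : 0 < Complex.normSq w + ε :=
  add_pos_of_nonneg_of_pos (Complex.normSq_nonneg _) hε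

theorem ContinuousOn.normSq_add_rpow {X : Type*} [TopologicalSpace X] {φ : X → ℂ} {s : Set X}
    {ε : ℝ} (q : ℝ) (hε : 0 < ε) (hφ : ContinuousOn φ s) :
    ContinuousOn (fun x => (Complex.normSq (φ x) + ε) ^ q) s :=
  ((Complex.continuous_normSq.comp_continuousOn hφ).add continuousOn_const).rpow_const
    fun x _ => Or.inl (normSq_add_pos hε (φ x)).ne'

theorem ContinuousOn.re_conj_mul {X : Type*} [TopologicalSpace X] {φ ψ : X → ℂ} {s : Set X}
    (hφ : ContinuousOn φ s) (hψ : ContinuousOn ψ s) :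
    ContinuousOn (fun x => (conj (φ x) * ψ x).re) s :=
  Complex.continuous_re.comp_continuousOn ((Complex.continuous_conj.comp_continuousOn hφ).mul hψ)

theorem continuousOn_regDensity {f : ℂ → ℂ} {R ε : ℝ} (q : ℝ) (hε : 0 < ε)
    (hf : DifferentiableOn ℂ f (Metric.ball 0 R)) :
    ContinuousOn (regDensity f ε q) (Metric.ball 0 R) := by
  have hD := (hf.deriv Metric.isOpen_ball).continuousOn
  exact ((continuousOn_const.mul (hD.norm.pow 2)).mul
    (hf.continuousOn.normSq_add_rpow _ hε)).mul
    ((continuousOn_const.mul (Complex.continuous_normSq.comp_continuousOn hf.continuousOn)).add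
      continuousOn_const)

theorem hasDerivAt_comp_ray {φ : ℂ → ℂ} {φ' : ℂ} {ρ t : ℝ}
    (h : HasDerivAt φ φ' (ρ * Complex.exp (Complex.I * t))) :
    HasDerivAt (fun y : ℝ => φ (y * Complex.exp (Complex.I * t)))
      (φ' * Complex.exp (Complex.I * t)) ρ := by
  have h1 : HasDerivAt (fun y : ℝ => (y : ℂ) * Complex.exp (Complex.I * t))
      (Complex.exp (Complex.I * t)) ρ := by
    simpa using (Complex.ofRealCLM.hasDerivAt (x := ρ)).mul_const (Complex.exp (Complex.I * t))
  exact h.comp ρ h1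

theorem hasDerivAt_exp_I_mul (t : ℝ) :
    HasDerivAt (fun y : ℝ => Complex.exp (Complex.I * y))
      (Complex.exp (Complex.I * t) * Complex.I) t := by
  have h : HasDerivAt (fun y : ℝ => Complex.I * (y : ℂ)) Complex.I t := by
    simpa using (Complex.ofRealCLM.hasDerivAt (x := t)).const_mul Complex.I
  exact h.cexp

theorem hasDerivAt_comp_circle {φ : ℂ → ℂ} {φ' : ℂ} {ρ t : ℝ}
    (h : HasDerivAt φ φ' (ρ * Complex.exp (Complex.I * t))) :
    HasDerivAt (fun y : ℝ => φ (ρ * Complex.exp (Complex.I * y)))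
      (φ' * (ρ * (Complex.exp (Complex.I * t) * Complex.I))) t :=
  h.comp t ((hasDerivAt_exp_I_mul t).const_mul (ρ : ℂ))

theorem ofReal_mul_exp_mem_ball {R ρ : ℝ} (hρ : ρ ∈ Ioo (-R) R) (t : ℝ) :
    (ρ : ℂ) * Complex.exp (Complex.I * t) ∈ Metric.ball (0 : ℂ) R := by
  rw [mem_ball_zero_iff, norm_ofReal_mul_exp_I_mul]
  exact abs_lt.2 hρ

theorem continuous_slice {φ : ℝ × ℝ → ℝ} {R ρ : ℝ} (hφ : ContinuousOn φ (Ioo (-R) R ×ˢ univ))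
    (hρ : ρ ∈ Ioo (-R) R) : Continuous fun t => φ (ρ, t) := by
  rw [← continuousOn_univ]
  exact hφ.comp (by fun_prop) fun t _ => ⟨hρ, mem_univ _⟩

/-- Green's formula on a disk for the radial flux of `(|f|² + ε)^q`. -/
theorem integral_flux_eq {f : ℂ → ℂ} {R r ε : ℝ} (q : ℝ) (hε : 0 < ε)
    (hf : DifferentiableOn ℂ f (Metric.ball 0 R)) (hr : 0 < r) (hrR : r < R) :
    ∫ t in (0 : ℝ)..(2 * Real.pi),
        (Complex.normSq (f (r * Complex.exp (Complex.I * t))) + ε) ^ (q - 1) *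
          (conj (f (r * Complex.exp (Complex.I * t))) *
            (r * Complex.exp (Complex.I * t) * deriv f (r * Complex.exp (Complex.I * t)))).re =
      ∫ z in Metric.ball (0 : ℂ) r, regDensity f ε q z := by
  have hf' := hf.deriv Metric.isOpen_ball
  have hf'' := hf'.deriv Metric.isOpen_ball
  have hd : ∀ z ∈ Metric.ball (0 : ℂ) R, HasDerivAt f (deriv f z) z := fun z hz =>
    (hf.differentiableAt (Metric.isOpen_ball.mem_nhds hz)).hasDerivAt
  have hd' : ∀ z ∈ Metric.ball (0 : ℂ) R, HasDerivAt (deriv f) (deriv (deriv f) z) z := fun z hz =>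
    (hf'.differentiableAt (Metric.isOpen_ball.mem_nhds hz)).hasDerivAt
  have cf := hf.continuousOn.comp_ofReal_mul_exp
  have cf' := hf'.continuousOn.comp_ofReal_mul_exp
  have cf'' := hf''.continuousOn.comp_ofReal_mul_exp
  have ce : ContinuousOn (fun x : ℝ × ℝ => Complex.exp (Complex.I * x.2)) (Ioo (-R) R ×ˢ univ) := by
    fun_prop
  have cz : ContinuousOn (fun x : ℝ × ℝ => (x.1 : ℂ) * Complex.exp (Complex.I * x.2))
    (Ioo (-R) R ×ˢ univ) := by fun_prop
  set g : ℝ → ℝ → ℝ := fun ρ t =>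
    (Complex.normSq (f (ρ * Complex.exp (Complex.I * t))) + ε) ^ (q - 1) *
      (conj (f (ρ * Complex.exp (Complex.I * t))) *
        (ρ * Complex.exp (Complex.I * t) * deriv f (ρ * Complex.exp (Complex.I * t)))).re with hg
  set g' : ℝ → ℝ → ℝ := fun ρ t =>
    2 * (q - 1) * ((Complex.normSq (f (ρ * Complex.exp (Complex.I * t))) + ε) ^ (q - 1 - 1) *
        (conj (f (ρ * Complex.exp (Complex.I * t))) *
          (deriv f (ρ * Complex.exp (Complex.I * t)) * Complex.exp (Complex.I * t))).re) *
        (conj (f (ρ * Complex.exp (Complex.I * t))) *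
        (ρ * Complex.exp (Complex.I * t) * deriv f (ρ * Complex.exp (Complex.I * t)))).re +
      (Complex.normSq (f (ρ * Complex.exp (Complex.I * t))) + ε) ^ (q - 1) *
        (conj (deriv f (ρ * Complex.exp (Complex.I * t)) * Complex.exp (Complex.I * t)) *
          (ρ * Complex.exp (Complex.I * t) * deriv f (ρ * Complex.exp (Complex.I * t))) +
        conj (f (ρ * Complex.exp (Complex.I * t))) *
          (Complex.exp (Complex.I * t) * deriv f (ρ * Complex.exp (Complex.I * t)) +
            ρ * Complex.exp (Complex.I * t) *
              (deriv (deriv f) (ρ * Complex.exp (Complex.I * t)) *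
                Complex.exp (Complex.I * t)))).re with hg'
  have hgc : ContinuousOn (Function.uncurry g) (Ioo (-R) R ×ˢ univ) :=
    (cf.normSq_add_rpow _ hε).mul (cf.re_conj_mul (cz.mul cf'))
  have hg'c : ContinuousOn (Function.uncurry g') (Ioo (-R) R ×ˢ univ) :=
    ((continuousOn_const.mul ((cf.normSq_add_rpow _ hε).mul (cf.re_conj_mul (cf'.mul ce)))).mul
      (cf.re_conj_mul (cz.mul cf'))).add ((cf.normSq_add_rpow _ hε).mul
      (Complex.continuous_re.comp_continuousOn
        (((Complex.continuous_conj.comp_continuousOn (cf'.mul ce)).mul (cz.mul cf')).add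
          ((Complex.continuous_conj.comp_continuousOn cf).mul
            ((ce.mul cf').add (cz.mul (cf''.mul ce)))))))
  have hgd : ∀ ρ ∈ Ioo (-R) R, ∀ t, HasDerivAt (fun y => g y t) (g' ρ t) ρ := by
    intro ρ hρ t
    have hz := ofReal_mul_exp_mem_ball hρ t
    have h1 : HasDerivAt (fun y : ℝ => (y : ℂ) * Complex.exp (Complex.I * t))
        (Complex.exp (Complex.I * t)) ρ := by
      simpa using hasDerivAt_comp_ray (hasDerivAt_id ((ρ : ℂ) * Complex.exp (Complex.I * t)))
    exact hasDerivAt_normSq_add_rpow_mul_re (q - 1) hε (hasDerivAt_comp_ray (hd _ hz))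
      (h1.mul (hasDerivAt_comp_ray (hd' _ hz)))
  have hzero : ∫ t in (0 : ℝ)..(2 * Real.pi), g 0 t = 0 := by simp [hg]
  have key : ∀ ρ ∈ Ioo (-R) R, ∫ t in (0 : ℝ)..(2 * Real.pi), g' ρ t =
      ∫ t in (0 : ℝ)..(2 * Real.pi),
        ρ * regDensity f ε q (ρ * Complex.exp (Complex.I * t)) := by
    intro ρ hρ
    set T : ℝ → ℝ := fun t =>
      (Complex.normSq (f (ρ * Complex.exp (Complex.I * t))) + ε) ^ (q - 1) *
        (conj (f (ρ * Complex.exp (Complex.I * t))) *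
          (Complex.I * Complex.exp (Complex.I * t) *
            deriv f (ρ * Complex.exp (Complex.I * t)))).re with hT
    have cg : Continuous (g' ρ) := continuous_slice hg'c hρ
    have cK : Continuous fun t : ℝ => ρ * regDensity f ε q (ρ * Complex.exp (Complex.I * t)) :=
      continuous_const.mul
        (continuous_slice (continuousOn_regDensity q hε hf).comp_ofReal_mul_exp hρ)
    have hTd : ∀ t : ℝ, HasDerivAt T
        (ρ * regDensity f ε q (ρ * Complex.exp (Complex.I * t)) - g' ρ t) t := by
      intro t
      have hz := ofReal_mul_exp_mem_ball hρ t
      have h := hasDerivAt_normSq_add_rpow_mul_re (q - 1) hε (hasDerivAt_comp_circle (hd _ hz))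
        (((hasDerivAt_exp_I_mul t).const_mul Complex.I).mul (hasDerivAt_comp_circle (hd' _ hz)))
      refine h.congr_deriv ?_
      have hpow : ∀ w : ℂ, (Complex.normSq w + ε) ^ (q - 1) =
          (Complex.normSq w + ε) ^ (q - 1 - 1) * (Complex.normSq w + ε) := by
        intro w
        have := normSq_add_pos hε w
        rw [Real.rpow_sub_one this.ne' (q - 1), div_mul_cancel₀ _ this.ne']
      have he : ‖Complex.exp (Complex.I * t)‖ = 1 := by
        rw [mul_comm, Complex.norm_exp_ofReal_mul_I]
      have := radial_add_angular_eq (f (ρ * Complex.exp (Complex.I * t)))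
        (deriv f (ρ * Complex.exp (Complex.I * t)))
        (deriv (deriv f) (ρ * Complex.exp (Complex.I * t))) (Complex.exp (Complex.I * t)) ρ ε q
        ((Complex.normSq (f (ρ * Complex.exp (Complex.I * t))) + ε) ^ (q - 1 - 1)) he
      rw [eq_sub_iff_add_eq', regDensity, ← this, hg']
      simp only [hpow]
      rfl
    have hI := intervalIntegral.integral_eq_sub_of_hasDerivAt (a := 0) (b := 2 * Real.pi)
      (fun t _ => hTd t) ((cK.sub cg).intervalIntegrable _ _)
    have hper : T (2 * Real.pi) = T 0 := by
      have : Complex.exp (Complex.I * ((2 * Real.pi : ℝ) : ℂ)) = 1 := by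
        rw [mul_comm]
        push_cast
        exact Complex.exp_two_pi_mul_I
      simp only [hT, this]
      simp
    rw [hper, sub_self, intervalIntegral.integral_sub (cK.intervalIntegrable _ _)
      (cg.intervalIntegrable _ _)] at hI
    linarith
  have hsub : Icc 0 r ⊆ Ioo (-R) R := fun ρ hρ => ⟨by linarith [hρ.1], by linarith [hρ.2]⟩
  have hIcc : ∀ ρ ∈ uIcc 0 r, ρ ∈ Ioo (-R) R := by
    rw [uIcc_of_le hr.le]
    exact hsub
  have hFTC := intervalIntegral.integral_eq_sub_of_hasDerivAt (a := 0) (b := r)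
    (fun ρ hρ => hasDerivAt_intervalIntegral_of_continuousOn (a := 0) (b := 2 * Real.pi)
      hgc hg'c hgd (hIcc ρ hρ)) ?_
  · rw [hzero, sub_zero] at hFTC
    rw [← hFTC, setIntegral_ball_eq_polar (continuousOn_regDensity q hε hf) hr hrR]
    exact intervalIntegral.integral_congr fun ρ hρ => key ρ (hIcc ρ hρ)
  · have hint := (hg'c.mono (t := Icc 0 r ×ˢ Icc 0 (2 * Real.pi))
      (Set.prod_mono hsub (subset_univ _))).integrableOn_compact
      (μ := volume) (isCompact_Icc.prod isCompact_Icc)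
    rw [IntegrableOn, Measure.volume_eq_prod, ← Measure.prod_restrict] at hint
    rw [intervalIntegrable_iff_integrableOn_Icc_of_le hr.le]
    refine hint.integral_prod_left.congr (Eventually.of_forall fun ρ => ?_)
    simp only [intervalIntegral.integral_of_le Real.two_pi_pos.le, integral_Icc_eq_integral_Ioc,
      Function.uncurry_apply_pair]

theorem hasDerivAt_integral_normSq_add_rpow {f : ℂ → ℂ} {R r ε : ℝ} (q : ℝ) (hε : 0 < ε)
    (hf : DifferentiableOn ℂ f (Metric.ball 0 R)) (hr : 0 < r) (hrR : r < R) :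
    HasDerivAt (fun ρ : ℝ => ∫ t in (0 : ℝ)..(2 * Real.pi),
        (Complex.normSq (f (ρ * Complex.exp (Complex.I * t))) + ε) ^ q)
      (2 * q * (r⁻¹ * ∫ z in Metric.ball (0 : ℂ) r, regDensity f ε q z)) r := by
  have hd : ∀ z ∈ Metric.ball (0 : ℂ) R, HasDerivAt f (deriv f z) z := fun z hz =>
    (hf.differentiableAt (Metric.isOpen_ball.mem_nhds hz)).hasDerivAt
  have cf := hf.continuousOn.comp_ofReal_mul_exp
  have cf' := (hf.deriv Metric.isOpen_ball).continuousOn.comp_ofReal_mul_exp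
  have ce : ContinuousOn (fun x : ℝ × ℝ => Complex.exp (Complex.I * x.2)) (Ioo (-R) R ×ˢ univ) := by
    fun_prop
  have h := hasDerivAt_intervalIntegral_of_continuousOn (a := 0) (b := 2 * Real.pi)
    (g := fun ρ t => (Complex.normSq (f (ρ * Complex.exp (Complex.I * t))) + ε) ^ q)
    (g' := fun ρ t => 2 * q *
      ((Complex.normSq (f (ρ * Complex.exp (Complex.I * t))) + ε) ^ (q - 1) *
        (conj (f (ρ * Complex.exp (Complex.I * t))) *
          (deriv f (ρ * Complex.exp (Complex.I * t)) * Complex.exp (Complex.I * t))).re))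
    (cf.normSq_add_rpow q hε)
    (continuousOn_const.mul ((cf.normSq_add_rpow _ hε).mul (cf.re_conj_mul (cf'.mul ce))))
    (fun ρ hρ t => hasDerivAt_normSq_add_rpow q hε
      (hasDerivAt_comp_ray (hd _ (ofReal_mul_exp_mem_ball hρ t))))
    (x := r) ⟨by linarith, hrR⟩
  refine h.congr_deriv ?_
  rw [← integral_flux_eq q hε hf hr hrR, intervalIntegral.integral_const_mul,
    ← intervalIntegral.integral_const_mul r⁻¹]
  congr 1
  refine intervalIntegral.integral_congr fun t _ => ?_
  have hr' : (r : ℂ) ≠ 0 := by exact_mod_cast hr.ne'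
  have : ∀ a d e : ℂ, (conj a * (r * e * d)).re = r * (conj a * (d * e)).re := by
    intro a d e
    rw [← Complex.re_ofReal_mul]
    congr 1
    ring
  simp only [this]
  field_simp

theorem regDensity_nonneg {f : ℂ → ℂ} {ε q : ℝ} (hε : 0 < ε) (hq : 0 < q) (z : ℂ) :
    0 ≤ regDensity f ε q z := by
  have := normSq_add_pos hε (f z)
  have := Complex.normSq_nonneg (f z)
  unfold regDensity
  positivity

theorem normSq_rpow (w : ℂ) (s : ℝ) : Complex.normSq w ^ s = ‖w‖ ^ (2 * s) := by
  rw [Complex.normSq_eq_norm_sq, Real.rpow_mul (norm_nonneg _), Real.rpow_two]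

theorem ae_ne_zero_or_deriv_eq_zero {f : ℂ → ℂ} {R : ℝ}
    (hf : DifferentiableOn ℂ f (Metric.ball 0 R)) :
    ∀ᵐ z ∂volume.restrict (Metric.ball (0 : ℂ) R), f z ≠ 0 ∨ deriv f z = 0 := by
  have ha : AnalyticOnNhd ℂ f (Metric.ball 0 R) := hf.analyticOnNhd Metric.isOpen_ball
  by_cases h : ∃ z ∈ Metric.ball (0 : ℂ) R, f z ≠ 0
  · obtain ⟨z, hz, hfz⟩ := h
    have hconn : IsConnected (Metric.ball (0 : ℂ) R) :=
      ⟨⟨z, hz⟩, (convex_ball _ _).isPreconnected⟩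
    filter_upwards [ae_restrict_le_codiscreteWithin measurableSet_ball
      (ha.preimage_zero_mem_codiscreteWithin hfz hz hconn)] with w hw using Or.inl hw
  · push Not at h
    filter_upwards [ae_restrict_mem measurableSet_ball] with w hw
    have : f =ᶠ[𝓝 w] fun _ => 0 := by
      filter_upwards [Metric.isOpen_ball.mem_nhds hw] with y hy using h y hy
    right
    rw [this.deriv_eq, deriv_const]

theorem tendsto_regDensity {f : ℂ → ℂ} (q : ℝ) {z : ℂ} (hz : f z ≠ 0 ∨ deriv f z = 0) :
    Tendsto (fun ε => regDensity f ε q z) (𝓝[>] 0)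
      (𝓝 (2 * q * (‖deriv f z‖ ^ 2 * ‖f z‖ ^ (2 * (q - 1))))) := by
  rcases hz with hz | hz
  · have hN : 0 < Complex.normSq (f z) := Complex.normSq_pos.2 hz
    have hc : ContinuousAt (fun ε => regDensity f ε q z) 0 := by
      unfold regDensity
      refine (ContinuousAt.mul continuousAt_const
        (ContinuousAt.rpow_const (by fun_prop) (Or.inl ?_))).mul (by fun_prop)
      rw [add_zero]
      exact hN.ne'
    have h0 : regDensity f 0 q z = 2 * q * (‖deriv f z‖ ^ 2 * ‖f z‖ ^ (2 * (q - 1))) := by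
      rw [regDensity, add_zero, add_zero, ← normSq_rpow, Real.rpow_sub_one hN.ne' (q - 1)]
      field_simp
    rw [← h0]
    exact hc.tendsto.mono_left nhdsWithin_le_nhds
  · simp [regDensity, hz]

theorem regDensity_le {f : ℂ → ℂ} {ε q : ℝ} (hε : 0 < ε) (hε1 : ε ≤ 1) {z : ℂ}
    (hz : f z ≠ 0 ∨ deriv f z = 0) :
    regDensity f ε q z ≤ 2 * max q 1 * (‖deriv f z‖ ^ 2 * ‖f z‖ ^ (2 * (q - 1)) +
      ‖deriv f z‖ ^ 2 * (Complex.normSq (f z) + 1) ^ (q - 1)) := by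
  rcases hz with hz | hz
  · have hN : 0 < Complex.normSq (f z) := Complex.normSq_pos.2 hz
    have hNε := normSq_add_pos hε (f z)
    rw [regDensity, ← normSq_rpow, Real.rpow_sub_one hNε.ne' (q - 1)]
    have h1 : q * Complex.normSq (f z) + ε ≤ max q 1 * (Complex.normSq (f z) + ε) := by
      nlinarith [le_max_left q 1, le_max_right q 1]
    have h2 : (Complex.normSq (f z) + ε) ^ (q - 1) ≤
        Complex.normSq (f z) ^ (q - 1) + (Complex.normSq (f z) + 1) ^ (q - 1) := by
      rcases le_total 0 (q - 1) with h | h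
      · have := Real.rpow_le_rpow hNε.le (show Complex.normSq (f z) + ε ≤
          Complex.normSq (f z) + 1 by linarith) h
        have := Real.rpow_nonneg hN.le (q - 1)
        linarith
      · have := Real.rpow_le_rpow_of_nonpos hN (show Complex.normSq (f z) ≤
          Complex.normSq (f z) + ε by linarith) h
        have := Real.rpow_nonneg (normSq_add_pos one_pos (f z)).le (q - 1)
        linarith
    have h0 : 0 ≤ max q 1 := zero_le_one.trans (le_max_right _ _)
    calc _ ≤ 2 * ‖deriv f z‖ ^ 2 * ((Complex.normSq (f z) + ε) ^ (q - 1) /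
          (Complex.normSq (f z) + ε)) * (max q 1 * (Complex.normSq (f z) + ε)) := by gcongr
      _ = 2 * max q 1 * (‖deriv f z‖ ^ 2 * (Complex.normSq (f z) + ε) ^ (q - 1)) := by
          field_simp
      _ ≤ 2 * max q 1 * (‖deriv f z‖ ^ 2 * (Complex.normSq (f z) ^ (q - 1) +
          (Complex.normSq (f z) + 1) ^ (q - 1))) := by gcongr
      _ = _ := by ring
  · simp [regDensity, hz]

theorem ContinuousOn.integrableOn_ball {φ : ℂ → ℝ} {R r : ℝ}
    (hφ : ContinuousOn φ (Metric.ball 0 R)) (hrR : r < R) :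
    IntegrableOn φ (Metric.ball 0 r) :=
  ((hφ.mono (Metric.closedBall_subset_ball hrR)).integrableOn_compact
    (isCompact_closedBall _ _)).mono_set Metric.ball_subset_closedBall

theorem monotoneOn_setIntegral_ball {φ : ℂ → ℝ} {R : ℝ} (h0 : ∀ z, 0 ≤ φ z)
    (hφ : ∀ r < R, IntegrableOn φ (Metric.ball 0 r)) :
    MonotoneOn (fun ρ => ∫ z in Metric.ball (0 : ℂ) ρ, φ z) (Iio R) := fun _ _ y hy hxy =>
  setIntegral_mono_set (hφ y hy) (Eventually.of_forall h0)
    (Metric.ball_subset_ball hxy).eventuallyLE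

theorem exists_bound_integral_regDensity {f : ℂ → ℂ} {R r q : ℝ} (hq : 0 < q)
    (hf : DifferentiableOn ℂ f (Metric.ball 0 R)) (hr : 0 < r) (hrR : r < R) :
    ∃ C, ∀ ε, 0 < ε → ε ≤ 1 → ∀ ρ ≤ r, ∫ z in Metric.ball (0 : ℂ) ρ, regDensity f ε q z ≤ C := by
  obtain ⟨r', hr', hr'R⟩ := exists_between hrR
  set Φ : ℝ → ℝ → ℝ := fun ε ρ => ∫ t in (0 : ℝ)..(2 * Real.pi),
    (Complex.normSq (f (ρ * Complex.exp (Complex.I * t))) + ε) ^ q with hΦ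
  refine ⟨r' / (2 * q) * (Φ 1 r' / (r' - r)), fun ε hε hε1 ρ hρ => ?_⟩
  have hmono := monotoneOn_setIntegral_ball (regDensity_nonneg (f := f) hε hq)
    fun r hr => (continuousOn_regDensity q hε hf).integrableOn_ball hr
  have hd : ∀ x ∈ Icc r r', HasDerivAt (Φ ε)
      (2 * q * (x⁻¹ * ∫ z in Metric.ball (0 : ℂ) x, regDensity f ε q z)) x := fun x hx =>
    hasDerivAt_integral_normSq_add_rpow q hε hf (hr.trans_le hx.1) (hx.2.trans_lt hr'R)
  obtain ⟨c, hc, hcs⟩ := exists_hasDerivAt_eq_slope (Φ ε) _ hr'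
    (fun x hx => (hd x hx).continuousAt.continuousWithinAt)
    (fun x hx => hd x (Ioo_subset_Icc_self hx))
  have hc0 : 0 < c := hr.trans hc.1
  have h1 : ∫ z in Metric.ball (0 : ℂ) ρ, regDensity f ε q z ≤
      ∫ z in Metric.ball (0 : ℂ) c, regDensity f ε q z :=
    hmono (show ρ < R by linarith) (show c < R by linarith [hc.2]) (hρ.trans hc.1.le)
  have hcont : ∀ δ, 0 < δ → Continuous fun t : ℝ =>
      (Complex.normSq (f (r' * Complex.exp (Complex.I * t))) + δ) ^ q := fun δ hδ =>
    continuous_slice (hf.continuousOn.comp_ofReal_mul_exp.normSq_add_rpow q hδ)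
      ⟨by linarith, hr'R⟩
  have h2 : Φ ε r' ≤ Φ 1 r' :=
    intervalIntegral.integral_mono Real.two_pi_pos.le ((hcont ε hε).intervalIntegrable _ _)
      ((hcont 1 one_pos).intervalIntegrable _ _) fun t =>
        Real.rpow_le_rpow (normSq_add_pos hε _).le (by linarith) hq.le
  have h3 : 0 ≤ Φ ε r := intervalIntegral.integral_nonneg Real.two_pi_pos.le fun t _ =>
    Real.rpow_nonneg (normSq_add_pos hε _).le _
  have h4 : 0 ≤ Φ 1 r' := intervalIntegral.integral_nonneg Real.two_pi_pos.le fun t _ =>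
    Real.rpow_nonneg (normSq_add_pos one_pos _).le _
  have hrr : 0 < r' - r := sub_pos.2 hr'
  calc _ ≤ ∫ z in Metric.ball (0 : ℂ) c, regDensity f ε q z := h1
    _ = c / (2 * q) * ((Φ ε r' - Φ ε r) / (r' - r)) := by
        rw [← hcs]
        field_simp
    _ ≤ c / (2 * q) * (Φ 1 r' / (r' - r)) := by
        gcongr
        linarith
    _ ≤ r' / (2 * q) * (Φ 1 r' / (r' - r)) := by
        gcongr
        exact hc.2.le

theorem integrableOn_norm_deriv_sq_mul_norm_rpow {f : ℂ → ℂ} {R r q : ℝ} (hq : 0 < q)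
    (hf : DifferentiableOn ℂ f (Metric.ball 0 R)) (hr : 0 < r) (hrR : r < R) :
    IntegrableOn (fun z => ‖deriv f z‖ ^ 2 * ‖f z‖ ^ (2 * (q - 1))) (Metric.ball 0 r) := by
  obtain ⟨C, hC⟩ := exists_bound_integral_regDensity hq hf hr hrR
  set δ : ℕ → ℝ := fun n => 1 / (n + 1 : ℝ)
  have hδ : ∀ n, 0 < δ n := fun n => Nat.one_div_pos_of_nat
  have hδ1 : ∀ n, δ n ≤ 1 := fun n => by
    simpa [δ] using Nat.one_div_le_one_div (α := ℝ) (Nat.zero_le n)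
  have hδt : Tendsto δ atTop (𝓝[>] 0) := tendsto_nhdsWithin_iff.2
    ⟨tendsto_one_div_add_atTop_nhds_zero_nat, Eventually.of_forall hδ⟩
  have hae : ∀ᵐ z ∂volume.restrict (Metric.ball (0 : ℂ) r),
      Tendsto (fun n => regDensity f (δ n) q z) atTop
        (𝓝 (2 * q * (‖deriv f z‖ ^ 2 * ‖f z‖ ^ (2 * (q - 1))))) := by
    filter_upwards [ae_ne_zero_or_deriv_eq_zero
      (hf.mono (Metric.ball_subset_ball hrR.le))] with z hz
    exact (tendsto_regDensity q hz).comp hδt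
  have hint : ∀ n, IntegrableOn (regDensity f (δ n) q) (Metric.ball 0 r) := fun n =>
    (continuousOn_regDensity q (hδ n) hf).integrableOn_ball hrR
  have hmeas := aestronglyMeasurable_of_tendsto_ae atTop
    (fun n => (hint n).aestronglyMeasurable) hae
  have h2 : IntegrableOn (fun z => 2 * q * (‖deriv f z‖ ^ 2 * ‖f z‖ ^ (2 * (q - 1))))
      (Metric.ball 0 r) := by
    refine ⟨hmeas, ?_⟩
    have hfin : ∫⁻ z in Metric.ball (0 : ℂ) r,
        ‖2 * q * (‖deriv f z‖ ^ 2 * ‖f z‖ ^ (2 * (q - 1)))‖ₑ ≤ ENNReal.ofReal C := by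
      calc _ = ∫⁻ z in Metric.ball (0 : ℂ) r,
            liminf (fun n => ‖regDensity f (δ n) q z‖ₑ) atTop :=
            lintegral_congr_ae (hae.mono fun z hz => hz.enorm.liminf_eq.symm)
        _ ≤ liminf (fun n => ∫⁻ z in Metric.ball (0 : ℂ) r, ‖regDensity f (δ n) q z‖ₑ) atTop :=
            lintegral_liminf_le' fun n => (hint n).aestronglyMeasurable.enorm
        _ ≤ liminf (fun _ : ℕ => ENNReal.ofReal C) atTop := by
            refine liminf_le_liminf (Eventually.of_forall fun n => ?_)
            rw [← ofReal_integral_norm_eq_lintegral_enorm (hint n)]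
            refine ENNReal.ofReal_le_ofReal ?_
            simpa only [Real.norm_of_nonneg (regDensity_nonneg (hδ n) hq _)] using
              hC (δ n) (hδ n) (hδ1 n) r le_rfl
        _ = ENNReal.ofReal C := liminf_const _
    exact hfin.trans_lt ENNReal.ofReal_lt_top
  refine (h2.const_mul (2 * q)⁻¹).congr (Eventually.of_forall fun z => ?_)
  simp only
  rw [inv_mul_cancel_left₀ (by positivity)]

theorem tendsto_integral_regDensity {f : ℂ → ℂ} {R r q : ℝ} (hq : 0 < q)
    (hf : DifferentiableOn ℂ f (Metric.ball 0 R)) (hr : 0 < r) (hrR : r < R) :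
    Tendsto (fun ε => ∫ z in Metric.ball (0 : ℂ) r, regDensity f ε q z) (𝓝[>] 0)
      (𝓝 (2 * q * ∫ z in Metric.ball (0 : ℂ) r, ‖deriv f z‖ ^ 2 * ‖f z‖ ^ (2 * (q - 1)))) := by
  have hz := ae_ne_zero_or_deriv_eq_zero (hf.mono (Metric.ball_subset_ball hrR.le))
  have hc : ContinuousOn (fun z => ‖deriv f z‖ ^ 2 * (Complex.normSq (f z) + 1) ^ (q - 1))
      (Metric.ball 0 R) :=
    ((hf.deriv Metric.isOpen_ball).continuousOn.norm.pow 2).mul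
      (hf.continuousOn.normSq_add_rpow _ one_pos)
  rw [← integral_const_mul]
  refine tendsto_integral_filter_of_dominated_convergence _ ?_ ?_
    (((integrableOn_norm_deriv_sq_mul_norm_rpow hq hf hr hrR).add
      (hc.integrableOn_ball hrR)).const_mul (2 * max q 1))
    (hz.mono fun z hz => tendsto_regDensity q hz)
  · filter_upwards [self_mem_nhdsWithin] with ε hε
    exact ((continuousOn_regDensity q hε hf).integrableOn_ball hrR).aestronglyMeasurable
  · filter_upwards [Ioc_mem_nhdsGT one_pos] with ε hε
    filter_upwards [hz] with z hz
    rw [Real.norm_of_nonneg (regDensity_nonneg hε.1 hq z)]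
    exact regDensity_le hε.1 hε.2 hz

theorem continuousOn_setIntegral_ball {φ : ℂ → ℝ} {R : ℝ}
    (hφ : ∀ r, 0 < r → r < R → IntegrableOn φ (Metric.ball 0 r)) :
    ContinuousOn (fun ρ => ∫ z in Metric.ball (0 : ℂ) ρ, φ z) (Ioo 0 R) := by
  intro r hr
  obtain ⟨r', hr', hr'R⟩ := exists_between hr.2
  refine ContinuousAt.continuousWithinAt ?_
  have hi : ∀ ρ, ∫ z in Metric.ball (0 : ℂ) ρ, φ z = ∫ z, (Metric.ball 0 ρ).indicator φ z :=
    fun ρ => (integral_indicator measurableSet_ball).symm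
  simp only [ContinuousAt, hi]
  refine tendsto_integral_filter_of_dominated_convergence
    (fun z => (Metric.ball 0 r').indicator (fun z => ‖φ z‖) z) ?_ ?_ ?_ ?_
  · filter_upwards [Ioo_mem_nhds hr.1 hr.2] with ρ hρ
    exact ((hφ ρ hρ.1 hρ.2).integrable_indicator measurableSet_ball).aestronglyMeasurable
  · filter_upwards [Iio_mem_nhds hr'] with ρ hρ
    refine Eventually.of_forall fun z => ?_
    rw [norm_indicator_eq_indicator_norm]
    exact indicator_le_indicator_of_subset (Metric.ball_subset_ball (le_of_lt hρ))
      (fun _ => norm_nonneg _) z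
  · exact (integrable_indicator_iff measurableSet_ball).2 (hφ r' (hr.1.trans hr') hr'R).norm
  · have hs : ∀ᵐ z : ℂ, z ∉ Metric.sphere (0 : ℂ) r :=
      measure_eq_zero_iff_ae_notMem.1 (Measure.addHaar_sphere volume 0 r)
    filter_upwards [hs] with z hz
    rw [mem_sphere_zero_iff_norm] at hz
    refine tendsto_const_nhds.congr' ?_
    rcases lt_or_gt_of_ne hz with h | h
    · filter_upwards [Ioi_mem_nhds h] with ρ hρ
      rw [indicator_of_mem (by simpa using h), indicator_of_mem (by simpa using hρ)]
    · filter_upwards [Iio_mem_nhds h] with ρ hρ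
      rw [indicator_of_notMem (by simpa using h.le),
        indicator_of_notMem (by simpa using le_of_lt hρ)]

theorem integral_norm_rpow_sub_eq {f : ℂ → ℂ} {R a x q : ℝ} (hq : 0 < q)
    (hf : DifferentiableOn ℂ f (Metric.ball 0 R)) (ha : 0 < a) (hax : a ≤ x) (hxR : x < R) :
    (∫ t in (0 : ℝ)..(2 * Real.pi), ‖f (x * Complex.exp (Complex.I * t))‖ ^ (2 * q)) -
      (∫ t in (0 : ℝ)..(2 * Real.pi), ‖f (a * Complex.exp (Complex.I * t))‖ ^ (2 * q)) =
    ∫ ρ in a..x, 2 * q * (ρ⁻¹ * (2 * q *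
      ∫ z in Metric.ball (0 : ℂ) ρ, ‖deriv f z‖ ^ 2 * ‖f z‖ ^ (2 * (q - 1)))) := by
  obtain ⟨C, hC⟩ := exists_bound_integral_regDensity hq hf (ha.trans_le hax) hxR
  have hΦ : ∀ y ∈ Ioo 0 R, Tendsto (fun ε => ∫ t in (0 : ℝ)..(2 * Real.pi),
        (Complex.normSq (f (y * Complex.exp (Complex.I * t))) + ε) ^ q) (𝓝[>] 0)
      (𝓝 (∫ t in (0 : ℝ)..(2 * Real.pi), ‖f (y * Complex.exp (Complex.I * t))‖ ^ (2 * q))) := by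
    intro y hy
    have hc : ∀ δ, 0 < δ → Continuous fun t : ℝ =>
        (Complex.normSq (f (y * Complex.exp (Complex.I * t))) + δ) ^ q := fun δ hδ =>
      continuous_slice (hf.continuousOn.comp_ofReal_mul_exp.normSq_add_rpow q hδ)
        ⟨by linarith [hy.1, hy.2], hy.2⟩
    refine intervalIntegral.tendsto_integral_filter_of_dominated_convergence _ ?_ ?_
      ((hc 1 one_pos).intervalIntegrable _ _) ?_
    · filter_upwards [self_mem_nhdsWithin] with ε hε
      exact (hc ε hε).aestronglyMeasurable
    · filter_upwards [Ioc_mem_nhdsGT one_pos] with ε hε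
      refine Eventually.of_forall fun t _ => ?_
      have h := normSq_add_pos hε.1 (f (y * Complex.exp (Complex.I * t)))
      rw [Real.norm_of_nonneg (Real.rpow_nonneg h.le _)]
      exact Real.rpow_le_rpow h.le (by linarith [hε.2]) hq.le
    · refine Eventually.of_forall fun t _ => ?_
      have hca : ContinuousAt (fun ε : ℝ =>
          (Complex.normSq (f (y * Complex.exp (Complex.I * t))) + ε) ^ q) 0 :=
        (continuousAt_const.add continuousAt_id).rpow_const (Or.inr hq.le)
      have := hca.tendsto
      rw [add_zero, normSq_rpow] at this
      exact this.mono_left nhdsWithin_le_nhds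
  have hint : ∀ ε, 0 < ε → IntervalIntegrable (fun ρ =>
      2 * q * (ρ⁻¹ * ∫ z in Metric.ball (0 : ℂ) ρ, regDensity f ε q z)) volume a x := by
    intro ε hε
    refine ContinuousOn.intervalIntegrable ?_
    rw [uIcc_of_le hax]
    refine continuousOn_const.mul ((continuousOn_id.inv₀ fun y hy => (ha.trans_le hy.1).ne').mul
      ((continuousOn_setIntegral_ball (R := R) fun r _ hrR =>
        (continuousOn_regDensity q hε hf).integrableOn_ball hrR).mono
          fun y hy => ⟨ha.trans_le hy.1, hy.2.trans_lt hxR⟩))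
  refine tendsto_nhds_unique (f := fun ε => ∫ ρ in a..x,
    2 * q * (ρ⁻¹ * ∫ z in Metric.ball (0 : ℂ) ρ, regDensity f ε q z)) (l := 𝓝[>] 0) ?_ ?_
  · refine ((hΦ x ⟨ha.trans_le hax, hxR⟩).sub (hΦ a ⟨ha, hax.trans_lt hxR⟩)).congr' ?_
    filter_upwards [self_mem_nhdsWithin] with ε hε
    refine (intervalIntegral.integral_eq_sub_of_hasDerivAt (f := fun y : ℝ =>
      ∫ t in (0 : ℝ)..(2 * Real.pi), (Complex.normSq (f (y * Complex.exp (Complex.I * t))) + ε) ^ q)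
      (fun y hy => ?_) (hint ε hε)).symm
    rw [uIcc_of_le hax] at hy
    exact hasDerivAt_integral_normSq_add_rpow q hε hf (ha.trans_le hy.1) (hy.2.trans_lt hxR)
  · refine intervalIntegral.tendsto_integral_filter_of_dominated_convergence
      (fun _ => 2 * q * (a⁻¹ * C)) ?_ ?_ (by simp) ?_
    · filter_upwards [self_mem_nhdsWithin] with ε hε
      exact (intervalIntegrable_iff.1 (hint ε hε)).aestronglyMeasurable
    · filter_upwards [Ioc_mem_nhdsGT one_pos] with ε hε
      refine Eventually.of_forall fun ρ hρ => ?_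
      rw [uIoc_of_le hax] at hρ
      have hρ0 : 0 < ρ := ha.trans hρ.1
      have h0 : 0 ≤ ∫ z in Metric.ball (0 : ℂ) ρ, regDensity f ε q z :=
        integral_nonneg fun z => regDensity_nonneg hε.1 hq z
      rw [Real.norm_of_nonneg (by positivity)]
      have := hC ε hε.1 hε.2 ρ hρ.2
      gcongr
      exact hρ.1.le
    · refine Eventually.of_forall fun ρ hρ => ?_
      rw [uIoc_of_le hax] at hρ
      exact ((tendsto_integral_regDensity hq hf (ha.trans hρ.1)
        (hρ.2.trans_lt hxR)).const_mul _).const_mul _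

theorem hasDerivAt_integral_norm_rpow {f : ℂ → ℂ} {R r q : ℝ} (hq : 0 < q)
    (hf : DifferentiableOn ℂ f (Metric.ball 0 R)) (hr : 0 < r) (hrR : r < R) :
    HasDerivAt (fun ρ : ℝ =>
        ∫ t in (0 : ℝ)..(2 * Real.pi), ‖f (ρ * Complex.exp (Complex.I * t))‖ ^ (2 * q))
      (2 * q * (r⁻¹ * (2 * q *
        ∫ z in Metric.ball (0 : ℂ) r, ‖deriv f z‖ ^ 2 * ‖f z‖ ^ (2 * (q - 1))))) r := by
  have hc : ContinuousOn (fun ρ => 2 * q * (ρ⁻¹ * (2 * q *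
      ∫ z in Metric.ball (0 : ℂ) ρ, ‖deriv f z‖ ^ 2 * ‖f z‖ ^ (2 * (q - 1))))) (Ioo 0 R) :=
    continuousOn_const.mul ((continuousOn_id.inv₀ fun y hy => hy.1.ne').mul
      (continuousOn_const.mul (continuousOn_setIntegral_ball fun r hr hrR =>
        integrableOn_norm_deriv_sq_mul_norm_rpow hq hf hr hrR)))
  have ha : 0 < r / 2 := half_pos hr
  have har : r / 2 < r := half_lt_self hr
  have hFTC := intervalIntegral.integral_hasDerivAt_right (a := r / 2)
    ((hc.mono (t := uIcc (r / 2) r) (by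
      rw [uIcc_of_le har.le]
      exact fun y hy => ⟨ha.trans_le hy.1, hy.2.trans_lt hrR⟩)).intervalIntegrable)
    (hc.stronglyMeasurableAtFilter isOpen_Ioo r ⟨hr, hrR⟩)
    (hc.continuousAt (Ioo_mem_nhds hr hrR))
  refine (hFTC.const_add (∫ t in (0 : ℝ)..(2 * Real.pi),
    ‖f ((r / 2 : ℝ) * Complex.exp (Complex.I * t))‖ ^ (2 * q))).congr_of_eventuallyEq ?_
  filter_upwards [Ioo_mem_nhds har hrR] with x hx
  rw [← integral_norm_rpow_sub_eq hq hf ha hx.1.le hx.2]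
  ring

end HardyStein

/-- Hardy–Stein identity: for p > 0, f holomorphic on 𝔻 and r ∈ (0,1),
d/dr M_p^p(r,f) = (p²/(2r)) ∫_{r𝔻} |f'(z)|² |f(z)|^{p-2} dA(z). -/
theorem statement11 (p : ℝ) (hp : 0 < p) (f : ℂ → ℂ)
    (hf : DifferentiableOn ℂ f unitDisk) (r : ℝ) (hr : r ∈ Set.Ioo (0 : ℝ) 1) :
    HasDerivAt
      (fun ρ : ℝ => (2 * Real.pi)⁻¹ *
        ∫ t in (0 : ℝ)..(2 * Real.pi), ‖f ((ρ : ℂ) * Complex.exp (Complex.I * (t : ℂ)))‖ ^ p)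
      (p ^ 2 / (2 * r) *
        ((Real.pi)⁻¹ * ∫ z in Metric.ball (0 : ℂ) r, ‖deriv f z‖ ^ 2 * ‖f z‖ ^ (p - 2)))
      r := by
  have h := hasDerivAt_integral_norm_rpow (half_pos hp) hf hr.1 hr.2
  rw [show 2 * (p / 2 - 1) = p - 2 by ring, show 2 * (p / 2) = p by ring] at h
  refine (h.const_mul (2 * Real.pi)⁻¹).congr_deriv ?_
  have := hr.1.ne'
  field_simp

end
end
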